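/- Let m be a non-negative integer and let x > 0 be real with x not an integer. Then ∑_{n=1}^∞ σ_{2m+1/2}(n) n^{−1/2} e^{−2π√(2nx)} sin(2π√(2nx)) = ζ(1/2−2m)/(2π√(2x)) − √2·( π√x + (2m)!/(√2·(2πx)^{2m+1}) )·ζ(−1/2−2m) + (√x/(√2·π^{2m+1/2})) ∑_{n=1}^∞ σ_{2m+1/2}(n) n^{−2m−3/2} [ −2·((2m)!/√π)·(n/(2x))^{2m+3/2}·( (1+in/x)^{−(2m+1)} + (1−in/x)^{−(2m+1)} ) + ((−1)^m n/(2^{2m} π x))·Γ(2m+1/2)·W_m(n,x) ], where W_m(n,x) denotes the convergent series ₃F₂(1/4, 3/4, 1; 1/4−m, 3/4−m; −n²/x²) when n < x, and denotes its analytic continuation 1 − ₃F₂(1/4+m, 3/4+m, 1; 1/4, 3/4; −x²/n²) (a convergent series since x < n) when n > x. -/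

import Mathlib

open Complex Finset
open scoped Real BigOperators Classical

/-- Generalized divisor sum `σ_r(n) = ∑_{d ∣ n} d^r` with real exponent. -/
noncomputable def rsigma (r : ℝ) (n : ℕ) : ℝ := ∑ d ∈ n.divisors, (d : ℝ) ^ r

/-- Rising factorial `(a)_k`. -/
noncomputable def poch (a : ℂ) (k : ℕ) : ℂ := ∏ i ∈ Finset.range k, (a + i)

/-- Generalized hypergeometric series `₃F₂`. -/
noncomputable def F32 (a₁ a₂ a₃ b₁ b₂ z : ℂ) : ℂ :=
  ∑' k : ℕ, poch a₁ k * poch a₂ k * poch a₃ k /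
    (poch b₁ k * poch b₂ k * (k.factorial : ℂ)) * z ^ k

/-- `W_m(n,x)`: the series `₃F₂(1/4,3/4,1;1/4−m,3/4−m;−n²/x²)` for `n < x`, and its
analytic continuation `1 − ₃F₂(1/4+m,3/4+m,1;1/4,3/4;−x²/n²)` for `n > x`. -/
noncomputable def Wm (m : ℕ) (n : ℕ) (x : ℝ) : ℂ :=
  if (n : ℝ) < x then
    F32 (1 / 4) (3 / 4) 1 (1 / 4 - (m : ℂ)) (3 / 4 - (m : ℂ)) (-(n : ℂ) ^ 2 / (x : ℂ) ^ 2)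
  else
    1 - F32 (1 / 4 + (m : ℂ)) (3 / 4 + (m : ℂ)) 1 (1 / 4) (3 / 4) (-(x : ℂ) ^ 2 / (n : ℂ) ^ 2)


namespace CS
open MeasureTheory Filter Topology

/-- half error function -/
noncomputable def erfh (z : ℝ) : ℝ := ∫ s in (0:ℝ)..z, Real.exp (-s ^ 2)

lemma erfh_hasDerivAt (z : ℝ) : HasDerivAt erfh (Real.exp (-z ^ 2)) z := by
  have hc : Continuous (fun s : ℝ => Real.exp (-s ^ 2)) := by fun_prop
  exact intervalIntegral.integral_hasDerivAt_right (hc.intervalIntegrable _ _)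
    (hc.stronglyMeasurableAtFilter _ _) hc.continuousAt

lemma erfh_atTop : Tendsto erfh atTop (𝓝 (√π / 2)) := by
  have h1 := intervalIntegral_tendsto_integral_Ioi (f := fun s : ℝ => Real.exp (-s ^ 2)) (0:ℝ)
    (μ := volume) (b := fun z : ℝ => z) (l := atTop)
    (by simpa using (integrable_exp_neg_mul_sq (b := 1) one_pos).integrableOn) tendsto_id
  have h2 := integral_gaussian_Ioi 1
  simp only [neg_mul, one_mul, div_one] at h2
  rw [h2] at h1
  exact h1

lemma erfh_neg (z : ℝ) : erfh (-z) = - erfh z := by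
  unfold erfh
  have := intervalIntegral.integral_comp_neg (a := 0) (b := z) (fun s : ℝ => Real.exp (-s ^ 2))
  simp only [neg_zero, even_two, Even.neg_pow] at this
  rw [intervalIntegral.integral_symm, ← this]

lemma erfh_atBot : Tendsto erfh atBot (𝓝 (-(√π / 2))) := by
  have h : erfh = fun z => - erfh (-z) := by funext z; rw [erfh_neg]; ring
  rw [h]
  exact (erfh_atTop.comp tendsto_neg_atBot_atTop).neg

lemma integral_Ioi_zero_of_nonneg {g g' : ℝ → ℝ} {l0 l : ℝ}
    (hd : ∀ v ∈ Set.Ioi (0:ℝ), HasDerivAt g (g' v) v) (hp : ∀ v ∈ Set.Ioi (0:ℝ), 0 ≤ g' v)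
    (h0 : Tendsto g (𝓝[>] 0) (𝓝 l0)) (h1 : Tendsto g atTop (𝓝 l)) :
    IntegrableOn g' (Set.Ioi 0) ∧ ∫ v in Set.Ioi (0:ℝ), g' v = l - l0 := by
  set G := Function.update g 0 l0 with hG
  have hcont : ContinuousWithinAt G (Set.Ici 0) 0 := by
    rw [hG, continuousWithinAt_update_same]
    simpa using h0
  have hd' : ∀ v ∈ Set.Ioi (0:ℝ), HasDerivAt G (g' v) v := by
    intro v hv
    refine (hd v hv).congr_of_eventuallyEq ?_
    filter_upwards [isOpen_Ioi.mem_nhds hv] with w hw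
    have hw' : (0:ℝ) < w := hw
    simp [hG, Function.update_of_ne (ne_of_gt hw')]
  have h1' : Tendsto G atTop (𝓝 l) := by
    refine h1.congr' ?_
    filter_upwards [eventually_gt_atTop 0] with w hw
    simp [hG, Function.update_of_ne (ne_of_gt hw)]
  refine ⟨integrableOn_Ioi_deriv_of_nonneg hcont hd' hp h1', ?_⟩
  rw [integral_Ioi_of_hasDerivAt_of_nonneg hcont hd' hp h1']
  simp [hG]

lemma rpow_neg_half_eq {v : ℝ} (hv : 0 < v) : v ^ (-(1/2) : ℝ) = √v / v := by
  rw [Real.rpow_neg hv.le, ← Real.sqrt_eq_rpow]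
  have := Real.sqrt_pos.2 hv
  field_simp
  rw [Real.sq_sqrt hv.le]

lemma rpow_neg_three_half_eq {v : ℝ} (hv : 0 < v) : v ^ (-(3/2) : ℝ) = 1 / (√v * v) := by
  rw [Real.rpow_neg hv.le, show (3/2 : ℝ) = 1/2 + 1 by norm_num, Real.rpow_add hv,
    ← Real.sqrt_eq_rpow, Real.rpow_one, one_div]

section levy
variable {a p : ℝ}

lemma levy_derivs (ha : 0 < a) (hp : 0 < p) {v : ℝ} (hv : 0 < v) :
    HasDerivAt (fun v => Real.exp (-(2 * √a * √p)) * erfh (√p * √v - √a / √v))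
      (Real.exp (-a / v - p * v) * (√p * √v + √a / √v) / (2 * v)) v ∧
    HasDerivAt (fun v => Real.exp ((2 * √a * √p)) * erfh (√p * √v + √a / √v))
      (Real.exp (-a / v - p * v) * (√p * √v - √a / √v) / (2 * v)) v := by
  have hs := Real.sqrt_pos.2 hv
  have hsq : √v ^ 2 = v := Real.sq_sqrt hv.le
  have hap : √a ^ 2 = a := Real.sq_sqrt ha.le
  have hpp : √p ^ 2 = p := Real.sq_sqrt hp.le
  have h1 : HasDerivAt (fun v => √v) (1 / (2 * √v)) v := Real.hasDerivAt_sqrt hv.ne'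
  have hU := h1.const_mul (√p)
  have hV := (hasDerivAt_const v (√a)).div h1 hs.ne'
  constructor
  · have h2 := ((erfh_hasDerivAt (√p * √v - √a / √v)).comp v (hU.sub hV)).const_mul
      (Real.exp (-(2 * √a * √p)))
    refine h2.congr_deriv ?_
    rw [← mul_assoc, ← Real.exp_add]
    have e1 : -(2 * √a * √p) + -(√p * √v - √a / √v) ^ 2 = -a / v - p * v := by
      have e2 : -a / v - p * v = -√a ^ 2 / √v ^ 2 - √p ^ 2 * √v ^ 2 := by rw [hap, hpp, hsq]
      rw [e2]; field_simp; ring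
    rw [e1, mul_div_assoc]
    congr 1
    nth_rewrite 7 [← hsq]
    field_simp; ring
  · have h2 := ((erfh_hasDerivAt (√p * √v + √a / √v)).comp v (hU.add hV)).const_mul
      (Real.exp ((2 * √a * √p)))
    refine h2.congr_deriv ?_
    rw [← mul_assoc, ← Real.exp_add]
    have e1 : (2 * √a * √p) + -(√p * √v + √a / √v) ^ 2 = -a / v - p * v := by
      have e2 : -a / v - p * v = -√a ^ 2 / √v ^ 2 - √p ^ 2 * √v ^ 2 := by rw [hap, hpp, hsq]
      rw [e2]; field_simp; ring
    rw [e1, mul_div_assoc]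
    congr 1
    nth_rewrite 7 [← hsq]
    field_simp; ring

lemma sqrt_zero_right : Tendsto (fun v : ℝ => √v) (𝓝[>] 0) (𝓝[>] 0) := by
  refine tendsto_nhdsWithin_iff.2 ⟨?_, ?_⟩
  · have := (Real.continuous_sqrt.tendsto 0)
    rw [Real.sqrt_zero] at this
    exact this.mono_left nhdsWithin_le_nhds
  · filter_upwards [self_mem_nhdsWithin] with v hv using Real.sqrt_pos.2 hv

lemma levy_lims (ha : 0 < a) (hp : 0 < p) :
    Tendsto (fun v : ℝ => √p * √v - √a / √v) (𝓝[>] 0) atBot ∧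
    Tendsto (fun v : ℝ => √p * √v + √a / √v) (𝓝[>] 0) atTop ∧
    Tendsto (fun v : ℝ => √p * √v - √a / √v) atTop atTop ∧
    Tendsto (fun v : ℝ => √p * √v + √a / √v) atTop atTop := by
  have hsa := Real.sqrt_pos.2 ha
  have hsp := Real.sqrt_pos.2 hp
  have h1 : Tendsto (fun v : ℝ => √p * √v) (𝓝[>] 0) (𝓝 0) := by
    simpa using (sqrt_zero_right.mono_right nhdsWithin_le_nhds).const_mul (√p)
  have h2 : Tendsto (fun v : ℝ => √a / √v) (𝓝[>] 0) atTop := by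
    simp_rw [div_eq_mul_inv]
    exact (tendsto_inv_nhdsGT_zero.comp sqrt_zero_right).const_mul_atTop hsa
  have h3 : Tendsto (fun v : ℝ => √p * √v) atTop atTop :=
    Real.tendsto_sqrt_atTop.const_mul_atTop hsp
  have h4 : Tendsto (fun v : ℝ => √a / √v) atTop (𝓝 0) :=
    Real.tendsto_sqrt_atTop.const_div_atTop _
  refine ⟨?_, h1.add_atTop h2, ?_, h3.atTop_add h4⟩
  · simp_rw [sub_eq_add_neg]
    exact h1.add_atBot (tendsto_neg_atTop_atBot.comp h2)
  · simp_rw [sub_eq_add_neg]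
    exact h3.atTop_add h4.neg

lemma levy_real_i (ha : 0 < a) (hp : 0 < p) :
    IntegrableOn (fun v => v ^ (-(1/2) : ℝ) * Real.exp (-a / v) * Real.exp (-p * v)) (Set.Ioi 0) ∧
    ∫ v in Set.Ioi (0:ℝ), v ^ (-(1/2) : ℝ) * Real.exp (-a / v) * Real.exp (-p * v)
      = √π / √p * Real.exp (-(2 * √a * √p)) := by
  obtain ⟨l1, l2, l3, l4⟩ := levy_lims ha hp
  have hsp := Real.sqrt_pos.2 hp
  have key := integral_Ioi_zero_of_nonneg
    (g := fun v => (Real.exp (-(2 * √a * √p)) * erfh (√p * √v - √a / √v)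
      + Real.exp ((2 * √a * √p)) * erfh (√p * √v + √a / √v)) / √p)
    (g' := fun v => v ^ (-(1/2) : ℝ) * Real.exp (-a / v) * Real.exp (-p * v))
    (l0 := (Real.exp (-(2 * √a * √p)) * (-(√π/2)) + Real.exp ((2 * √a * √p)) * (√π/2)) / √p)
    (l := (Real.exp (-(2 * √a * √p)) * ((√π/2)) + Real.exp ((2 * √a * √p)) * (√π/2)) / √p)
    ?_ ?_ ?_ ?_
  · refine ⟨key.1, key.2.trans ?_⟩
    field_simp; ring
  · intro v hv
    obtain ⟨d1, d2⟩ := levy_derivs ha hp hv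
    refine ((d1.add d2).div_const (√p)).congr_deriv ?_
    have hv' : 0 < v := hv
    rw [rpow_neg_half_eq hv', mul_assoc, ← Real.exp_add, show -a / v + -p * v = -a / v - p * v by ring]
    field_simp; ring
  · intro v hv
    have hv' : 0 < v := hv
    positivity
  · exact (((erfh_atBot.comp l1).const_mul _).add ((erfh_atTop.comp l2).const_mul _)).div_const _
  · exact (((erfh_atTop.comp l3).const_mul _).add ((erfh_atTop.comp l4).const_mul _)).div_const _

lemma levy_real_ii (ha : 0 < a) (hp : 0 < p) :
    IntegrableOn (fun v => v ^ (-(3/2) : ℝ) * Real.exp (-a / v) * Real.exp (-p * v)) (Set.Ioi 0) ∧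
    ∫ v in Set.Ioi (0:ℝ), v ^ (-(3/2) : ℝ) * Real.exp (-a / v) * Real.exp (-p * v)
      = √π / √a * Real.exp (-(2 * √a * √p)) := by
  obtain ⟨l1, l2, l3, l4⟩ := levy_lims ha hp
  have hsa := Real.sqrt_pos.2 ha
  have key := integral_Ioi_zero_of_nonneg
    (g := fun v => (Real.exp (-(2 * √a * √p)) * erfh (√p * √v - √a / √v)
      - Real.exp ((2 * √a * √p)) * erfh (√p * √v + √a / √v)) / √a)
    (g' := fun v => v ^ (-(3/2) : ℝ) * Real.exp (-a / v) * Real.exp (-p * v))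
    (l0 := (Real.exp (-(2 * √a * √p)) * (-(√π/2)) - Real.exp ((2 * √a * √p)) * (√π/2)) / √a)
    (l := (Real.exp (-(2 * √a * √p)) * ((√π/2)) - Real.exp ((2 * √a * √p)) * (√π/2)) / √a)
    ?_ ?_ ?_ ?_
  · refine ⟨key.1, key.2.trans ?_⟩
    field_simp; ring
  · intro v hv
    obtain ⟨d1, d2⟩ := levy_derivs ha hp hv
    refine ((d1.sub d2).div_const (√a)).congr_deriv ?_
    have hv' : 0 < v := hv
    have hs := Real.sqrt_pos.2 hv'
    rw [rpow_neg_three_half_eq hv', mul_assoc, ← Real.exp_add,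
      show -a / v + -p * v = -a / v - p * v by ring]
    field_simp; ring
  · intro v hv
    have hv' : 0 < v := hv
    positivity
  · exact (((erfh_atBot.comp l1).const_mul _).sub ((erfh_atTop.comp l2).const_mul _)).div_const _
  · exact (((erfh_atTop.comp l3).const_mul _).sub ((erfh_atTop.comp l4).const_mul _)).div_const _

end levy

/-- Laplace transforms are holomorphic on the right half-plane. -/
lemma laplace_diff {f : ℝ → ℝ}
    (hf : ∀ c : ℝ, 0 < c → IntegrableOn (fun v => f v * Real.exp (-c * v)) (Set.Ioi 0)) :
    DifferentiableOn ℂ (fun p : ℂ => ∫ v in Set.Ioi (0:ℝ), (f v : ℂ) * cexp (-p * v))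
      {p | 0 < p.re} := by
  intro p0 hp0
  simp only [Set.mem_ofPred_eq] at hp0
  set c := p0.re / 4 with hc
  have hc0 : 0 < c := by positivity
  have hfm : AEStronglyMeasurable f (volume.restrict (Set.Ioi 0)) := by
    have h1 := (hf 1 one_pos).aestronglyMeasurable
    have h2 : AEStronglyMeasurable (fun v : ℝ => Real.exp v) (volume.restrict (Set.Ioi 0)) := by
      exact (Real.continuous_exp).aestronglyMeasurable
    refine (h1.mul h2).congr (Eventually.of_forall fun v => ?_)
    simp [mul_assoc, ← Real.exp_add]
  have hfmc : AEStronglyMeasurable (fun v => (f v : ℂ)) (volume.restrict (Set.Ioi 0)) :=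
    Complex.continuous_ofReal.comp_aestronglyMeasurable hfm
  have hFm : ∀ p : ℂ, AEStronglyMeasurable (fun v : ℝ => (f v : ℂ) * cexp (-p * v))
      (volume.restrict (Set.Ioi 0)) := fun p =>
    hfmc.mul (by fun_prop : Continuous fun v : ℝ => cexp (-p * v)).aestronglyMeasurable
  have := (hasDerivAt_integral_of_dominated_loc_of_deriv_le (μ := volume.restrict (Set.Ioi 0))
    (F := fun (p : ℂ) (v : ℝ) => (f v : ℂ) * cexp (-p * v))
    (F' := fun (p : ℂ) (v : ℝ) => (f v : ℂ) * (cexp (-p * v) * (-v)))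
    (bound := fun v : ℝ => |f v * Real.exp (-c * v)| * (1 / c))
    (s := Metric.ball p0 c) (x₀ := p0) (Metric.ball_mem_nhds _ hc0)
    (Eventually.of_forall hFm) ?_ ?_ ?_ ?_ ?_).2
  · exact this.differentiableAt.differentiableWithinAt
  · refine Integrable.mono (hf _ hp0) (hFm p0) (Eventually.of_forall fun v => ?_)
    simp [Complex.norm_exp]
  · exact hfmc.mul (by fun_prop : Continuous fun v : ℝ => cexp (-p0 * v) * (-v)).aestronglyMeasurable
  · refine (ae_restrict_iff' measurableSet_Ioi).2 (Eventually.of_forall fun v hv p hp => ?_)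
    have hv' : (0:ℝ) < v := hv
    have hpre : 2 * c ≤ p.re := by
      have h1 : |(p - p0).re| ≤ ‖p - p0‖ := Complex.abs_re_le_norm _
      have h2 : ‖p - p0‖ < c := by simpa [dist_eq_norm] using hp
      have h3 := (abs_le.1 h1).1
      simp only [Complex.sub_re] at h3
      linarith
    have e1 : ‖(f v : ℂ) * (cexp (-p * v) * (-v))‖ = |f v| * (Real.exp (-(p.re * v)) * v) := by
      simp [Complex.norm_exp, abs_of_pos hv']
    rw [e1, abs_mul, Real.abs_exp, mul_assoc]
    refine mul_le_mul_of_nonneg_left ?_ (abs_nonneg _)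
    have h4 : Real.exp (-(p.re * v)) ≤ Real.exp (-c * v) * Real.exp (-(c * v)) := by
      rw [← Real.exp_add]
      apply Real.exp_le_exp.2
      nlinarith
    have h5 : v * Real.exp (-(c * v)) ≤ 1 / c := by
      rw [Real.exp_neg, ← div_eq_mul_inv, div_le_div_iff₀ (Real.exp_pos _) hc0]
      have := Real.add_one_le_exp (c * v)
      linarith
    calc Real.exp (-(p.re * v)) * v ≤ Real.exp (-c * v) * Real.exp (-(c * v)) * v := by gcongr
      _ = Real.exp (-c * v) * (v * Real.exp (-(c * v))) := by ring
      _ ≤ _ := by gcongr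
  · exact ((hf c hc0).abs).mul_const _
  · refine Eventually.of_forall fun v p hp => ?_
    have h1 : HasDerivAt (fun p : ℂ => -p * v) (-v : ℂ) p := by
      simpa using ((hasDerivAt_id p).neg.mul_const (v : ℂ))
    exact (h1.cexp).const_mul _

lemma eq_on_half_plane {F G : ℂ → ℂ} (hF : DifferentiableOn ℂ F {p | 0 < p.re})
    (hG : DifferentiableOn ℂ G {p | 0 < p.re}) (h : ∀ p : ℝ, 0 < p → F p = G p) :
    ∀ p : ℂ, 0 < p.re → F p = G p := by
  have hop : IsOpen {p : ℂ | 0 < p.re} := isOpen_lt continuous_const Complex.continuous_re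
  have hpc : IsPreconnected {p : ℂ | 0 < p.re} := (convex_halfSpace_re_gt 0).isPreconnected
  have := (hF.analyticOnNhd hop).eqOn_of_preconnected_of_frequently_eq (hG.analyticOnNhd hop) hpc
    (z₀ := 1) (by simp) ?_
  · exact fun p hp => this hp
  · have ht : Tendsto (fun n : ℕ => ((1 + 1 / ((n:ℝ) + 1) : ℝ) : ℂ)) atTop (𝓝[≠] 1) := by
      refine tendsto_nhdsWithin_iff.2 ⟨?_, Eventually.of_forall fun n => ?_⟩
      · have h1 := (tendsto_one_div_add_atTop_nhds_zero_nat (𝕜 := ℝ)).const_add 1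
        have := (Complex.continuous_ofReal.tendsto _).comp h1
        simpa [Function.comp_def] using this
      · have : (0:ℝ) < 1 / ((n:ℝ)+1) := by positivity
        simp only [Set.mem_compl_iff, Set.mem_singleton_iff]
        intro hh
        have h2 : ((1 + 1 / ((n:ℝ) + 1) : ℝ)) = 1 := by exact_mod_cast hh
        linarith
    refine ht.frequently (Eventually.frequently (Eventually.of_forall fun n => h _ ?_))
    positivity

lemma levy_i {a : ℝ} (ha : 0 < a) {p : ℂ} (hp : 0 < p.re) :
    ∫ v in Set.Ioi (0:ℝ), ((v ^ (-(1/2) : ℝ) * Real.exp (-a / v) : ℝ) : ℂ) * cexp (-p * v)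
      = √π / p ^ (1/2 : ℂ) * cexp (-(2 * √a * p ^ (1/2 : ℂ))) := by
  have hcp : DifferentiableOn ℂ (fun p : ℂ => p ^ (1/2 : ℂ)) {p | 0 < p.re} := by
    intro p hp
    exact (DifferentiableAt.cpow (differentiableAt_id) (differentiableAt_const _)
      (Or.inl hp)).differentiableWithinAt
  refine eq_on_half_plane (laplace_diff fun c hc => (levy_real_i ha hc).1)
    (G := fun p => √π / p ^ (1/2 : ℂ) * cexp (-(2 * √a * p ^ (1/2 : ℂ)))) ?_ ?_ p hp
  · refine ((differentiableOn_const _).div hcp fun p hp => ?_).mul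
      (((differentiableOn_const _).mul hcp).neg.cexp)
    have : p ≠ 0 := by rintro rfl; simp at hp
    simp [Complex.cpow_eq_zero_iff, this]
  · intro p hp
    have h1 : (p : ℂ) ^ (1/2 : ℂ) = (√p : ℝ) := by
      rw [Real.sqrt_eq_rpow, Complex.ofReal_cpow hp.le]; norm_num
    simp only [h1]
    have := (levy_real_i ha hp).2
    rw [← Complex.ofReal_inj] at this
    push_cast at this ⊢
    rw [← this, ← integral_complex_ofReal]
    refine integral_congr_ae (Eventually.of_forall fun v => ?_)
    simp only; push_cast; ring

lemma levy_ii {a : ℝ} (ha : 0 < a) {p : ℂ} (hp : 0 < p.re) :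
    ∫ v in Set.Ioi (0:ℝ), ((v ^ (-(3/2) : ℝ) * Real.exp (-a / v) : ℝ) : ℂ) * cexp (-p * v)
      = √π / √a * cexp (-(2 * √a * p ^ (1/2 : ℂ))) := by
  have hcp : DifferentiableOn ℂ (fun p : ℂ => p ^ (1/2 : ℂ)) {p | 0 < p.re} := by
    intro p hp
    exact (DifferentiableAt.cpow (differentiableAt_id) (differentiableAt_const _)
      (Or.inl hp)).differentiableWithinAt
  refine eq_on_half_plane (laplace_diff fun c hc => (levy_real_ii ha hc).1)
    (G := fun p => √π / √a * cexp (-(2 * √a * p ^ (1/2 : ℂ)))) ?_ ?_ p hp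
  · exact ((differentiableOn_const _)).mul
      (((differentiableOn_const _).mul hcp).neg.cexp)
  · intro p hp
    have h1 : (p : ℂ) ^ (1/2 : ℂ) = (√p : ℝ) := by
      rw [Real.sqrt_eq_rpow, Complex.ofReal_cpow hp.le]; norm_num
    simp only [h1]
    have := (levy_real_ii ha hp).2
    rw [← Complex.ofReal_inj] at this
    push_cast at this ⊢
    rw [← this, ← integral_complex_ofReal]
    refine integral_congr_ae (Eventually.of_forall fun v => ?_)
    simp only; push_cast; ring

end CS

namespace CS
open MeasureTheory Filter Topology

lemma int_pow_exp (n : ℕ) {c : ℝ} (hc : 0 < c) :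
    IntegrableOn (fun t : ℝ => t ^ n * Real.exp (-c * t)) (Set.Ioi 0) := by
  have := integrableOn_rpow_mul_exp_neg_mul_rpow (p := 1) (s := n) (b := c)
    (by linarith [(Nat.cast_nonneg n : (0:ℝ) ≤ n)]) one_pos hc
  simpa using this

lemma int_pow_exp_sqrt (n : ℕ) {c : ℝ} (hc : 0 < c) :
    IntegrableOn (fun t : ℝ => t ^ n * Real.exp (-c * √t)) (Set.Ioi 0) := by
  have := integrableOn_rpow_mul_exp_neg_mul_rpow (p := 1/2) (s := n) (b := c)
    (by linarith [(Nat.cast_nonneg n : (0:ℝ) ≤ n)]) (by norm_num) hc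
  simpa [Real.sqrt_eq_rpow] using this

lemma int_rpow_exp {s : ℝ} (hs : -1 < s) {c : ℝ} (hc : 0 < c) :
    IntegrableOn (fun t : ℝ => t ^ s * Real.exp (-c * t)) (Set.Ioi 0) := by
  have := integrableOn_rpow_mul_exp_neg_mul_rpow (p := 1) (s := s) (b := c) hs one_pos hc
  simpa using this

lemma laplace_pow (n : ℕ) {p : ℂ} (hp : 0 < p.re) :
    ∫ t in Set.Ioi (0:ℝ), ((t ^ n : ℝ) : ℂ) * cexp (-p * t) = n.factorial / p ^ (n + 1) := by
  refine eq_on_half_plane (laplace_diff fun c hc => int_pow_exp n hc)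
    (G := fun p => n.factorial / p ^ (n + 1)) ?_ ?_ p hp
  · intro p hp
    have : p ≠ 0 := by rintro rfl; simp at hp
    have h2 : DifferentiableAt ℂ (fun p : ℂ => p ^ (n + 1)) p := by fun_prop
    exact ((differentiableAt_const _).div h2 (pow_ne_zero _ this)).differentiableWithinAt
  · intro p hp
    have h := Real.integral_rpow_mul_exp_neg_mul_Ioi (a := n + 1) (r := p) (by positivity) hp
    rw [Real.Gamma_nat_eq_factorial] at h
    rw [← Complex.ofReal_inj] at h
    rw [← integral_complex_ofReal] at h
    have e : ((((1 / p) ^ ((n:ℝ) + 1) * (n.factorial : ℝ) : ℝ)) : ℂ) = n.factorial / (p:ℂ) ^ (n + 1) := by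
      have : (1 / p) ^ ((n:ℝ) + 1) = (1 / p) ^ (n + 1) := by
        rw [← Real.rpow_natCast]; push_cast; rfl
      rw [this]; push_cast; rw [one_div, inv_pow]; ring
    rw [e] at h
    rw [← h]
    refine integral_congr_ae (Eventually.of_forall fun v => ?_)
    simp only; push_cast; simp

/-- the even rational function -/
noncomputable def Q (m : ℕ) (u : ℝ) : ℝ := ((((1:ℂ) + I * u) ^ (2 * m + 1))⁻¹).re

lemma re_pow_le (m : ℕ) (u : ℝ) :
    |((((1:ℂ) + I * u) ^ (2 * m + 1))).re| ≤ (2 * m + 1) * (1 + u ^ 2) ^ m := by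
  set z : ℂ := 1 + I * u with hz
  have hn : ‖z‖ ^ 2 = 1 + u ^ 2 := by
    rw [← Complex.normSq_eq_norm_sq, Complex.normSq_apply]; simp [hz]; ring
  induction m with
  | zero => simp [hz]
  | succ k ih =>
    have e : z ^ (2 * (k + 1) + 1) = z ^ (2 * k + 1) * z ^ 2 := by ring
    have hz2r : (z ^ 2).re = 1 - u ^ 2 := by simp [hz, pow_two]
    have hz2i : (z ^ 2).im = 2 * u := by simp [hz, pow_two]; ring
    rw [e, Complex.mul_re, hz2r, hz2i]
    have h1 : |1 - u ^ 2| ≤ 1 + u ^ 2 := by rw [abs_le]; constructor <;> nlinarith [sq_nonneg u]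
    have h2 : |(z ^ (2 * k + 1)).im| * |u| ≤ (1 + u ^ 2) ^ (k + 1) := by
      have h3 : |(z ^ (2 * k + 1)).im| ≤ ‖z‖ ^ (2 * k + 1) := by
        rw [← norm_pow]; exact Complex.abs_im_le_norm _
      have h4 : |u| ≤ ‖z‖ := by
        have := Complex.abs_im_le_norm z
        simpa [hz] using this
      calc _ ≤ ‖z‖ ^ (2 * k + 1) * ‖z‖ := by gcongr
        _ = (‖z‖ ^ 2) ^ (k + 1) := by ring
        _ = _ := by rw [hn]
    calc |(z ^ (2 * k + 1)).re * (1 - u ^ 2) - (z ^ (2 * k + 1)).im * (2 * u)|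
        ≤ |(z ^ (2 * k + 1)).re| * |1 - u ^ 2| + 2 * (|(z ^ (2 * k + 1)).im| * |u|) := by
          refine (abs_sub _ _).trans ?_
          rw [abs_mul, abs_mul, abs_mul, abs_two]; apply le_of_eq; ring
      _ ≤ ((2 * k + 1) * (1 + u ^ 2) ^ k) * (1 + u ^ 2) + 2 * (1 + u ^ 2) ^ (k + 1) := by gcongr
      _ = _ := by push_cast; ring

lemma Q_abs_le (m : ℕ) (u : ℝ) : |Q m u| ≤ (2 * m + 1) / (1 + u ^ 2) ^ (m + 1) := by
  unfold Q
  have hn : Complex.normSq ((1 : ℂ) + I * u) = 1 + u ^ 2 := by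
    rw [Complex.normSq_apply]; simp; ring
  rw [Complex.inv_re, map_pow, hn, abs_div, abs_of_pos (by positivity : 0 < (1 + u ^ 2) ^ (2 * m + 1)),
    div_le_div_iff₀ (by positivity) (by positivity)]
  calc _ ≤ (2 * m + 1) * (1 + u ^ 2) ^ m * (1 + u ^ 2) ^ (m + 1) := by
        gcongr; exact re_pow_le m u
    _ = _ := by ring

lemma one_add_I_ne (u : ℝ) : (1:ℂ) + I * u ≠ 0 := by
  intro h
  have := congrArg Complex.re h
  simp at this

lemma Q_cont (m : ℕ) : Continuous (Q m) := by
  unfold Q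
  refine Complex.continuous_re.comp (Continuous.inv₀ (by fun_prop) fun u => ?_)
  exact pow_ne_zero _ (one_add_I_ne u)

lemma Q_even (m : ℕ) (u : ℝ) : Q m (-u) = Q m u := by
  unfold Q
  have : (((1:ℂ) + I * ((-u : ℝ) : ℂ)) ^ (2 * m + 1))⁻¹
      = (starRingEnd ℂ) ((((1:ℂ) + I * u) ^ (2 * m + 1))⁻¹) := by
    simp [map_pow]
  rw [this, Complex.conj_re]

/-- integrability of `√u/(1+(cu)²)` -/
lemma int_base {c : ℝ} (hc : 0 < c) :
    IntegrableOn (fun v : ℝ => v ^ (1/2 : ℝ) / (1 + (c * v) ^ 2)) (Set.Ioi 0) := by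
  have h0 : Set.Ioi (0:ℝ) = Set.Ioc 0 1 ∪ Set.Ioi 1 := (Set.Ioc_union_Ioi_eq_Ioi zero_le_one).symm
  have hm : Measurable (fun v : ℝ => v ^ (1/2 : ℝ) / (1 + (c * v) ^ 2)) := by fun_prop
  rw [h0]
  refine IntegrableOn.union ?_ ?_
  · have h1 : IntegrableOn (fun v : ℝ => v ^ (1/2 : ℝ)) (Set.Ioc 0 1) :=
      (intervalIntegrable_iff_integrableOn_Ioc_of_le zero_le_one).1
        (intervalIntegral.intervalIntegrable_rpow' (by norm_num))
    refine Integrable.mono h1 hm.aestronglyMeasurable ?_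
    refine (ae_restrict_iff' measurableSet_Ioc).2 (Eventually.of_forall fun v hv => ?_)
    have hv0 : 0 < v := hv.1
    rw [Real.norm_eq_abs, Real.norm_eq_abs, abs_of_pos (by positivity), abs_of_pos (by positivity)]
    exact div_le_self (by positivity) (by nlinarith [sq_nonneg (c * v)])
  · have h1 := (integrableOn_Ioi_rpow_of_lt (a := -(3/2)) (c := 1) (by norm_num) one_pos).const_mul (1 / c ^ 2)
    refine Integrable.mono h1 hm.aestronglyMeasurable ?_
    refine (ae_restrict_iff' measurableSet_Ioi).2 (Eventually.of_forall fun v hv => ?_)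
    have hv0 : 0 < v := lt_trans one_pos hv
    rw [Real.norm_eq_abs, Real.norm_eq_abs, abs_of_pos (by positivity), abs_of_pos (by positivity),
      show (-(3/2) : ℝ) = 1/2 - (2:ℕ) by norm_num, Real.rpow_sub hv0, Real.rpow_natCast]
    rw [div_mul_div_comm, one_mul, ← mul_pow]
    gcongr
    linarith [sq_nonneg (c * v)]

/-- base constant -/
noncomputable def Abase : ℝ := ∫ u in Set.Ioi (0:ℝ), u ^ (1/2 : ℝ) / (1 + u ^ 2)

lemma Abase_nonneg : 0 ≤ Abase :=
  setIntegral_nonneg measurableSet_Ioi fun u hu => by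
    have : (0:ℝ) < u := hu
    positivity

lemma integral_base {c : ℝ} (hc : 0 < c) :
    ∫ v in Set.Ioi (0:ℝ), v ^ (1/2 : ℝ) / (1 + (c * v) ^ 2) = c ^ (-(3/2) : ℝ) * Abase := by
  have h := MeasureTheory.integral_comp_mul_left_Ioi (fun u : ℝ => u ^ (1/2 : ℝ) / (1 + u ^ 2)) 0 hc
  rw [mul_zero, smul_eq_mul] at h
  have e : ∫ v in Set.Ioi (0:ℝ), v ^ (1/2 : ℝ) / (1 + (c * v) ^ 2)
      = c ^ (-(1/2) : ℝ) * ∫ v in Set.Ioi (0:ℝ), (c * v) ^ (1/2 : ℝ) / (1 + (c * v) ^ 2) := by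
    rw [← integral_const_mul]
    refine setIntegral_congr_fun measurableSet_Ioi fun v hv => ?_
    have hv0 : 0 < v := hv
    rw [Real.mul_rpow hc.le hv0.le, ← mul_div_assoc, ← mul_assoc, ← Real.rpow_add hc]
    norm_num
  rw [e, h, ← mul_assoc, Abase, ← Real.rpow_neg_one, ← Real.rpow_add hc]
  norm_num

lemma GQ_bound (m : ℕ) {c v : ℝ} (hc : 0 < c) (hv : 0 < v) :
    |v ^ (2 * m + 1/2 : ℝ) * Q m (c * v)| ≤
      (2 * m + 1) * (c ^ (2 * m))⁻¹ * (v ^ (1/2 : ℝ) / (1 + (c * v) ^ 2)) := by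
  rw [abs_mul, abs_of_pos (by positivity : 0 < v ^ (2 * m + 1/2 : ℝ))]
  have h1 : v ^ (2 * m + 1/2 : ℝ) = v ^ (2 * m) * v ^ (1/2 : ℝ) := by
    rw [Real.rpow_add hv]; congr 1; rw [← Real.rpow_natCast]; push_cast; rfl
  rw [h1]
  calc _ ≤ v ^ (2 * m) * v ^ (1/2 : ℝ) * ((2 * m + 1) / (1 + (c * v) ^ 2) ^ (m + 1)) := by
        gcongr; exact Q_abs_le m _
    _ = (2 * m + 1) * (c ^ (2 * m))⁻¹ * v ^ (1/2 : ℝ) / (1 + (c * v) ^ 2) *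
        (((c * v) ^ 2) ^ m / (1 + (c * v) ^ 2) ^ m) := by
        rw [← pow_mul, mul_pow, mul_pow, pow_succ (1 + c ^ 2 * v ^ 2) m]
        field_simp
        try ring
    _ ≤ (2 * m + 1) * (c ^ (2 * m))⁻¹ * v ^ (1/2 : ℝ) / (1 + (c * v) ^ 2) * 1 := by
        gcongr
        rw [div_le_one (by positivity)]
        gcongr
        linarith
    _ = _ := by ring

lemma GQ_meas (m : ℕ) (c : ℝ) : Measurable (fun v : ℝ => v ^ (2 * m + 1/2 : ℝ) * Q m (c * v)) := by
  have := (Q_cont m).measurable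
  fun_prop

lemma GQ_int (m : ℕ) {c : ℝ} (hc : 0 < c) :
    IntegrableOn (fun v : ℝ => v ^ (2 * m + 1/2 : ℝ) * Q m (c * v)) (Set.Ioi 0) := by
  refine Integrable.mono' ((int_base hc).const_mul ((2 * m + 1) * (c ^ (2 * m))⁻¹))
    (GQ_meas m c).aestronglyMeasurable ?_
  refine (ae_restrict_iff' measurableSet_Ioi).2 (Eventually.of_forall fun v hv => ?_)
  exact GQ_bound m hc hv

/-- abbreviation -/
noncomputable def al (x : ℝ) : ℝ := 2 * π * √(2 * x)

/-- kernel -/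
noncomputable def Kf (x t : ℝ) : ℂ := cexp (-((1 + I) * ((al x * √t : ℝ) : ℂ)))

/-- the cosine transform -/
noncomputable def Jc (m : ℕ) (x ξ : ℝ) : ℂ :=
  ∫ t in Set.Ioi (0:ℝ), ((t ^ (2 * m) * Real.cos (2 * π * ξ * t) : ℝ) : ℂ) * Kf x t

noncomputable def Cp (m : ℕ) (x : ℝ) : ℝ := (2 * m).factorial / (2 * π * x) ^ (2 * m + 1)

lemma inner_t (m : ℕ) {x v : ℝ} (ξ : ℝ) (hx : 0 < x) (hv : 0 < v) :
    ∫ t in Set.Ioi (0:ℝ), t ^ (2 * m) * Real.cos (2 * π * ξ * t) * Real.exp (-(2 * π * x * t) / v)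
      = Cp m x * (v ^ (2 * m + 1) * Q m (ξ / x * v)) := by
  have hre : 0 < (((2 * π * x / v : ℝ) : ℂ) + I * (2 * π * ξ : ℝ)).re := by
    have : 0 < 2 * π * x / v := by positivity
    simpa using this
  have h := laplace_pow (2 * m) hre
  have h_intg : Integrable (fun t : ℝ => ((t ^ (2 * m) : ℝ) : ℂ) *
      cexp (-(((2 * π * x / v : ℝ) : ℂ) + I * (2 * π * ξ : ℝ)) * t)) (volume.restrict (Set.Ioi 0)) := by
    refine Integrable.mono (int_pow_exp (2 * m) (c := 2 * π * x / v) (by positivity)) ?_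
      (Eventually.of_forall fun t => ?_)
    · exact (by fun_prop : Continuous _).aestronglyMeasurable
    · rw [norm_mul, norm_mul, Complex.norm_exp]; simp
  have h2 := congrArg Complex.re h
  rw [show (∫ t in Set.Ioi (0:ℝ), ((t ^ (2 * m) : ℝ) : ℂ) *
      cexp (-(((2 * π * x / v : ℝ) : ℂ) + I * (2 * π * ξ : ℝ)) * t)).re = ∫ t in Set.Ioi (0:ℝ), (((t ^ (2 * m) : ℝ) : ℂ) *
      cexp (-(((2 * π * x / v : ℝ) : ℂ) + I * (2 * π * ξ : ℝ)) * t)).re from (integral_re h_intg).symm] at h2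
  rw [show (∫ t in Set.Ioi (0:ℝ), t ^ (2 * m) * Real.cos (2 * π * ξ * t) * Real.exp (-(2 * π * x * t) / v))
    = ∫ t in Set.Ioi (0:ℝ), (((t ^ (2 * m) : ℝ) : ℂ) *
      cexp (-(((2 * π * x / v : ℝ) : ℂ) + I * (2 * π * ξ : ℝ)) * t)).re from ?_, h2]
  · have e : ((2 * π * x / v : ℝ) : ℂ) + I * (2 * π * ξ : ℝ) =
        ((2 * π * x / v : ℝ) : ℂ) * (1 + I * ((ξ / x * v : ℝ) : ℂ)) := by
      have hx' : (x : ℂ) ≠ 0 := by exact_mod_cast hx.ne'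
      have hv' : (v : ℂ) ≠ 0 := by exact_mod_cast hv.ne'
      push_cast; field_simp
    rw [e, mul_pow, div_mul_eq_div_div, div_eq_mul_inv]
    have e2 : ((2 * m).factorial : ℂ) / ((2 * π * x / v : ℝ) : ℂ) ^ (2 * m + 1)
        = ((Cp m x * v ^ (2 * m + 1) : ℝ) : ℂ) := by
      unfold Cp
      have hx' : (x : ℂ) ≠ 0 := by exact_mod_cast hx.ne'
      have hv' : (v : ℂ) ≠ 0 := by exact_mod_cast hv.ne'
      push_cast
      rw [div_pow]; field_simp
    rw [e2, Complex.re_ofReal_mul, Q]; ring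
  · refine integral_congr_ae (Eventually.of_forall fun t => ?_)
    simp only
    rw [Complex.re_ofReal_mul, Complex.exp_re]
    have e3 : (-(((2 * π * x / v : ℝ) : ℂ) + I * (2 * π * ξ : ℝ)) * t).re = -(2 * π * x * t) / v := by
      simp; ring
    have e4 : (-(((2 * π * x / v : ℝ) : ℂ) + I * (2 * π * ξ : ℝ)) * t).im = -(2 * π * ξ * t) := by
      simp
    rw [e3, e4, Real.cos_neg]; ring

end CS

namespace CS
open MeasureTheory Filter Topology

lemma csqrt_2pii {t : ℝ} (ht : 0 < t) :
    ((2 * π * t : ℝ) * I : ℂ) ^ (1/2 : ℂ) = (√(π * t) : ℝ) * (1 + I) := by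
  have h : (((√(π * t) : ℝ) : ℂ) * (1 + I)) ^ 2 = (2 * π * t : ℝ) * I := by
    rw [mul_pow, ← Complex.ofReal_pow, Real.sq_sqrt (by positivity)]
    have : (1 + I) ^ 2 = 2 * I := by
      rw [add_sq, Complex.I_sq]; ring
    rw [this]; push_cast; ring
  rw [← h]
  have harg : Complex.arg (((√(π * t) : ℝ) : ℂ) * (1 + I)) = π / 4 := by
    rw [Complex.arg_real_mul _ (by positivity)]
    rw [Complex.arg_of_re_nonneg (by simp)]
    have h2 : ‖(1 + I : ℂ)‖ = √2 := by
      rw [Complex.norm_def, Complex.normSq_apply]; norm_num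
    rw [h2]
    simp only [add_im, one_im, I_im, zero_add]
    rw [show (1 / √2 : ℝ) = Real.sin (π / 4) by
      rw [Real.sin_pi_div_four]
      have : (0:ℝ) < √2 := by positivity
      field_simp; rw [Real.sq_sqrt (by norm_num)]]
    exact Real.arcsin_sin (by linarith [Real.pi_pos]) (by linarith [Real.pi_pos])
  rw [show (1/2 : ℂ) = ((2:ℕ) : ℂ)⁻¹ by norm_num]
  refine Complex.pow_cpow_nat_inv two_ne_zero ?_ ?_ 
  · rw [harg]; push_cast; linarith [Real.pi_pos]
  · rw [harg]; push_cast; linarith [Real.pi_pos]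

lemma tendsto_csqrt {t : ℝ} (ht : 0 < t) :
    Tendsto (fun ε : ℝ => ((ε : ℂ) + (2 * π * t : ℝ) * I) ^ (1/2 : ℂ)) (𝓝[>] 0)
      (𝓝 ((√(π * t) : ℝ) * (1 + I))) := by
  rw [← csqrt_2pii ht]
  have hc : ContinuousAt (fun z : ℂ => z ^ (1/2 : ℂ)) ((2 * π * t : ℝ) * I) := by
    refine continuousAt_cpow_const ?_
    rw [Complex.mem_slitPlane_iff]
    right
    have : 2 * π * t ≠ 0 := by positivity
    simpa using this
  have h1 : Tendsto (fun ε : ℝ => ((ε : ℂ) + (2 * π * t : ℝ) * I)) (𝓝[>] 0) (𝓝 ((2 * π * t : ℝ) * I)) := by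
    have : Continuous (fun ε : ℝ => ((ε : ℂ) + (2 * π * t : ℝ) * I)) := by fun_prop
    have h := this.tendsto 0
    simp only [ofReal_zero, zero_add] at h
    exact h.mono_left nhdsWithin_le_nhds
  exact hc.tendsto.comp h1

lemma fubini_p (m : ℕ) {x : ℝ} (ξ : ℝ) (hx : 0 < x) {p : ℂ} (hp : 0 < p.re) :
    ∫ t in Set.Ioi (0:ℝ), ((t ^ (2 * m) * Real.cos (2 * π * ξ * t) : ℝ) : ℂ) *
        (√π / p ^ (1/2 : ℂ) * cexp (-(2 * √(2 * π * x * t) * p ^ (1/2 : ℂ))))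
      = Cp m x * ∫ v in Set.Ioi (0:ℝ), ((v ^ (2 * m + 1/2 : ℝ) * Q m (ξ / x * v) : ℝ) : ℂ) *
          cexp (-p * v) := by
  have step1 : ∀ t ∈ Set.Ioi (0:ℝ), ((t ^ (2 * m) * Real.cos (2 * π * ξ * t) : ℝ) : ℂ) *
        (√π / p ^ (1/2 : ℂ) * cexp (-(2 * √(2 * π * x * t) * p ^ (1/2 : ℂ))))
      = ∫ v in Set.Ioi (0:ℝ), ((t ^ (2 * m) * Real.cos (2 * π * ξ * t) : ℝ) : ℂ) *
        (((v ^ (-(1/2) : ℝ) * Real.exp (-(2 * π * x * t) / v) : ℝ) : ℂ) * cexp (-p * v)) := by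
    intro t ht
    have ht' : 0 < t := ht
    rw [integral_const_mul, levy_i (by positivity) hp]
  rw [setIntegral_congr_fun measurableSet_Ioi step1]
  rw [integral_integral_swap]
  · rw [← integral_const_mul]
    refine setIntegral_congr_fun measurableSet_Ioi fun v hv => ?_
    have hv' : 0 < v := hv
    have h2 := inner_t m ξ hx hv'
    rw [← Complex.ofReal_inj, ← integral_complex_ofReal] at h2
    have e : ∀ t : ℝ, ((t ^ (2 * m) * Real.cos (2 * π * ξ * t) : ℝ) : ℂ) *
        (((v ^ (-(1/2) : ℝ) * Real.exp (-(2 * π * x * t) / v) : ℝ) : ℂ) * cexp (-p * v))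
        = ((t ^ (2 * m) * Real.cos (2 * π * ξ * t) * Real.exp (-(2 * π * x * t) / v) : ℝ) : ℂ) *
          (((v ^ (-(1/2) : ℝ) : ℝ) : ℂ) * cexp (-p * v)) := by
      intro t; push_cast; ring
    simp only [e]
    rw [integral_mul_const, h2]
    have e2 : v ^ (2 * m + 1/2 : ℝ) = v ^ (2 * m + 1) * v ^ (-(1/2) : ℝ) := by
      rw [← Real.rpow_natCast, ← Real.rpow_add hv']; push_cast; ring_nf
    rw [e2]; push_cast; ring
  · rw [integrable_prod_iff']
    · constructor
      · refine (ae_restrict_iff' measurableSet_Ioi).2 (Eventually.of_forall fun v hv => ?_)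
        have hv' : 0 < v := hv
        refine Integrable.mono' ((int_pow_exp (2 * m) (c := 2 * π * x / v) (by positivity)).const_mul
          (v ^ (-(1/2) : ℝ) * Real.exp (-p.re * v))) ?_ ?_
        · have : Measurable (fun t : ℝ => ((t ^ (2 * m) * Real.cos (2 * π * ξ * t) : ℝ) : ℂ) *
            (((v ^ (-(1/2) : ℝ) * Real.exp (-(2 * π * x * t) / v) : ℝ) : ℂ) * cexp (-p * v))) := by
            fun_prop
          exact this.aestronglyMeasurable
        · refine (ae_restrict_iff' measurableSet_Ioi).2 (Eventually.of_forall fun t ht => ?_)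
          have ht' : 0 < t := ht
          simp only [Function.uncurry]
          rw [norm_mul, norm_mul, Complex.norm_real, Complex.norm_real, Complex.norm_exp, norm_mul, norm_mul,
            Real.norm_of_nonneg (by positivity : 0 ≤ t ^ (2 * m)), Real.norm_of_nonneg (Real.exp_pos _).le,
            Real.norm_of_nonneg (by positivity : 0 ≤ v ^ (-(1/2) : ℝ))]
          have h1 : ‖Real.cos (2 * π * ξ * t)‖ ≤ 1 := Real.abs_cos_le_one _
          have h3 : (-p * (v:ℂ)).re = -p.re * v := by simp
          rw [h3, show -(2 * π * x * t) / v = -(2 * π * x / v) * t by ring]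
          calc _ ≤ t ^ (2 * m) * 1 * (v ^ (-(1/2) : ℝ) * Real.exp (-(2 * π * x / v) * t) * Real.exp (-p.re * v)) := by
                gcongr
            _ = _ := by ring
      · have hI : IntegrableOn (fun v : ℝ => Cp m x * (v ^ (2 * m + 1/2 : ℝ) * Real.exp (-p.re * v))) (Set.Ioi 0) :=
          (int_rpow_exp (by linarith [(Nat.cast_nonneg m : (0:ℝ) ≤ m)]) hp).const_mul _
        have hmeas : Measurable (Function.uncurry fun (t v : ℝ) => ((t ^ (2 * m) * Real.cos (2 * π * ξ * t) : ℝ) : ℂ) *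
            (((v ^ (-(1/2) : ℝ) * Real.exp (-(2 * π * x * t) / v) : ℝ) : ℂ) * cexp (-p * v))) := by
          unfold Function.uncurry; fun_prop
        refine Integrable.mono' hI ?_ ?_
        · have := hmeas.norm.stronglyMeasurable.integral_prod_left' (μ := volume.restrict (Set.Ioi (0:ℝ)))
          exact this.aestronglyMeasurable
        · refine (ae_restrict_iff' measurableSet_Ioi).2 (Eventually.of_forall fun v hv => ?_)
          have hv' : 0 < v := hv
          rw [Real.norm_of_nonneg (integral_nonneg fun t => norm_nonneg _)]
          have h2 := inner_t m 0 hx hv'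
          have hQ : Q m (0 / x * v) = 1 := by simp [Q]
          rw [hQ, mul_one] at h2
          have h4 : ∫ t in Set.Ioi (0:ℝ), v ^ (-(1/2) : ℝ) * Real.exp (-p.re * v) *
              (t ^ (2 * m) * Real.cos (2 * π * 0 * t) * Real.exp (-(2 * π * x * t) / v))
              = Cp m x * (v ^ (2 * m + 1/2 : ℝ) * Real.exp (-p.re * v)) := by
            rw [integral_const_mul, h2]
            have e2 : v ^ (2 * m + 1/2 : ℝ) = v ^ (2 * m + 1) * v ^ (-(1/2) : ℝ) := by
              rw [← Real.rpow_natCast, ← Real.rpow_add hv']; push_cast; ring_nf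
            rw [e2]; ring
          rw [← h4]
          refine setIntegral_mono_on ?_ ?_ measurableSet_Ioi fun t ht => ?_
          · refine Integrable.mono' ((int_pow_exp (2 * m) (c := 2 * π * x / v) (by positivity)).const_mul
              (v ^ (-(1/2) : ℝ) * Real.exp (-p.re * v))) ?_ ?_
            · exact (hmeas.comp (measurable_id.prodMk measurable_const)).norm.aestronglyMeasurable
            · refine (ae_restrict_iff' measurableSet_Ioi).2 (Eventually.of_forall fun t ht => ?_)
              have ht' : 0 < t := ht
              simp only [Function.uncurry, norm_norm]
              rw [norm_mul, norm_mul, Complex.norm_real, Complex.norm_real, Complex.norm_exp, norm_mul, norm_mul,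
                Real.norm_of_nonneg (by positivity : 0 ≤ t ^ (2 * m)), Real.norm_of_nonneg (Real.exp_pos _).le,
                Real.norm_of_nonneg (by positivity : 0 ≤ v ^ (-(1/2) : ℝ))]
              have h1 : ‖Real.cos (2 * π * ξ * t)‖ ≤ 1 := Real.abs_cos_le_one _
              have h3 : (-p * (v:ℂ)).re = -p.re * v := by simp
              rw [h3, show -(2 * π * x * t) / v = -(2 * π * x / v) * t by ring]
              calc _ ≤ t ^ (2 * m) * 1 * (v ^ (-(1/2) : ℝ) * Real.exp (-(2 * π * x / v) * t) * Real.exp (-p.re * v)) := by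
                    gcongr
                _ = _ := by ring
          · have := (int_pow_exp (2 * m) (c := 2 * π * x / v) (by positivity)).const_mul
              (v ^ (-(1/2) : ℝ) * Real.exp (-p.re * v))
            refine this.congr (Eventually.of_forall fun t => ?_)
            simp only [mul_zero, zero_mul, Real.cos_zero, mul_one]
            rw [show -(2 * π * x * t) / v = -(2 * π * x / v) * t by ring]
          · have ht' : 0 < t := ht
            simp only [Function.uncurry, mul_zero, zero_mul, Real.cos_zero, mul_one]
            rw [norm_mul, norm_mul, Complex.norm_real, Complex.norm_real, Complex.norm_exp, norm_mul, norm_mul,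
              Real.norm_of_nonneg (by positivity : 0 ≤ t ^ (2 * m)), Real.norm_of_nonneg (Real.exp_pos _).le,
              Real.norm_of_nonneg (by positivity : 0 ≤ v ^ (-(1/2) : ℝ))]
            have h1 : ‖Real.cos (2 * π * ξ * t)‖ ≤ 1 := Real.abs_cos_le_one _
            have h3 : (-p * (v:ℂ)).re = -p.re * v := by simp
            rw [h3]
            calc _ ≤ t ^ (2 * m) * 1 * (v ^ (-(1/2) : ℝ) * Real.exp (-(2 * π * x * t) / v) * Real.exp (-p.re * v)) := by
                  gcongr
              _ = _ := by ring
    · have : Measurable (Function.uncurry fun (t v : ℝ) => ((t ^ (2 * m) * Real.cos (2 * π * ξ * t) : ℝ) : ℂ) *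
            (((v ^ (-(1/2) : ℝ) * Real.exp (-(2 * π * x * t) / v) : ℝ) : ℂ) * cexp (-p * v))) := by
          unfold Function.uncurry; fun_prop
      exact this.aestronglyMeasurable

lemma Kf_eq {x t : ℝ} (hx : 0 < x) (ht : 0 < t) :
    cexp (-(2 * √(2 * π * x * t) * ((√(π * 1) : ℝ) * (1 + I)))) = Kf x t := by
  unfold Kf al
  congr 1
  have : √(2 * π * x * t) * √(π * 1) = π * √(2 * x) * √t := by
    rw [← Real.sqrt_mul (by positivity), mul_assoc π, ← Real.sqrt_mul (by positivity),
      show 2 * π * x * t * (π * 1) = π ^ 2 * (2 * x * t) by ring, Real.sqrt_mul (by positivity),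
      Real.sqrt_sq Real.pi_pos.le]
  have h2 := congrArg (fun r : ℝ => (r : ℂ)) this
  push_cast at h2 ⊢
  linear_combination (-2 * (1 + I)) * h2

lemma Kf_norm (x t : ℝ) : ‖Kf x t‖ = Real.exp (-al x * √t) := by
  unfold Kf
  rw [Complex.norm_exp]
  congr 1
  simp

lemma Kf_cont (x : ℝ) : Continuous (Kf x) := by
  unfold Kf; fun_prop

lemma al_pos {x : ℝ} (hx : 0 < x) : 0 < al x := by unfold al; positivity

theorem Jc_formula (m : ℕ) {x ξ : ℝ} (hx : 0 < x) (hξ : 0 < ξ) :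
    Jc m x ξ = (1 + I) * Cp m x *
      ∫ v in Set.Ioi (0:ℝ), ((v ^ (2 * m + 1/2 : ℝ) * Q m (ξ / x * v) : ℝ) : ℂ) *
          cexp (-(2 * π * I) * v) := by
  set pe : ℝ → ℂ := fun ε => (ε : ℂ) + (2 * π * 1 : ℝ) * I with hpe
  have hs := tendsto_csqrt one_pos
  have hsne : ((√(π * 1) : ℝ) * (1 + I) : ℂ) ≠ 0 := by
    have h1 : (√(π * 1) : ℝ) ≠ 0 := by positivity
    have h2 : (1 + I : ℂ) ≠ 0 := by
      intro h; have := congrArg Complex.re h; simp at this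
    exact mul_ne_zero (by exact_mod_cast h1) h2
  have hL : Tendsto (fun ε : ℝ => ∫ t in Set.Ioi (0:ℝ), ((t ^ (2 * m) * Real.cos (2 * π * ξ * t) : ℝ) : ℂ) *
        (√π / (pe ε) ^ (1/2 : ℂ) * cexp (-(2 * √(2 * π * x * t) * (pe ε) ^ (1/2 : ℂ))))) (𝓝[>] 0)
      (𝓝 (∫ t in Set.Ioi (0:ℝ), ((t ^ (2 * m) * Real.cos (2 * π * ξ * t) : ℝ) : ℂ) *
        (√π / ((√(π * 1) : ℝ) * (1 + I)) * cexp (-(2 * √(2 * π * x * t) * ((√(π * 1) : ℝ) * (1 + I))))))) := by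
    set B : ℝ := ‖(√π / ((√(π * 1) : ℝ) * (1 + I)) : ℂ)‖ + 1 with hB
    have hd : Tendsto (fun ε : ℝ => (√π / (pe ε) ^ (1/2 : ℂ) : ℂ)) (𝓝[>] 0)
        (𝓝 (√π / ((√(π * 1) : ℝ) * (1 + I)))) := tendsto_const_nhds.div hs hsne
    have ev1 : ∀ᶠ ε in 𝓝[>] (0:ℝ), ‖(√π / (pe ε) ^ (1/2 : ℂ) : ℂ)‖ ≤ B := by
      have := hd.norm.eventually (gt_mem_nhds (lt_add_one _))
      filter_upwards [this] with ε h using h.le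
    have ev2 : ∀ᶠ ε in 𝓝[>] (0:ℝ), 1 ≤ ((pe ε) ^ (1/2 : ℂ)).re := by
      have h1 : Tendsto (fun ε : ℝ => ((pe ε) ^ (1/2 : ℂ)).re) (𝓝[>] 0) (𝓝 (((√(π * 1) : ℝ) * (1 + I) : ℂ).re)) :=
        (Complex.continuous_re.tendsto _).comp hs
      have h2 : 1 < ((√(π * 1) : ℝ) * (1 + I) : ℂ).re := by
        simp only [mul_one, re_ofReal_mul, add_re, one_re, I_re, add_zero]
        rw [Real.lt_sqrt zero_le_one]; linarith [Real.pi_gt_three]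
      filter_upwards [h1.eventually (lt_mem_nhds h2)] with ε h using h.le
    have hintb : IntegrableOn (fun t : ℝ => B * (t ^ (2 * m) * Real.exp (-(2 * √(2 * π * x)) * √t))) (Set.Ioi 0) :=
      (int_pow_exp_sqrt (2 * m) (by positivity)).const_mul _
    refine tendsto_integral_filter_of_dominated_convergence _ ?_ ?_ hintb ?_
    · refine Eventually.of_forall fun ε => ?_
      refine (Continuous.aestronglyMeasurable ?_)
      fun_prop
    · filter_upwards [ev1, ev2] with ε h1 h2
      refine (ae_restrict_iff' measurableSet_Ioi).2 (Eventually.of_forall fun t ht => ?_)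
      have ht' : 0 < t := ht
      rw [norm_mul, norm_mul, Complex.norm_real, Complex.norm_exp, norm_mul,
        Real.norm_of_nonneg (by positivity : 0 ≤ t ^ (2 * m))]
      have h5 : ‖Real.cos (2 * π * ξ * t)‖ ≤ 1 := Real.abs_cos_le_one _
      have h6 : (-(2 * (√(2 * π * x * t) : ℂ) * (pe ε) ^ (1/2 : ℂ))).re ≤ -(2 * √(2 * π * x)) * √t := by
        have e : (2 * (√(2 * π * x * t) : ℂ) * (pe ε) ^ (1/2 : ℂ)) = ((2 * √(2 * π * x * t) : ℝ) : ℂ) * (pe ε) ^ (1/2 : ℂ) := by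
          push_cast; ring
        rw [e, Complex.neg_re, Complex.re_ofReal_mul, Real.sqrt_mul (by positivity : 0 ≤ 2 * π * x)]
        have h7 : 0 ≤ 2 * (√(2 * π * x) * √t) := by positivity
        nlinarith
      calc _ ≤ t ^ (2 * m) * 1 * (B * Real.exp (-(2 * √(2 * π * x)) * √t)) := by gcongr
        _ = _ := by ring
    · refine (ae_restrict_iff' measurableSet_Ioi).2 (Eventually.of_forall fun t ht => ?_)
      refine (hd.mul ?_).const_mul _
      refine (Complex.continuous_exp.tendsto _).comp ?_
      exact (hs.const_mul _).neg
  have hR : Tendsto (fun ε : ℝ => Cp m x * ∫ v in Set.Ioi (0:ℝ), ((v ^ (2 * m + 1/2 : ℝ) * Q m (ξ / x * v) : ℝ) : ℂ) *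
          cexp (-(pe ε) * v)) (𝓝[>] 0)
      (𝓝 (Cp m x * ∫ v in Set.Ioi (0:ℝ), ((v ^ (2 * m + 1/2 : ℝ) * Q m (ξ / x * v) : ℝ) : ℂ) *
          cexp (-(2 * π * I) * v))) := by
    refine Tendsto.const_mul _ ?_
    have hc : 0 < ξ / x := by positivity
    refine tendsto_integral_filter_of_dominated_convergence _ ?_ ?_ (GQ_int m hc).norm ?_
    · refine Eventually.of_forall fun ε => ?_
      have := GQ_meas m (ξ / x)
      exact (this.complex_ofReal.mul (by fun_prop)).aestronglyMeasurable
    · filter_upwards [self_mem_nhdsWithin] with ε hε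
      refine (ae_restrict_iff' measurableSet_Ioi).2 (Eventually.of_forall fun v hv => ?_)
      have hv' : 0 < v := hv
      have hε' : (0:ℝ) < ε := hε
      rw [norm_mul, Complex.norm_exp, Complex.norm_real]
      refine mul_le_of_le_one_right (norm_nonneg _) ?_
      rw [Real.exp_le_one_iff]
      simp [hpe]
      positivity
    · refine Eventually.of_forall fun v => ?_
      refine Tendsto.const_mul _ ?_
      have : Continuous (fun ε : ℝ => cexp (-(pe ε) * v)) := by simp only [hpe]; fun_prop
      have h := this.tendsto 0
      have e0 : pe 0 = 2 * π * I := by simp [hpe]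
      rw [e0] at h
      exact h.mono_left nhdsWithin_le_nhds
  have hlim := tendsto_nhds_unique_of_eventuallyEq hL hR (by
    filter_upwards [self_mem_nhdsWithin] with ε hε
    exact fubini_p m ξ hx (p := pe ε) (by simpa [hpe] using hε))
  have e1 : ∫ t in Set.Ioi (0:ℝ), ((t ^ (2 * m) * Real.cos (2 * π * ξ * t) : ℝ) : ℂ) *
        (√π / ((√(π * 1) : ℝ) * (1 + I)) * cexp (-(2 * √(2 * π * x * t) * ((√(π * 1) : ℝ) * (1 + I)))))
      = (1 + I)⁻¹ * Jc m x ξ := by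
    unfold Jc
    rw [← integral_const_mul]
    refine setIntegral_congr_fun measurableSet_Ioi fun t ht => ?_
    have ht' : 0 < t := ht
    rw [Kf_eq hx ht', mul_one]
    have h1 : ((√π : ℝ) : ℂ) ≠ 0 := by
      have : √π ≠ 0 := by positivity
      exact_mod_cast this
    rw [← div_div, div_self h1, one_div]; ring
  rw [e1] at hlim
  have h2 : (1 + I : ℂ) ≠ 0 := by
    intro h; have := congrArg Complex.re h; simp at this
  rw [mul_assoc, ← hlim, mul_inv_cancel_left₀ h2]

end CS

namespace CS
open MeasureTheory Filter Topology FourierTransform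

lemma integrable_abs_of {f : ℝ → ℝ} (hf : IntegrableOn f (Set.Ioi 0)) :
    Integrable (fun t : ℝ => f |t|) := by
  have hf' : IntegrableOn (fun t : ℝ => f |t|) (Set.Ioi 0) := by
    refine hf.congr_fun (fun t ht => ?_) measurableSet_Ioi
    simp [abs_of_pos (show (0:ℝ) < t from ht)]
  have int_Iic : IntegrableOn (fun x ↦ f |x|) (Set.Iic 0) := by
    rw [← Measure.map_neg_eq_self (volume : Measure ℝ)]
    let m : MeasurableEmbedding fun x : ℝ => -x := (Homeomorph.neg ℝ).measurableEmbedding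
    rw [m.integrableOn_map_iff]
    simp_rw [Function.comp_def, abs_neg, Set.neg_preimage, Set.neg_Iic, neg_zero]
    exact Iff.mpr integrableOn_Ici_iff_integrableOn_Ioi hf'
  have := int_Iic.union hf'
  rwa [Set.Iic_union_Ioi, integrableOn_univ] at this

lemma fourier_even {f : ℝ → ℝ} (hf : IntegrableOn f (Set.Ioi 0)) (ξ : ℝ) :
    𝓕 (fun t : ℝ => ((f |t| : ℝ) : ℂ)) ξ =
      ((2 * ∫ t in Set.Ioi (0:ℝ), f t * Real.cos (2 * π * ξ * t) : ℝ) : ℂ) := by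
  have hI := (integrable_abs_of hf).ofReal (𝕜 := ℂ)
  rw [Real.fourier_real_eq_integral_exp_smul]
  set g : ℝ → ℂ := fun v => cexp (↑(-2 * π * v * ξ) * I) • ((f |v| : ℝ) : ℂ) with hg
  have hgI : Integrable g := by
    refine hI.bdd_mul (c := 1) (Continuous.aestronglyMeasurable (by fun_prop)) (Eventually.of_forall fun v => ?_)
    rw [Complex.norm_exp_ofReal_mul_I]
  have h1 : ∫ v, g v = ∫ v, g (-v) := (integral_neg_eq_self g volume).symm
  have h2 : (2:ℂ) * ∫ v, g v = ∫ v, (g v + g (-v)) := by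
    rw [integral_add hgI hgI.comp_neg, ← h1]; ring
  have h3 : ∀ v, g v + g (-v) = ((2 * (f |v| * Real.cos (2 * π * ξ * |v|)) : ℝ) : ℂ) := by
    intro v
    simp only [hg, abs_neg, smul_eq_mul]
    have hc : Real.cos (2 * π * ξ * |v|) = Real.cos (2 * π * ξ * v) := by
      rcases abs_choice v with h | h <;> rw [h]
      rw [mul_neg, Real.cos_neg]
    rw [hc]
    push_cast
    rw [Complex.cos]
    have e1 : -2 * (π:ℂ) * v * ξ * I = -(2 * π * ξ * v) * I := by ring
    have e2 : -2 * (π:ℂ) * -v * ξ * I = (2 * π * ξ * v) * I := by ring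
    rw [e1, e2]; ring
  simp_rw [h3] at h2
  rw [integral_complex_ofReal, integral_const_mul, integral_comp_abs (f := fun t => f t * Real.cos (2 * π * ξ * t))] at h2
  have h4 : ∫ v, g v = ((2 * ∫ t in Set.Ioi (0:ℝ), f t * Real.cos (2 * π * ξ * t) : ℝ) : ℂ) := by
    have : (2:ℂ) ≠ 0 := two_ne_zero
    apply mul_left_cancel₀ this
    rw [h2]; push_cast; ring
  exact h4

lemma tsum_int_even {g : ℤ → ℂ} (hg : Summable g) (he : ∀ n, g (-n) = g n) :
    ∑' n : ℤ, g n = g 0 + 2 * ∑' n : ℕ, g ((n : ℤ) + 1) := by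
  have h1 : Summable fun n : ℕ => g n := hg.comp_injective Nat.cast_injective
  have h2 : Summable fun n : ℕ => g (-((n:ℤ) + 1)) := hg.comp_injective (fun a b h => by simpa using h)
  rw [tsum_of_nat_of_neg_add_one h1 h2, h1.tsum_eq_zero_add]
  simp only [he]
  push_cast
  ring

lemma summable_int_even {g : ℤ → ℂ} (hg : Summable fun n : ℕ => g ((n:ℤ) + 1)) (he : ∀ n, g (-n) = g n) :
    Summable g := by
  refine Summable.of_nat_of_neg_add_one ?_ ?_
  · exact (summable_nat_add_iff 1).1 (by simpa using hg)
  · simpa only [he] using hg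

lemma poisson_even {f : ℝ → ℝ} (hc : Continuous (fun t : ℝ => f |t|)) (h0 : f 0 = 0)
    {C : ℝ} (hd : ∀ t : ℝ, 1 ≤ t → |f t| ≤ C * t ^ (-(3/2) : ℝ)) (h_intg : IntegrableOn f (Set.Ioi 0))
    (hs : Summable fun j : ℕ => ∫ t in Set.Ioi (0:ℝ), f t * Real.cos (2 * π * (j + 1 : ℕ) * t)) :
    (Summable fun k : ℕ => f (k + 1)) ∧ ∑' k : ℕ, f (k + 1) = (∫ t in Set.Ioi (0:ℝ), f t) +
      2 * ∑' j : ℕ, ∫ t in Set.Ioi (0:ℝ), f t * Real.cos (2 * π * (j + 1 : ℕ) * t) := by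
  have hsumf : Summable fun k : ℕ => f (k + 1) := by
    have h1 : Summable fun k : ℕ => C * ((k + 1 : ℕ) : ℝ) ^ (-(3/2) : ℝ) :=
      ((summable_nat_add_iff 1).2 (Real.summable_nat_rpow.2 (by norm_num))).mul_left _
    refine Summable.of_norm_bounded h1 fun k => ?_
    have := hd (k + 1) (by linarith [(Nat.cast_nonneg k : (0:ℝ) ≤ k)])
    push_cast
    exact this
  refine ⟨hsumf, ?_⟩
  have hF : ∀ n : ℤ, 𝓕 (fun t : ℝ => ((f |t| : ℝ) : ℂ)) n =
      ((2 * ∫ t in Set.Ioi (0:ℝ), f t * Real.cos (2 * π * n * t) : ℝ) : ℂ) := fun n => fourier_even h_intg n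
  have heven : ∀ n : ℤ, 𝓕 (fun t : ℝ => ((f |t| : ℝ) : ℂ)) ((-n : ℤ) : ℝ) = 𝓕 (fun t : ℝ => ((f |t| : ℝ) : ℂ)) (n : ℝ) := by
    intro n
    rw [hF, hF]
    congr 3
    funext t
    push_cast
    rw [mul_neg, neg_mul, Real.cos_neg]
  have hsF : Summable fun n : ℤ => 𝓕 (fun t : ℝ => ((f |t| : ℝ) : ℂ)) (n : ℝ) := by
    refine summable_int_even ?_ heven
    simp only [hF]
    have := Complex.ofRealCLM.summable (hs.mul_left 2)
    refine this.congr fun j => ?_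
    rw [Complex.ofRealCLM_apply]
    push_cast
    rfl
  have hbig : (fun t : ℝ => ((f |t| : ℝ) : ℂ)) =O[cocompact ℝ] fun x : ℝ => |x| ^ (-(3/2) : ℝ) := by
    refine Asymptotics.IsBigO.of_bound C ?_
    have : ∀ᶠ t : ℝ in cocompact ℝ, 1 ≤ ‖t‖ := (tendsto_norm_cocompact_atTop).eventually_ge_atTop 1
    filter_upwards [this] with t ht
    rw [Complex.norm_real, Real.norm_eq_abs, Real.norm_eq_abs, abs_of_nonneg (by positivity : 0 ≤ |t| ^ (-(3/2) : ℝ))]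
    exact hd |t| ht
  have hP := Real.tsum_eq_tsum_fourier_of_rpow_decay_of_summable
    (Complex.continuous_ofReal.comp hc) (by norm_num : (1:ℝ) < 3/2) hbig hsF 0
  simp only [Function.comp_def, zero_add, QuotientAddGroup.mk_zero] at hP
  have hP1 : ∀ n : ℤ, fourier n (0 : UnitAddCircle) = 1 := by
    intro n; simp
  simp only [hP1, mul_one] at hP
  have hP' : ∑' n : ℤ, ((f |(n:ℝ)| : ℝ) : ℂ) = ∑' n : ℤ, 𝓕 (fun t : ℝ => ((f |t| : ℝ) : ℂ)) (n : ℝ) := hP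
  rw [tsum_int_even hsF heven, tsum_int_even (g := fun n : ℤ => ((f |(n:ℝ)| : ℝ) : ℂ))] at hP'
  · simp only [hF] at hP'
    rw [← Complex.ofReal_inj]
    push_cast
    have e1 : ∀ n : ℕ, |((n:ℝ) + 1)| = n + 1 := fun n => abs_of_pos (by positivity)
    push_cast at hP'
    simp only [e1, Int.cast_zero, abs_zero, h0, Complex.ofReal_zero, zero_add, mul_zero, zero_mul, Real.cos_zero, mul_one] at hP'
    have h2 : (2:ℂ) ≠ 0 := two_ne_zero
    apply mul_left_cancel₀ h2
    rw [hP', tsum_mul_left]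
    ring
  · refine summable_int_even ?_ ?_
    · have := Complex.ofRealCLM.summable hsumf
      refine this.congr fun k => ?_
      have e1 : |((k:ℝ) + 1)| = k + 1 := abs_of_pos (by positivity)
      push_cast
      rw [e1]
      simp
    · intro n; push_cast; rw [abs_neg]
  · intro n; push_cast; rw [abs_neg]

end CS

namespace CS
open MeasureTheory Filter Topology

lemma Jc_intble (m : ℕ) {x : ℝ} (ξ : ℝ) (hx : 0 < x) :
    IntegrableOn (fun t : ℝ => ((t ^ (2 * m) * Real.cos (2 * π * ξ * t) : ℝ) : ℂ) * Kf x t) (Set.Ioi 0) := by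
  refine Integrable.mono' (int_pow_exp_sqrt (2 * m) (al_pos hx)) ?_ ?_
  · have := Kf_cont x
    exact (by fun_prop : Continuous _).aestronglyMeasurable
  · refine (ae_restrict_iff' measurableSet_Ioi).2 (Eventually.of_forall fun t ht => ?_)
    have ht' : 0 < t := ht
    rw [norm_mul, Kf_norm, Complex.norm_real, Real.norm_eq_abs, abs_mul, abs_of_pos (by positivity : 0 < t ^ (2 * m))]
    gcongr
    exact mul_le_of_le_one_right (by positivity) (Real.abs_cos_le_one _)

lemma Jc_bound1 (m : ℕ) {x : ℝ} (ξ : ℝ) (hx : 0 < x) :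
    ‖Jc m x ξ‖ ≤ ∫ t in Set.Ioi (0:ℝ), t ^ (2 * m) * Real.exp (-al x * √t) := by
  unfold Jc
  refine norm_integral_le_of_norm_le (int_pow_exp_sqrt (2 * m) (al_pos hx)) ?_
  refine (ae_restrict_iff' measurableSet_Ioi).2 (Eventually.of_forall fun t ht => ?_)
  have ht' : 0 < t := ht
  rw [norm_mul, Kf_norm, Complex.norm_real, Real.norm_eq_abs, abs_mul, abs_of_pos (by positivity : 0 < t ^ (2 * m))]
  gcongr
  exact mul_le_of_le_one_right (by positivity) (Real.abs_cos_le_one _)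

lemma norm_exp_2pii (v : ℝ) : ‖cexp (-(2 * π * I) * v)‖ = 1 := by
  rw [Complex.norm_exp]; simp

lemma Jc_bound2 (m : ℕ) {x ξ : ℝ} (hx : 0 < x) (hξ : 0 < ξ) :
    ‖Jc m x ξ‖ ≤ 2 * Cp m x * ((2 * m + 1) * x ^ (2 * m + 3/2 : ℝ) * Abase) * ξ ^ (-(2 * m + 3/2) : ℝ) := by
  have hc : 0 < ξ / x := by positivity
  have hC : 0 ≤ Cp m x := by unfold Cp; positivity
  rw [Jc_formula m hx hξ, norm_mul, norm_mul, Complex.norm_real, Real.norm_eq_abs, abs_of_nonneg hC]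
  have h1 : ‖(1 + I : ℂ)‖ ≤ 2 := by
    refine (norm_add_le _ _).trans ?_
    simp; norm_num
  have h2 : ‖∫ v in Set.Ioi (0:ℝ), ((v ^ (2 * m + 1/2 : ℝ) * Q m (ξ / x * v) : ℝ) : ℂ) *
          cexp (-(2 * π * I) * v)‖ ≤ (2 * m + 1) * ((ξ / x) ^ (2 * m))⁻¹ * ((ξ / x) ^ (-(3/2) : ℝ) * Abase) := by
    rw [← integral_base hc, ← integral_const_mul]
    refine norm_integral_le_of_norm_le ((int_base hc).const_mul _) ?_
    refine (ae_restrict_iff' measurableSet_Ioi).2 (Eventually.of_forall fun t ht => ?_)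
    rw [norm_mul, norm_exp_2pii, mul_one, Complex.norm_real, Real.norm_eq_abs]
    exact GQ_bound m hc ht
  have h3 : ((ξ / x) ^ (2 * m))⁻¹ * (ξ / x) ^ (-(3/2) : ℝ) = x ^ (2 * m + 3/2 : ℝ) * ξ ^ (-(2 * m + 3/2) : ℝ) := by
    rw [← Real.rpow_natCast, ← Real.rpow_neg hc.le, ← Real.rpow_add hc,
      show (-((2 * m : ℕ) : ℝ) + -(3/2)) = -(2 * m + 3/2) by push_cast; ring, Real.div_rpow hξ.le hx.le,
      Real.rpow_neg hx.le, div_inv_eq_mul, mul_comm]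
  calc _ ≤ 2 * Cp m x * ((2 * m + 1) * ((ξ / x) ^ (2 * m))⁻¹ * ((ξ / x) ^ (-(3/2) : ℝ) * Abase)) := by
        gcongr
    _ = 2 * Cp m x * ((2 * m + 1) * (((ξ / x) ^ (2 * m))⁻¹ * (ξ / x) ^ (-(3/2) : ℝ)) * Abase) := by ring
    _ = _ := by rw [h3]; ring

lemma Jc_bound (m : ℕ) {x : ℝ} (hx : 0 < x) : ∃ K : ℝ, 0 ≤ K ∧ ∀ σ : ℝ, 0 ≤ σ → σ ≤ 2 * m + 3/2 →
    ∀ ξ : ℝ, 0 < ξ → ‖Jc m x ξ‖ ≤ K * ξ ^ (-σ) := by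
  set K1 := ∫ t in Set.Ioi (0:ℝ), t ^ (2 * m) * Real.exp (-al x * √t)
  set K2 := 2 * Cp m x * ((2 * m + 1) * x ^ (2 * m + 3/2 : ℝ) * Abase)
  refine ⟨max 0 (max K1 K2), le_max_left _ _, fun σ h0 h1 ξ hξ => ?_⟩
  set K := max 0 (max K1 K2)
  have hK : 0 ≤ K := le_max_left _ _
  have hK1 : K1 ≤ K := (le_max_left _ _).trans (le_max_right _ _)
  have hK2 : K2 ≤ K := (le_max_right _ _).trans (le_max_right _ _)
  rcases le_total ξ 1 with h | h
  · have : 1 ≤ ξ ^ (-σ) := Real.one_le_rpow_of_pos_of_le_one_of_nonpos hξ h (by linarith)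
    calc _ ≤ K1 := Jc_bound1 m ξ hx
      _ ≤ K := hK1
      _ = K * 1 := by ring
      _ ≤ _ := by gcongr
  · calc _ ≤ K2 * ξ ^ (-(2 * m + 3/2) : ℝ) := Jc_bound2 m hx hξ
      _ ≤ K * ξ ^ (-(2 * m + 3/2) : ℝ) := by gcongr
      _ ≤ _ := by
        gcongr

/-- `T(b,ξ)` -/
noncomputable def T (m : ℕ) (x b ξ : ℝ) : ℂ := ((b ^ (-(2 * m + 3/2) : ℝ) : ℝ) : ℂ) * Jc m x (ξ / b)

lemma T_formula (m : ℕ) {x b ξ : ℝ} (hx : 0 < x) (hb : 0 < b) (hξ : 0 < ξ) :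
    T m x b ξ = (1 + I) * Cp m x *
      ∫ u in Set.Ioi (0:ℝ), ((u ^ (2 * m + 1/2 : ℝ) * Q m (ξ / x * u) : ℝ) : ℂ) *
          cexp (-(2 * π * I) * (b * u : ℝ)) := by
  rw [T, Jc_formula m hx (div_pos hξ hb)]
  have h := MeasureTheory.integral_comp_mul_left_Ioi (fun v : ℝ => ((v ^ (2 * m + 1/2 : ℝ) * Q m (ξ / b / x * v) : ℝ) : ℂ) *
          cexp (-(2 * π * I) * v)) 0 hb
  rw [mul_zero] at h
  have h2 : ∫ u in Set.Ioi (0:ℝ), (((b * u) ^ (2 * m + 1/2 : ℝ) * Q m (ξ / b / x * (b * u)) : ℝ) : ℂ) *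
          cexp (-(2 * π * I) * (b * u : ℝ)) = ((b ^ (2 * m + 1/2 : ℝ) : ℝ) : ℂ) *
      ∫ u in Set.Ioi (0:ℝ), ((u ^ (2 * m + 1/2 : ℝ) * Q m (ξ / x * u) : ℝ) : ℂ) *
          cexp (-(2 * π * I) * (b * u : ℝ)) := by
    rw [← integral_const_mul]
    refine setIntegral_congr_fun measurableSet_Ioi fun u hu => ?_
    have hu0 : 0 < u := hu
    have e : ξ / b / x * (b * u) = ξ / x * u := by field_simp
    simp only [e, Real.mul_rpow hb.le hu0.le]
    push_cast
    ring
  rw [h2] at h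
  set A := ∫ u in Set.Ioi (0:ℝ), ((u ^ (2 * m + 1/2 : ℝ) * Q m (ξ / x * u) : ℝ) : ℂ) *
          cexp (-(2 * π * I) * (b * u : ℝ))
  have h3 : (∫ v in Set.Ioi (0:ℝ), ((v ^ (2 * m + 1/2 : ℝ) * Q m (ξ / b / x * v) : ℝ) : ℂ) *
          cexp (-(2 * π * I) * v)) = ((b * b ^ (2 * m + 1/2 : ℝ) : ℝ) : ℂ) * A := by
    rw [ofReal_mul, mul_assoc (b:ℂ), h, Complex.real_smul, ← mul_assoc, ← ofReal_mul, mul_inv_cancel₀ hb.ne']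
    simp
  have h4 : b ^ (-(2 * m + 3/2) : ℝ) * (b * b ^ (2 * m + 1/2 : ℝ)) = 1 := by
    nth_rewrite 2 [← Real.rpow_one b]
    rw [← Real.rpow_add hb, ← Real.rpow_add hb]
    ring_nf
    simp
  rw [h3]
  calc _ = ((b ^ (-(2 * m + 3/2) : ℝ) * (b * b ^ (2 * m + 1/2 : ℝ)) : ℝ) : ℂ) * ((1 + I) * Cp m x * A) := by
        push_cast; ring
    _ = _ := by rw [h4]; simp

lemma T_bound (m : ℕ) {x : ℝ} (hx : 0 < x) : ∃ K : ℝ, 0 ≤ K ∧ ∀ σ : ℝ, 0 ≤ σ → σ ≤ 2 * m + 3/2 →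
    ∀ b ξ : ℝ, 0 < b → 0 < ξ → ‖T m x b ξ‖ ≤ K * (b ^ (σ - (2 * m + 3/2)) * ξ ^ (-σ)) := by
  obtain ⟨K, hK, h⟩ := Jc_bound m hx
  refine ⟨K, hK, fun σ h0 h1 b ξ hb hξ => ?_⟩
  rw [T, norm_mul, Complex.norm_real, Real.norm_eq_abs, abs_of_pos (by positivity)]
  calc _ ≤ b ^ (-(2 * m + 3/2) : ℝ) * (K * (ξ / b) ^ (-σ)) := by
        gcongr; exact h σ h0 h1 _ (by positivity)
    _ = K * (b ^ (-(2 * m + 3/2) : ℝ) * (b ^ σ) * ξ ^ (-σ)) := by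
        rw [Real.div_rpow hξ.le hb.le, Real.rpow_neg hb.le σ, div_inv_eq_mul]; ring
    _ = _ := by
        rw [← Real.rpow_add hb]
        ring_nf

end CS

namespace CS
open MeasureTheory Filter Topology FourierTransform

noncomputable def qr (a t : ℝ) : ℝ := t ^ (-(3/2) : ℝ) * Real.exp (-a / t)

lemma qr_meas (a : ℝ) : Measurable (qr a) := by unfold qr; fun_prop

lemma qr_int {a : ℝ} (ha : 0 < a) : IntegrableOn (qr a) (Set.Ioi 0) := by
  have h1 : IntegrableOn (qr a) (Set.Ioc 0 1) := by
    have hb : IntegrableOn (fun _ : ℝ => 2 / a ^ 2) (Set.Ioc 0 1) := by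
      simp
    refine Integrable.mono' hb (qr_meas a).aestronglyMeasurable ?_
    refine (ae_restrict_iff' measurableSet_Ioc).2 (Eventually.of_forall fun t ht => ?_)
    have ht0 : 0 < t := ht.1
    rw [Real.norm_eq_abs, qr, abs_of_nonneg (by positivity)]
    have h2 : (a / t) ^ 2 / 2 ≤ Real.exp (a / t) := by
      have := Real.quadratic_le_exp_of_nonneg (by positivity : 0 ≤ a / t)
      have h3 : 0 ≤ a / t := by positivity
      linarith
    have h4 : Real.exp (-a / t) ≤ 2 / a ^ 2 * t ^ 2 := by
      rw [neg_div, Real.exp_neg]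
      calc _ ≤ ((a / t) ^ 2 / 2)⁻¹ := by gcongr
        _ = _ := by field_simp
    calc _ ≤ t ^ (-(3/2) : ℝ) * (2 / a ^ 2 * t ^ 2) := by gcongr
      _ = 2 / a ^ 2 * (t ^ (-(3/2) : ℝ) * t ^ (2 : ℝ)) := by
        rw [← Real.rpow_natCast t 2]; push_cast; ring
      _ = 2 / a ^ 2 * t ^ (1/2 : ℝ) := by rw [← Real.rpow_add ht0]; norm_num
      _ ≤ 2 / a ^ 2 * 1 := by
        gcongr
        exact Real.rpow_le_one ht0.le ht.2 (by norm_num)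
      _ = _ := by ring
  have h2 : IntegrableOn (qr a) (Set.Ioi 1) := by
    refine Integrable.mono' (integrableOn_Ioi_rpow_of_lt (by norm_num : (-(3/2):ℝ) < -1) one_pos)
      (qr_meas a).aestronglyMeasurable ?_
    refine (ae_restrict_iff' measurableSet_Ioi).2 (Eventually.of_forall fun t ht => ?_)
    have ht0 : 0 < t := lt_trans one_pos ht
    rw [Real.norm_eq_abs, qr, abs_of_nonneg (by positivity)]
    refine mul_le_of_le_one_right (by positivity) ?_
    rw [Real.exp_le_one_iff, neg_div]
    have : 0 < a / t := by positivity
    linarith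
  rw [← Set.Ioc_union_Ioi_eq_Ioi (zero_le_one' ℝ)]
  exact h1.union h2

lemma Kf_eq2 {x t : ℝ} (hx : 0 < x) (ht : 0 < t) :
    cexp (-(2 * √(2 * π * x) * ((√(π * t) : ℝ) * (1 + I)))) = Kf x t := by
  unfold Kf al
  congr 1
  have : √(2 * π * x) * √(π * t) = π * √(2 * x) * √t := by
    rw [← Real.sqrt_mul (by positivity), mul_assoc π, ← Real.sqrt_mul (by positivity),
      show 2 * π * x * (π * t) = π ^ 2 * (2 * x * t) by ring, Real.sqrt_mul (by positivity),
      Real.sqrt_sq Real.pi_pos.le]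
  have h2 := congrArg (fun r : ℝ => (r : ℂ)) this
  push_cast at h2 ⊢
  linear_combination (-2 * (1 + I)) * h2

lemma qr_cos {x t : ℝ} (hx : 0 < x) (ht : 0 < t) :
    ∫ v in Set.Ioi (0:ℝ), qr (2 * π * x) v * Real.cos (2 * π * t * v) = (Kf x t).re / √(2 * x) := by
  have ha : 0 < 2 * π * x := by positivity
  set pe : ℝ → ℂ := fun ε => (ε : ℂ) + (2 * π * t : ℝ) * I with hpe
  have hs := tendsto_csqrt ht
  have hR : Tendsto (fun ε : ℝ => (√π / √(2 * π * x) * cexp (-(2 * √(2 * π * x) * (pe ε) ^ (1/2 : ℂ))) : ℂ)) (𝓝[>] 0)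
      (𝓝 (√π / √(2 * π * x) * cexp (-(2 * √(2 * π * x) * ((√(π * t) : ℝ) * (1 + I)))))) := by
    refine Tendsto.const_mul _ ?_
    refine (Complex.continuous_exp.tendsto _).comp ?_
    exact (hs.const_mul _).neg
  have hL : Tendsto (fun ε : ℝ => ∫ v in Set.Ioi (0:ℝ), ((qr (2 * π * x) v : ℝ) : ℂ) *
          cexp (-(pe ε) * v)) (𝓝[>] 0)
      (𝓝 (∫ v in Set.Ioi (0:ℝ), ((qr (2 * π * x) v : ℝ) : ℂ) *
          cexp (-((2 * π * t : ℝ) * I) * v))) := by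
    refine tendsto_integral_filter_of_dominated_convergence _ ?_ ?_ (qr_int ha).norm ?_
    · refine Eventually.of_forall fun ε => ?_
      have := qr_meas (2 * π * x)
      exact (this.complex_ofReal.mul (by fun_prop)).aestronglyMeasurable
    · filter_upwards [self_mem_nhdsWithin] with ε hε
      refine (ae_restrict_iff' measurableSet_Ioi).2 (Eventually.of_forall fun v hv => ?_)
      have hv' : 0 < v := hv
      have hε' : (0:ℝ) < ε := hε
      rw [norm_mul, Complex.norm_exp, Complex.norm_real]
      refine mul_le_of_le_one_right (norm_nonneg _) ?_
      rw [Real.exp_le_one_iff]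
      simp [hpe]
      positivity
    · refine Eventually.of_forall fun v => ?_
      refine Tendsto.const_mul _ ?_
      have : Continuous (fun ε : ℝ => cexp (-(pe ε) * v)) := by simp only [hpe]; fun_prop
      have h := this.tendsto 0
      have e0 : pe 0 = (2 * π * t : ℝ) * I := by simp [hpe]
      rw [e0] at h
      exact h.mono_left nhdsWithin_le_nhds
  have hlim := tendsto_nhds_unique_of_eventuallyEq hL hR (by
    filter_upwards [self_mem_nhdsWithin] with ε hε
    exact levy_ii ha (p := pe ε) (by simpa [hpe] using hε))
  rw [Kf_eq2 hx ht] at hlim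
  have h2 := congrArg Complex.re hlim
  have h_intg : Integrable (fun v : ℝ => ((qr (2 * π * x) v : ℝ) : ℂ) *
          cexp (-((2 * π * t : ℝ) * I) * v)) (volume.restrict (Set.Ioi 0)) := by
    refine (qr_int ha).ofReal.mul_bdd (c := 1) (Continuous.aestronglyMeasurable (by fun_prop)) (Eventually.of_forall fun v => ?_)
    rw [Complex.norm_exp]; simp
  rw [show (∫ v in Set.Ioi (0:ℝ), ((qr (2 * π * x) v : ℝ) : ℂ) *
          cexp (-((2 * π * t : ℝ) * I) * v)).re = ∫ v in Set.Ioi (0:ℝ), (((qr (2 * π * x) v : ℝ) : ℂ) *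
          cexp (-((2 * π * t : ℝ) * I) * v)).re from (integral_re h_intg).symm] at h2
  rw [show (∫ v in Set.Ioi (0:ℝ), qr (2 * π * x) v * Real.cos (2 * π * t * v)) = ∫ v in Set.Ioi (0:ℝ), (((qr (2 * π * x) v : ℝ) : ℂ) *
          cexp (-((2 * π * t : ℝ) * I) * v)).re from ?_, h2]
  · rw [show ((√π : ℝ) : ℂ) / ((√(2 * π * x) : ℝ) : ℂ) = ((√π / √(2 * π * x) : ℝ) : ℂ) by push_cast; rfl,
      Complex.re_ofReal_mul, show 2 * π * x = π * (2 * x) by ring, Real.sqrt_mul Real.pi_pos.le]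
    have : √π ≠ 0 := by positivity
    have : √(2 * x) ≠ 0 := by positivity
    field_simp
  · refine setIntegral_congr_fun measurableSet_Ioi fun v hv => ?_
    rw [Complex.re_ofReal_mul, Complex.exp_re]
    congr 1
    simp

lemma Kf_re_intble (m : ℕ) {x : ℝ} (hx : 0 < x) :
    IntegrableOn (fun t : ℝ => t ^ m * (Kf x t).re) (Set.Ioi 0) := by
  have hK := Kf_cont x
  refine Integrable.mono' (int_pow_exp_sqrt m (al_pos hx)) ((by fun_prop : Continuous _).aestronglyMeasurable) ?_
  refine (ae_restrict_iff' measurableSet_Ioi).2 (Eventually.of_forall fun t ht => ?_)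
  have ht' : 0 < t := ht
  rw [norm_mul, Real.norm_eq_abs, abs_of_pos (by positivity : 0 < t ^ m), ← Kf_norm]
  gcongr
  exact Complex.abs_re_le_norm _

lemma Jc_re (m : ℕ) {x : ℝ} (ξ : ℝ) (hx : 0 < x) :
    (Jc m x ξ).re = ∫ t in Set.Ioi (0:ℝ), (t ^ (2 * m) * (Kf x t).re) * Real.cos (2 * π * ξ * t) := by
  unfold Jc
  rw [show (∫ t in Set.Ioi (0:ℝ), ((t ^ (2 * m) * Real.cos (2 * π * ξ * t) : ℝ) : ℂ) * Kf x t).re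
    = ∫ t in Set.Ioi (0:ℝ), (((t ^ (2 * m) * Real.cos (2 * π * ξ * t) : ℝ) : ℂ) * Kf x t).re from
      (integral_re (Jc_intble m ξ hx)).symm]
  refine integral_congr_ae (Eventually.of_forall fun t => ?_)
  simp only
  rw [Complex.re_ofReal_mul]; ring

lemma fourier_qr {x : ℝ} (hx : 0 < x) :
    𝓕 (fun t : ℝ => ((qr (2 * π * x) |t| : ℝ) : ℂ)) = fun t : ℝ => ((2 / √(2 * x) * (Kf x |t|).re : ℝ) : ℂ) := by
  have ha : 0 < 2 * π * x := by positivity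
  have hI := (integrable_abs_of (qr_int ha)).ofReal (𝕜 := ℂ)
  have hK := Kf_cont x
  have hc : Continuous (𝓕 (fun t : ℝ => ((qr (2 * π * x) |t| : ℝ) : ℂ))) :=
    VectorFourier.fourierIntegral_continuous Real.continuous_fourierChar
      (by exact continuous_inner) hI
  refine Continuous.ext_on (dense_compl_singleton (0:ℝ)) hc (by fun_prop) fun t ht => ?_
  have ht' : 0 < |t| := abs_pos.2 ht
  rw [fourier_even (qr_int ha)]
  have : ∀ v, Real.cos (2 * π * t * v) = Real.cos (2 * π * |t| * v) := by
    intro v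
    rcases abs_choice t with h | h <;> rw [h]
    rw [mul_neg, neg_mul, Real.cos_neg]
  simp only [this]
  rw [qr_cos hx ht']
  congr 1
  ring

lemma Jc0_re {x ξ : ℝ} (hx : 0 < x) (hξ : 0 < ξ) :
    (Jc 0 x ξ).re = √(2 * x) / 4 * qr (2 * π * x) ξ := by
  have ha : 0 < 2 * π * x := by positivity
  have hI := (integrable_abs_of (qr_int ha)).ofReal (𝕜 := ℂ)
  have hK0 : IntegrableOn (fun t : ℝ => 2 / √(2 * x) * (Kf x t).re) (Set.Ioi 0) := by
    refine ((Kf_re_intble 0 hx).const_mul (2 / √(2 * x))).congr (Eventually.of_forall fun t => ?_)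
    simp only [pow_zero, one_mul]
  have hFI : Integrable (𝓕 (fun t : ℝ => ((qr (2 * π * x) |t| : ℝ) : ℂ))) := by
    rw [fourier_qr hx]
    exact (integrable_abs_of hK0).ofReal
  have hcont : ContinuousAt (fun t : ℝ => ((qr (2 * π * x) |t| : ℝ) : ℂ)) ξ := by
    have hne : |ξ| ≠ 0 := (abs_pos.2 hξ.ne').ne'
    unfold qr
    refine Complex.continuous_ofReal.continuousAt.comp ?_
    refine ContinuousAt.mul ?_ ?_
    · exact ContinuousAt.rpow_const continuous_abs.continuousAt (Or.inl hne)
    · exact Real.continuous_exp.continuousAt.comp (ContinuousAt.div continuousAt_const continuous_abs.continuousAt hne)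
  have h : 𝓕⁻ (𝓕 (fun t : ℝ => ((qr (2 * π * x) |t| : ℝ) : ℂ))) ξ = ((qr (2 * π * x) |ξ| : ℝ) : ℂ) :=
    hI.fourierInv_fourier_eq hFI hcont
  rw [Real.fourierInv_eq_fourier_neg, fourier_qr hx, fourier_even hK0, abs_of_pos hξ, Complex.ofReal_inj] at h
  rw [Jc_re 0 ξ hx, ← h]
  rw [← integral_const_mul, ← integral_const_mul]
  refine integral_congr_ae (Eventually.of_forall fun t => ?_)
  have : √(2 * x) ≠ 0 := by positivity
  simp only [mul_zero, pow_zero, one_mul]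
  rw [mul_neg, neg_mul, Real.cos_neg]
  field_simp
  try ring

/-- complex version -/
noncomputable def qC (a : ℝ) (w : ℂ) : ℂ := w ^ (-(3/2) : ℂ) * cexp (-a / w)

lemma qC_diff (a : ℝ) : DifferentiableOn ℂ (qC a) {w | 0 < w.re} := by
  intro w hw
  have hw0 : 0 < w.re := hw
  have hne : w ≠ 0 := by rintro rfl; simp at hw0
  unfold qC
  refine DifferentiableAt.differentiableWithinAt ?_
  refine DifferentiableAt.mul ?_ ?_
  · exact differentiableAt_id.cpow (differentiableAt_const _) (Or.inl hw0)
  · exact DifferentiableAt.cexp (DifferentiableAt.div (differentiableAt_const _) differentiableAt_id hne)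

lemma qC_ofReal (a : ℝ) {t : ℝ} (ht : 0 < t) : qC a t = (qr a t : ℝ) := by
  unfold qC qr
  rw [Complex.ofReal_mul, Complex.ofReal_cpow ht.le]
  push_cast
  rfl

lemma isOpen_hp : IsOpen {w : ℂ | 0 < w.re} := isOpen_lt continuous_const Complex.continuous_re

lemma diffOn_iter {F : ℂ → ℂ} {U : Set ℂ} (hU : IsOpen U) (hF : DifferentiableOn ℂ F U) (n : ℕ) :
    DifferentiableOn ℂ (iteratedDeriv n F) U := by
  induction n with
  | zero => simpa using hF
  | succ n ih => rw [iteratedDeriv_succ]; exact ih.deriv hU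

lemma iter_ofReal {F : ℂ → ℂ} (hF : DifferentiableOn ℂ F {w | 0 < w.re}) (n : ℕ) :
    ∀ t : ℝ, 0 < t → iteratedDeriv n (fun s : ℝ => F s) t = iteratedDeriv n F t := by
  induction n with
  | zero => intro t ht; simp
  | succ n ih =>
    intro t ht
    rw [iteratedDeriv_succ, iteratedDeriv_succ]
    have h1 : iteratedDeriv n (fun s : ℝ => F s) =ᶠ[𝓝 t] fun s : ℝ => iteratedDeriv n F s := by
      filter_upwards [lt_mem_nhds ht] with s hs using ih s hs
    rw [h1.deriv_eq]
    have h2 : DifferentiableAt ℂ (iteratedDeriv n F) (t:ℂ) :=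
      (diffOn_iter isOpen_hp hF n).differentiableAt (isOpen_hp.mem_nhds (by simpa using ht))
    exact h2.hasDerivAt.comp_ofReal.deriv

theorem Jc_re_formula (m : ℕ) {x ξ : ℝ} (hx : 0 < x) (hξ : 0 < ξ) :
    (((Jc m x ξ).re : ℝ) : ℂ) = (-1) ^ m / (2 * π) ^ (2 * m) * (√(2 * x) / 4 : ℝ) *
      iteratedDeriv (2 * m) (qC (2 * π * x)) ξ := by
  set g : ℝ → ℂ := fun t => (((Kf x |t|).re : ℝ) : ℂ) with hg
  have hI : ∀ n : ℕ, (n : ℕ∞) ≤ ⊤ → Integrable (fun t : ℝ => t ^ n • g t) := by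
    intro n _
    have h1 := (integrable_abs_of (Kf_re_intble n hx))
    have hK := Kf_cont x
    refine h1.mono ((by fun_prop : Continuous _).aestronglyMeasurable) (Eventually.of_forall fun t => ?_)
    simp only [hg, norm_smul, norm_mul, norm_pow, Complex.norm_real, Real.norm_eq_abs, abs_abs]
    exact le_rfl
  have h := Real.iteratedDeriv_fourier hI (n := 2 * m) le_top
  have h1 := congrFun h ξ
  have e1 : (fun t : ℝ => (-2 * (π:ℂ) * I * t) ^ (2 * m) • g t) =
      fun t : ℝ => (((fun t : ℝ => (-1) ^ m * (2 * π) ^ (2 * m) * (t ^ (2 * m) * (Kf x t).re)) |t| : ℝ) : ℂ) := by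
    funext t
    simp only [hg, smul_eq_mul]
    rw [Even.pow_abs (even_two_mul m)]
    push_cast
    rw [show (-2 * (π:ℂ) * I * t) ^ (2 * m) = (-1) ^ m * (2 * π) ^ (2 * m) * t ^ (2 * m) by
      rw [mul_pow, mul_pow, pow_mul I, I_sq, show (-2 * (π:ℂ)) ^ (2 * m) = (2 * π) ^ (2 * m) by
        rw [neg_mul, Even.neg_pow (even_two_mul m)]]
      ring]
    ring
  rw [e1, fourier_even ((Kf_re_intble (2 * m) hx).const_mul _)] at h1
  have e2 : 𝓕 g =ᶠ[𝓝 ξ] fun s : ℝ => ((√(2 * x) / 2 : ℝ) : ℂ) * qC (2 * π * x) s := by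
    filter_upwards [lt_mem_nhds hξ] with s hs
    have hK0 : IntegrableOn (fun t : ℝ => (Kf x t).re) (Set.Ioi 0) := by
      simpa using (Kf_re_intble 0 hx)
    rw [qC_ofReal _ hs, ← Complex.ofReal_mul]
    have h3 := Jc0_re hx hs
    rw [Jc_re 0 s hx] at h3
    simp only [mul_zero, pow_zero, one_mul] at h3
    rw [hg, fourier_even hK0, h3]
    congr 1
    ring
  rw [Filter.EventuallyEq.iteratedDeriv_eq (2 * m) e2] at h1
  have hd : DifferentiableOn ℂ (fun w => ((√(2 * x) / 2 : ℝ) : ℂ) * qC (2 * π * x) w) {w | 0 < w.re} :=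
    (qC_diff _).const_mul _
  rw [iter_ofReal hd (2 * m) ξ hξ, iteratedDeriv_const_mul_field] at h1
  have e3 : ∫ t in Set.Ioi (0:ℝ), (-1) ^ m * (2 * π) ^ (2 * m) * (t ^ (2 * m) * (Kf x t).re) * Real.cos (2 * π * ξ * t)
      = (-1) ^ m * (2 * π) ^ (2 * m) * (Jc m x ξ).re := by
    rw [Jc_re m ξ hx, ← integral_const_mul]
    refine integral_congr_ae (Eventually.of_forall fun t => ?_)
    simp only
    ring
  rw [e3] at h1
  push_cast at h1 ⊢
  have hp : (2 * (π:ℂ)) ^ (2 * m) ≠ 0 := pow_ne_zero _ (by simp [Real.pi_ne_zero])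
  have hsq : ((-1 : ℂ) ^ m) * (-1) ^ m = 1 := by rw [← mul_pow]; simp
  set D := iteratedDeriv (2 * m) (qC (2 * π * x)) ↑ξ
  field_simp
  linear_combination (-2 * (-1 : ℂ) ^ m) * h1 - 4 * (2 * (π:ℂ)) ^ (2 * m) * ((Jc m x ξ).re : ℂ) * hsq

end CS

namespace CS
open MeasureTheory Filter Topology

lemma Kf_scale {x b : ℝ} (hx : 0 < x) (hb : 0 < b) (t : ℝ) : Kf x (b * t) = Kf (x * b) t := by
  unfold Kf al
  congr 4
  rw [Real.sqrt_mul hb.le, ← mul_assoc 2 x b, Real.sqrt_mul (by positivity) b]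
  ring

lemma Jc_scale (m : ℕ) {x b : ℝ} (hx : 0 < x) (hb : 0 < b) (ξ : ℝ) :
    Jc m x (ξ / b) = ((b ^ (2 * m + 1) : ℝ) : ℂ) * Jc m (x * b) ξ := by
  unfold Jc
  have h := MeasureTheory.integral_comp_mul_left_Ioi (fun t : ℝ => ((t ^ (2 * m) * Real.cos (2 * π * (ξ / b) * t) : ℝ) : ℂ) * Kf x t) 0 hb
  rw [mul_zero] at h
  have h2 : ∫ t in Set.Ioi (0:ℝ), (((b * t) ^ (2 * m) * Real.cos (2 * π * (ξ / b) * (b * t)) : ℝ) : ℂ) * Kf x (b * t)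
      = ((b ^ (2 * m) : ℝ) : ℂ) * ∫ t in Set.Ioi (0:ℝ), ((t ^ (2 * m) * Real.cos (2 * π * ξ * t) : ℝ) : ℂ) * Kf (x * b) t := by
    rw [← integral_const_mul]
    refine integral_congr_ae (Eventually.of_forall fun t => ?_)
    have e : 2 * π * (ξ / b) * (b * t) = 2 * π * ξ * t := by field_simp
    simp only [e, Kf_scale hx hb]
    push_cast
    ring
  rw [h2] at h
  rw [pow_succ', ofReal_mul, mul_assoc (b:ℂ), h, Complex.real_smul, ← mul_assoc, ← ofReal_mul, mul_inv_cancel₀ hb.ne']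
  simp

lemma T_eq (m : ℕ) {x b : ℝ} (hx : 0 < x) (hb : 0 < b) (ξ : ℝ) :
    T m x b ξ = ((b ^ (-(1/2) : ℝ) : ℝ) : ℂ) * Jc m (x * b) ξ := by
  rw [T, Jc_scale m hx hb, ← mul_assoc, ← ofReal_mul, ← Real.rpow_natCast, ← Real.rpow_add hb]
  congr 3
  push_cast
  ring

theorem T_re_formula (m : ℕ) {x b ξ : ℝ} (hx : 0 < x) (hb : 0 < b) (hξ : 0 < ξ) :
    (((T m x b ξ).re : ℝ) : ℂ) = (-1) ^ m / (2 * π) ^ (2 * m) * (√(2 * x) / 4 : ℝ) *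
      iteratedDeriv (2 * m) (qC (2 * π * x * b)) ξ := by
  rw [T_eq m hx hb, Complex.re_ofReal_mul, ofReal_mul, Jc_re_formula m (mul_pos hx hb) hξ]
  have e1 : 2 * π * (x * b) = 2 * π * x * b := by ring
  have e2 : √(2 * (x * b)) = √(2 * x) * √b := by
    rw [← mul_assoc, Real.sqrt_mul (by positivity)]
  have e3 : b ^ (-(1/2) : ℝ) * √b = 1 := by
    rw [Real.sqrt_eq_rpow, ← Real.rpow_add hb]; norm_num
  have e4 : ((b ^ (-(1/2) : ℝ) : ℝ) : ℂ) * ((√b : ℝ) : ℂ) = 1 := by exact_mod_cast e3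
  rw [e1, e2]
  set D := iteratedDeriv (2 * m) (qC (2 * π * x * b)) ξ
  calc _ = (((b ^ (-(1/2) : ℝ) : ℝ) : ℂ) * ((√b : ℝ) : ℂ)) * ((-1) ^ m / (2 * π) ^ (2 * m) * (√(2 * x) / 4 : ℝ) * D) := by
        push_cast; ring
    _ = _ := by rw [e4, one_mul]

noncomputable def J0 (m : ℕ) (x : ℝ) : ℝ := (4 * m + 1).factorial * (-1) ^ m / (2 ^ (2 * m) * (8 * π ^ 2 * x) ^ (2 * m + 1))

lemma Jc_zero (m : ℕ) {x : ℝ} (hx : 0 < x) : -(Jc m x 0).im = J0 m x := by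
  have ha := al_pos hx
  have h := MeasureTheory.integral_comp_rpow_Ioi (fun t : ℝ => ((t ^ (2 * m) * Real.cos (2 * π * 0 * t) : ℝ) : ℂ) * Kf x t)
    (p := 2) two_ne_zero
  have h1 : Jc m x 0 = 2 * ((4 * m + 1).factorial / ((1 + I) * al x) ^ (4 * m + 1 + 1)) := by
    rw [Jc, ← h, ← laplace_pow (4 * m + 1) (p := (1 + I) * al x) (by simpa using ha), ← integral_const_mul]
    refine setIntegral_congr_fun measurableSet_Ioi fun s hs => ?_
    have hs0 : 0 < s := hs
    have e2 : s ^ (2 : ℝ) = s ^ 2 := by norm_cast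
    have e3 : s ^ (2 - 1 : ℝ) = s := by norm_num
    rw [e2, e3, Kf, Real.sqrt_sq hs0.le, mul_zero, zero_mul, Real.cos_zero, Complex.real_smul]
    rw [show -((1 + I) * ((al x * s : ℝ) : ℂ)) = -((1 + I) * al x) * s by push_cast; ring]
    push_cast
    rw [abs_of_pos two_pos]
    push_cast
    ring
  have h2 : ((1 + I) * (al x : ℂ)) ^ (4 * m + 1 + 1) = ((2 ^ (2 * m + 1) * (-1) ^ m * (8 * π ^ 2 * x) ^ (2 * m + 1) : ℝ) : ℂ) * I := by
    rw [show 4 * m + 1 + 1 = 2 * (2 * m + 1) by ring, pow_mul]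
    have e : ((1 + I) * (al x : ℂ)) ^ 2 = ((2 * (8 * π ^ 2 * x) : ℝ) : ℂ) * I := by
      have : al x ^ 2 = 8 * π ^ 2 * x := by
        unfold al
        rw [mul_pow, Real.sq_sqrt (by positivity)]; ring
      rw [mul_pow, ← ofReal_pow, this, add_sq, I_sq]; push_cast; ring
    rw [e, mul_pow, pow_succ I, pow_mul I, I_sq, ← ofReal_pow, mul_pow]
    push_cast
    ring
  rw [h1, h2, J0]
  have e5 : (2 * (((4 * m + 1).factorial : ℂ) / (((2 ^ (2 * m + 1) * (-1) ^ m * (8 * π ^ 2 * x) ^ (2 * m + 1) : ℝ) : ℂ) * I)))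
     = ((2 * ((4 * m + 1).factorial / (2 ^ (2 * m + 1) * (-1) ^ m * (8 * π ^ 2 * x) ^ (2 * m + 1))) : ℝ) : ℂ) * (-I) := by
    have hI : (I : ℂ) ≠ 0 := I_ne_zero
    rw [← div_div, div_I]
    push_cast
    ring
  rw [e5, Complex.im_ofReal_mul]
  have hsq : ((-1 : ℝ) ^ m) * (-1) ^ m = 1 := by rw [← mul_pow]; simp
  have hne : ((-1 : ℝ) ^ m) ≠ 0 := pow_ne_zero _ (by norm_num)
  simp only [neg_im, I_im]
  rw [pow_succ (2:ℝ) (2 * m)]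
  field_simp
  nlinarith [hsq]

lemma Jc_im (m : ℕ) {x : ℝ} (ξ : ℝ) (hx : 0 < x) :
    -(Jc m x ξ).im = ∫ t in Set.Ioi (0:ℝ), (t ^ (2 * m) * (-(Kf x t).im)) * Real.cos (2 * π * ξ * t) := by
  unfold Jc
  rw [show (∫ t in Set.Ioi (0:ℝ), ((t ^ (2 * m) * Real.cos (2 * π * ξ * t) : ℝ) : ℂ) * Kf x t).im
    = ∫ t in Set.Ioi (0:ℝ), (((t ^ (2 * m) * Real.cos (2 * π * ξ * t) : ℝ) : ℂ) * Kf x t).im from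
      (integral_im (Jc_intble m ξ hx)).symm, ← integral_neg]
  refine integral_congr_ae (Eventually.of_forall fun t => ?_)
  simp only
  rw [Complex.im_ofReal_mul]; ring

lemma Kf_im_decay (n : ℕ) {x t : ℝ} (hx : 0 < x) (ht : 0 < t) :
    |t ^ n * (-(Kf x t).im)| ≤ ((2 * n + 3).factorial / al x ^ (2 * n + 3)) * t ^ (-(3/2) : ℝ) := by
  have ha := al_pos hx
  rw [abs_mul, abs_neg, abs_of_pos (by positivity : 0 < t ^ n)]
  have h1 : |(Kf x t).im| ≤ Real.exp (-al x * √t) := by rw [← Kf_norm]; exact Complex.abs_im_le_norm _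
  have h2 := Real.pow_div_factorial_le_exp (al x * √t) (by positivity) (2 * n + 3)
  have h3 : (√t) ^ (2 * n + 3) = t ^ n * t ^ (3/2 : ℝ) := by
    rw [Real.sqrt_eq_rpow, ← Real.rpow_natCast, ← Real.rpow_natCast, ← Real.rpow_mul ht.le, ← Real.rpow_add ht]
    congr 1; push_cast; ring
  rw [mul_pow, h3] at h2
  calc _ ≤ t ^ n * Real.exp (-al x * √t) := by gcongr
    _ = t ^ n * (Real.exp (al x * √t))⁻¹ := by rw [neg_mul, Real.exp_neg]
    _ ≤ t ^ n * (al x ^ (2 * n + 3) * (t ^ n * t ^ (3/2 : ℝ)) / (2 * n + 3).factorial)⁻¹ := by gcongr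
    _ = _ := by
      rw [Real.rpow_neg ht.le]
      field_simp

lemma Kf_im_int (n : ℕ) {x : ℝ} (hx : 0 < x) :
    IntegrableOn (fun t : ℝ => t ^ n * (-(Kf x t).im)) (Set.Ioi 0) := by
  have hK := Kf_cont x
  refine Integrable.mono' (int_pow_exp_sqrt n (al_pos hx)) ((by fun_prop : Continuous _).aestronglyMeasurable) ?_
  refine (ae_restrict_iff' measurableSet_Ioi).2 (Eventually.of_forall fun t ht => ?_)
  have ht' : 0 < t := ht
  rw [norm_mul, Real.norm_eq_abs, abs_of_pos (by positivity : 0 < t ^ n), ← Kf_norm, norm_neg]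
  gcongr
  exact Complex.abs_im_le_norm _

lemma summable_rpow_shift {s : ℝ} (hs : 1 < s) : Summable fun j : ℕ => ((j + 1 : ℕ) : ℝ) ^ (-s) :=
  (summable_nat_add_iff 1).2 (Real.summable_nat_rpow.2 (by linarith))

/-- Poisson summation in `k`. -/
theorem poisson_k (m : ℕ) {x b : ℝ} (hx : 0 < x) (hb : 0 < b) :
    (Summable fun k : ℕ => b ^ (-(1/2) : ℝ) * (((k + 1 : ℕ) : ℝ) ^ (2 * m) * (-(Kf x (b * (k + 1 : ℕ))).im))) ∧
    (Summable fun j : ℕ => -(T m x b (j + 1 : ℕ)).im) ∧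
    ∑' k : ℕ, b ^ (-(1/2) : ℝ) * (((k + 1 : ℕ) : ℝ) ^ (2 * m) * (-(Kf x (b * (k + 1 : ℕ))).im))
      = b ^ (-(2 * m + 3/2) : ℝ) * J0 m x + 2 * ∑' j : ℕ, -(T m x b (j + 1 : ℕ)).im := by
  have hxb : 0 < x * b := mul_pos hx hb
  have hTs : Summable fun j : ℕ => -(T m x b (j + 1 : ℕ)).im := by
    obtain ⟨K, hK, h⟩ := T_bound m hx
    refine Summable.of_norm_bounded (g := fun j : ℕ => K * (b ^ ((2 * m + 3/2 : ℝ) - (2 * m + 3/2)) * ((j + 1 : ℕ) : ℝ) ^ (-(2 * m + 3/2) : ℝ)))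
      (((summable_rpow_shift (by linarith [(Nat.cast_nonneg m : (0:ℝ) ≤ m)])).mul_left _).mul_left _) fun j => ?_
    rw [norm_neg, Real.norm_eq_abs]
    exact (Complex.abs_im_le_norm _).trans (h _ (by positivity) le_rfl _ _ hb (by positivity))
  have hb2 : b ^ (-(1/2) : ℝ) ≠ 0 := by positivity
  have hTj : ∀ ξ : ℝ, -(T m x b ξ).im = b ^ (-(1/2) : ℝ) *
      ∫ t in Set.Ioi (0:ℝ), (t ^ (2 * m) * (-(Kf (x * b) t).im)) * Real.cos (2 * π * ξ * t) := by
    intro ξ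
    rw [T_eq m hx hb, Complex.im_ofReal_mul, ← Jc_im m ξ hxb]; ring
  have hP := poisson_even (f := fun t : ℝ => t ^ (2 * m) * (-(Kf (x * b) t).im))
    (by have := Kf_cont (x * b); fun_prop) (by simp [Kf])
    (fun t ht => Kf_im_decay (2 * m) hxb (by linarith)) (Kf_im_int (2 * m) hxb)
    (by
      have := hTs.mul_left (b ^ (-(1/2) : ℝ))⁻¹
      refine this.congr fun j => ?_
      rw [hTj, inv_mul_cancel_left₀ hb2])
  have e0 : ∫ t in Set.Ioi (0:ℝ), t ^ (2 * m) * (-(Kf (x * b) t).im) = J0 m (x * b) := by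
    rw [← Jc_zero m hxb, Jc_im m 0 hxb]
    simp
  obtain ⟨hs1, hs2⟩ := hP
  have hKs : ∀ k : ℕ, Kf x (b * (k + 1 : ℕ)) = Kf (x * b) (k + 1) := by
    intro k; rw [Kf_scale hx hb]; push_cast; rfl
  refine ⟨?_, hTs, ?_⟩
  · refine (hs1.mul_left (b ^ (-(1/2) : ℝ))).congr fun k => ?_
    rw [hKs]; push_cast; rfl
  · rw [tsum_mul_left]
    have e1 : ∑' k : ℕ, (((k + 1 : ℕ) : ℝ) ^ (2 * m) * (-(Kf x (b * (k + 1 : ℕ))).im)) =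
        ∑' k : ℕ, ((k:ℝ) + 1) ^ (2 * m) * (-(Kf (x * b) (k + 1)).im) := by
      refine tsum_congr fun k => ?_
      rw [hKs]; push_cast; rfl
    rw [e1, hs2, e0]
    simp only [hTj]
    rw [tsum_mul_left, mul_add]
    have e2 : b ^ (-(1/2) : ℝ) * J0 m (x * b) = b ^ (-(2 * m + 3/2) : ℝ) * J0 m x := by
      unfold J0
      rw [← mul_assoc (8 * π ^ 2), mul_pow _ b, show (-(2 * m + 3/2) : ℝ) = -(1/2) - ((2 * m + 1 : ℕ) : ℝ) by push_cast; ring,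
        Real.rpow_sub hb, Real.rpow_natCast]
      field_simp
    rw [e2]
    ring

end CS

namespace CS
open MeasureTheory Filter Topology

lemma iter_cpow (s : ℂ) (n : ℕ) : ∀ w : ℂ, 0 < w.re →
    iteratedDeriv n (fun z : ℂ => z ^ s) w = (∏ i ∈ Finset.range n, (s - i)) * w ^ (s - n) := by
  induction n with
  | zero => intro w hw; simp
  | succ n ih =>
    intro w hw
    rw [iteratedDeriv_succ]
    have h1 : iteratedDeriv n (fun z : ℂ => z ^ s) =ᶠ[𝓝 w]
        fun z => (∏ i ∈ Finset.range n, (s - i)) * z ^ (s - n) := by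
      filter_upwards [isOpen_hp.mem_nhds hw] with z hz using ih z hz
    rw [h1.deriv_eq]
    have h2 : HasDerivAt (fun z : ℂ => z ^ (s - n)) ((s - n) * w ^ (s - n - 1) * 1) w :=
      (hasDerivAt_id w).cpow_const (Or.inl hw)
    rw [(h2.const_mul _).deriv, Finset.prod_range_succ]
    push_cast
    rw [show s - (n + 1 : ℂ) = s - n - 1 by ring]
    ring

lemma tluo_iter {ι : Type*} {U : Set ℂ} {φ : Filter ι} {F : ι → ℂ → ℂ} {f : ℂ → ℂ} (hU : IsOpen U)
    (hF : ∀ᶠ i in φ, DifferentiableOn ℂ (F i) U) (h : TendstoLocallyUniformlyOn F f φ U) (n : ℕ) :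
    TendstoLocallyUniformlyOn (fun i => iteratedDeriv n (F i)) (iteratedDeriv n f) φ U := by
  induction n with
  | zero => simpa using h
  | succ n ih =>
    have := ih.deriv (by filter_upwards [hF] with i hi using diffOn_iter hU hi n) hU
    simpa only [iteratedDeriv_succ, Function.comp_def] using this

lemma hasSum_iter {ι : Type*} {U : Set ℂ} {F : ι → ℂ → ℂ} {u : ι → ℝ} (hU : IsOpen U)
    (hF : ∀ i, DifferentiableOn ℂ (F i) U) (hu : Summable u) (hb : ∀ i, ∀ w ∈ U, ‖F i w‖ ≤ u i) (n : ℕ)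
    {z : ℂ} (hz : z ∈ U) :
    HasSum (fun i => iteratedDeriv n (F i) z) (iteratedDeriv n (fun w => ∑' i, F i w) z) := by
  have h1 := (tendstoUniformlyOn_tsum hu hb).tendstoLocallyUniformlyOn
  have h2 := tluo_iter hU (Eventually.of_forall fun t => DifferentiableOn.fun_sum fun i _ => hF i) h1 n
  have h3 := h2.tendsto_at hz
  refine h3.congr fun t => ?_
  rw [iteratedDeriv_fun_sum]
  intro i _
  exact ((hF i).contDiffOn hU).contDiffAt (hU.mem_nhds hz)

/-- the constant -/
noncomputable def kap (m : ℕ) (x : ℝ) : ℝ := (-1) ^ m / (2 * π) ^ (2 * m) * (√(2 * x) / 4)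

noncomputable def Gf (m : ℕ) (c v : ℝ) : ℝ := v ^ (2 * m + 1/2 : ℝ) * Q m (c * v)

lemma lim_qC (n : ℕ) {w : ℂ} (hw : 0 < w.re) {A : ℝ} :
    Tendsto (fun b : ℝ => iteratedDeriv n (qC (A * b)) w) (𝓝[>] 0)
      (𝓝 ((∏ i ∈ Finset.range n, ((-(3/2) : ℂ) - i)) * w ^ (-(3/2) - n : ℂ))) := by
  have h : TendstoLocallyUniformlyOn (fun b : ℝ => qC (A * b)) (fun w => w ^ (-(3/2) : ℂ)) (𝓝[>] 0) {w | 0 < w.re} := by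
    rw [tendstoLocallyUniformlyOn_iff_forall_tendsto]
    intro z hz
    have hz0 : 0 < z.re := hz
    have hne : z ≠ 0 := by rintro rfl; simp at hz0
    have c1 : ContinuousAt (fun y : ℝ × ℂ => y.2 ^ (-(3/2) : ℂ)) (0, z) :=
      ContinuousAt.cpow continuousAt_snd continuousAt_const (Or.inl hz0)
    have c2 : ContinuousAt (fun y : ℝ × ℂ => qC (A * y.1) y.2) (0, z) := by
      unfold qC
      refine c1.mul (Complex.continuous_exp.continuousAt.comp ?_)
      refine ContinuousAt.div ?_ continuousAt_snd hne
      fun_prop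
    have hle : (𝓝[>] (0:ℝ)) ×ˢ 𝓝[{w : ℂ | 0 < w.re}] z ≤ 𝓝 ((0:ℝ), z) := by
      rw [nhds_prod_eq]
      exact Filter.prod_mono nhdsWithin_le_nhds nhdsWithin_le_nhds
    have c3 : qC (A * (0:ℝ)) z = z ^ (-(3/2) : ℂ) := by simp [qC]
    have h1 := c1.tendsto.mono_left hle
    have h2 := c2.tendsto.mono_left hle
    simp only [c3] at h2
    exact (h1.prodMk_nhds h2).mono_right (nhds_le_uniformity _)
  have h2 := (tluo_iter isOpen_hp (Eventually.of_forall fun b => qC_diff _) h n).tendsto_at hw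
  rwa [iter_cpow _ _ _ hw] at h2

lemma Gf_exp_intble (m : ℕ) {c : ℝ} (hc : 0 < c) (b : ℝ) :
    Integrable (fun u : ℝ => ((Gf m c u : ℝ) : ℂ) * cexp (-(2 * π * I) * (b * u : ℝ))) (volume.restrict (Set.Ioi 0)) := by
  refine (GQ_int m hc).ofReal.mul_bdd (c := 1) (Continuous.aestronglyMeasurable (by fun_prop)) (Eventually.of_forall fun v => ?_)
  exact (norm_exp_2pii _).le

/-- `C ∫ G_j = D j^{-2 * m - 3/2}` -/
theorem int_Gf (m : ℕ) {x ξ : ℝ} (hx : 0 < x) (hξ : 0 < ξ) :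
    Cp m x * ∫ u in Set.Ioi (0:ℝ), Gf m (ξ / x) u =
      kap m x * (∏ i ∈ Finset.range (2 * m), ((-(3/2) : ℝ) - i)) * ξ ^ (-(2 * m + 3/2) : ℝ) := by
  have hc : 0 < ξ / x := by positivity
  have hL : Tendsto (fun b : ℝ => (1 + I) * Cp m x *
      ∫ u in Set.Ioi (0:ℝ), ((Gf m (ξ / x) u : ℝ) : ℂ) * cexp (-(2 * π * I) * (b * u : ℝ))) (𝓝[>] 0)
      (𝓝 ((1 + I) * Cp m x * ∫ u in Set.Ioi (0:ℝ), ((Gf m (ξ / x) u : ℝ) : ℂ))) := by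
    refine Tendsto.const_mul _ ?_
    refine tendsto_integral_filter_of_dominated_convergence _ ?_ ?_ (GQ_int m hc).norm ?_
    · exact Eventually.of_forall fun b => (Gf_exp_intble m hc b).aestronglyMeasurable
    · refine Eventually.of_forall fun b => Eventually.of_forall fun u => ?_
      rw [norm_mul, norm_exp_2pii, mul_one, Complex.norm_real]; rfl
    · refine Eventually.of_forall fun u => ?_
      have : Continuous (fun b : ℝ => ((Gf m (ξ / x) u : ℝ) : ℂ) * cexp (-(2 * π * I) * (b * u : ℝ))) := by fun_prop
      have h := this.tendsto 0
      simp only [zero_mul, ofReal_zero, mul_zero, Complex.exp_zero, mul_one] at h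
      exact h.mono_left nhdsWithin_le_nhds
  have hL2 := (Complex.continuous_ofReal.tendsto _).comp ((Complex.continuous_re.tendsto _).comp hL)
  have hR := (lim_qC (2 * m) (w := (ξ:ℂ)) (by simpa using hξ) (A := 2 * π * x)).const_mul ((kap m x : ℝ) : ℂ)
  have hlim := tendsto_nhds_unique_of_eventuallyEq hL2 hR (by
    filter_upwards [self_mem_nhdsWithin] with b hb
    have hb0 : (0:ℝ) < b := hb
    have h1 := T_re_formula m hx hb0 hξ
    rw [T_formula m hx hb0 hξ] at h1
    simp only [Function.comp_def]
    rw [show (kap m x : ℂ) = (-1) ^ m / (2 * π) ^ (2 * m) * (√(2 * x) / 4 : ℝ) by unfold kap; push_cast; ring]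
    exact h1)
  rw [integral_complex_ofReal] at hlim
  have e1 : ((1 + I) * (Cp m x : ℂ) * ((∫ u in Set.Ioi (0:ℝ), Gf m (ξ / x) u : ℝ) : ℂ)).re
      = Cp m x * ∫ u in Set.Ioi (0:ℝ), Gf m (ξ / x) u := by
    rw [mul_assoc, ← ofReal_mul, mul_comm, Complex.re_ofReal_mul]
    simp
  rw [e1] at hlim
  have e2 : ((ξ:ℂ)) ^ (-(3/2) - ((2 * m : ℕ) : ℂ)) = ((ξ ^ (-(2 * m + 3/2) : ℝ) : ℝ) : ℂ) := by
    rw [Complex.ofReal_cpow hξ.le]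
    congr 1; push_cast; ring
  rw [e2] at hlim
  rw [← Complex.ofReal_inj, hlim]
  push_cast
  ring

/-- Poisson summation in `b`. -/
theorem poisson_b (m : ℕ) {x ξ : ℝ} (hx : 0 < x) (hξ : 0 < ξ) :
    (Summable fun b : ℕ => T m x (b + 1 : ℕ) ξ) ∧
    (Summable fun d : ℕ => Gf m (ξ / x) (d + 1)) ∧
    ∑' b : ℕ, ((T m x (b + 1 : ℕ) ξ).re + (T m x (b + 1 : ℕ) ξ).im) =
      Cp m x * (∑' d : ℕ, Gf m (ξ / x) (d + 1)) - Cp m x * ∫ u in Set.Ioi (0:ℝ), Gf m (ξ / x) u := by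
  have hc : 0 < ξ / x := by positivity
  have hTs : Summable fun b : ℕ => T m x (b + 1 : ℕ) ξ := by
    obtain ⟨K, hK, h⟩ := T_bound m hx
    refine Summable.of_norm_bounded (g := fun b : ℕ => K * ((((b + 1 : ℕ) : ℝ) ^ (-(2 * m + 3/2) : ℝ)) * ξ ^ (-0 : ℝ)))
      (((summable_rpow_shift (by linarith [(Nat.cast_nonneg m : (0:ℝ) ≤ m)])).mul_right _).mul_left _) fun j => ?_
    have := h 0 le_rfl (by positivity) ((j + 1 : ℕ) : ℝ) ξ (by positivity) hξ
    rwa [zero_sub] at this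
  have hT2 : ∀ b : ℝ, 0 < b → (T m x b ξ).re + (T m x b ξ).im = 2 * Cp m x *
      ∫ u in Set.Ioi (0:ℝ), Gf m (ξ / x) u * Real.cos (2 * π * b * u) := by
    intro b hb
    have h1 : (T m x b ξ).re + (T m x b ξ).im = ((1 - I) * T m x b ξ).re := by simp
    rw [h1, T_formula m hx hb hξ]
    set A := ∫ u in Set.Ioi (0:ℝ), ((u ^ (2 * m + 1/2 : ℝ) * Q m (ξ / x * u) : ℝ) : ℂ) *
          cexp (-(2 * π * I) * (b * u : ℝ)) with hA
    have h2 : (1 - I) * ((1 + I) * (Cp m x : ℂ) * A) = ((2 * Cp m x : ℝ) : ℂ) * A := by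
      push_cast; linear_combination (-(Cp m x : ℂ) * A) * I_sq
    rw [h2, Complex.re_ofReal_mul]
    congr 1
    rw [hA]
    rw [show (∫ u in Set.Ioi (0:ℝ), ((u ^ (2 * m + 1/2 : ℝ) * Q m (ξ / x * u) : ℝ) : ℂ) *
          cexp (-(2 * π * I) * (b * u : ℝ))).re = ∫ u in Set.Ioi (0:ℝ), (((u ^ (2 * m + 1/2 : ℝ) * Q m (ξ / x * u) : ℝ) : ℂ) *
          cexp (-(2 * π * I) * (b * u : ℝ))).re from (integral_re (Gf_exp_intble m hc b)).symm]
    refine integral_congr_ae (Eventually.of_forall fun u => ?_)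
    simp only
    rw [Complex.re_ofReal_mul, Complex.exp_re, Gf]
    congr 1
    simp [mul_assoc]
  have hC : 0 < Cp m x := by unfold Cp; positivity
  have hP := poisson_even (f := Gf m (ξ / x)) (C := (2 * m + 1) * ((ξ / x) ^ (2 * m))⁻¹ * ((ξ / x) ^ 2)⁻¹)
    (by
      have := Q_cont m
      have h3 : Continuous fun t : ℝ => |t| ^ (2 * m + 1/2 : ℝ) :=
        continuous_abs.rpow_const fun t => Or.inr (by positivity)
      unfold Gf
      fun_prop) (by
        unfold Gf
        rw [Real.zero_rpow (by positivity), zero_mul])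
    (fun t ht => by
      have ht0 : 0 < t := by linarith
      refine (GQ_bound m hc ht0).trans ?_
      rw [mul_assoc ((2 * m + 1) * ((ξ / x) ^ (2 * m))⁻¹)]
      gcongr
      calc _ ≤ t ^ (1/2 : ℝ) / ((ξ / x * t) ^ 2) := by gcongr; linarith
        _ = ((ξ / x) ^ 2)⁻¹ * (t ^ (1/2 : ℝ) * (t ^ 2)⁻¹) := by rw [mul_pow]; field_simp
        _ = _ := by
          rw [← Real.rpow_natCast t 2, ← Real.rpow_neg ht0.le, ← Real.rpow_add ht0]
          norm_num) (GQ_int m hc)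
    (by
      have h4 : Summable fun b : ℕ => (T m x (b + 1 : ℕ) ξ).re + (T m x (b + 1 : ℕ) ξ).im :=
        (Complex.reCLM.summable hTs).add (Complex.imCLM.summable hTs)
      refine (h4.mul_left (2 * Cp m x)⁻¹).congr fun b => ?_
      rw [hT2 _ (by positivity), inv_mul_cancel_left₀ (by positivity)])
  refine ⟨hTs, hP.1, ?_⟩
  have e : ∀ b : ℕ, (T m x (b + 1 : ℕ) ξ).re + (T m x (b + 1 : ℕ) ξ).im = 2 * Cp m x *
      ∫ u in Set.Ioi (0:ℝ), Gf m (ξ / x) u * Real.cos (2 * π * (b + 1 : ℕ) * u) := fun b => hT2 _ (by positivity)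
  rw [tsum_congr e, tsum_mul_left, hP.2]
  ring

end CS

namespace CS
open MeasureTheory Filter Topology

noncomputable def hh (x : ℝ) (d : ℕ) (w : ℂ) : ℂ := w ^ (-(1/2) : ℂ) * (x / (x ^ 2 + d ^ 2 * w ^ 2))

lemma hp_ne {w : ℂ} (hw : 0 < w.re) : w ≠ 0 := by rintro rfl; simp at hw

lemma norm_re_le (z : ℂ) : z.re ≤ ‖z‖ := (le_abs_self _).trans (Complex.abs_re_le_norm z)

lemma den_bound (x : ℝ) (d : ℕ) {w : ℂ} (hw : 0 < w.re) :
    (d * w.re) ^ 2 ≤ ‖(x:ℂ) ^ 2 + d ^ 2 * w ^ 2‖ := by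
  have h : (x:ℂ) ^ 2 + d ^ 2 * w ^ 2 = (d * w + I * x) * (d * w - I * x) := by
    ring_nf; rw [I_sq]; ring
  rw [h, norm_mul, sq]
  have h1 : (d * w.re) ≤ ‖(d * w + I * x : ℂ)‖ := by
    refine le_trans (le_of_eq ?_) (norm_re_le _); simp
  have h2 : (d * w.re) ≤ ‖(d * w - I * x : ℂ)‖ := by
    refine le_trans (le_of_eq ?_) (norm_re_le _); simp
  exact mul_le_mul h1 h2 (by positivity) (norm_nonneg _)

lemma den_ne (x : ℝ) {d : ℕ} (hd : 0 < d) {w : ℂ} (hw : 0 < w.re) : (x:ℂ) ^ 2 + d ^ 2 * w ^ 2 ≠ 0 := by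
  have := den_bound x d hw
  have h2 : 0 < (d * w.re) ^ 2 := by positivity
  intro h
  rw [h, norm_zero] at this
  linarith

lemma cot_id {x : ℝ} (hx : 0 < x) {w : ℂ} (hw : 0 < w.re) :
    ∑' b : ℕ, qC (2 * π * x * ((b + 1 : ℕ) : ℝ)) w = (1 / (2 * π * x)) * w ^ (-(1/2) : ℂ)
      - 1/2 * w ^ (-(3/2) : ℂ) + 1 / π * ∑' d : ℕ, hh x (d + 1) w := by
  have hw0 := hp_ne hw
  have hx0 : (x:ℂ) ≠ 0 := by exact_mod_cast hx.ne'
  have hpi : (π:ℂ) ≠ 0 := by exact_mod_cast Real.pi_ne_zero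
  set z : ℂ := I * (x / w) with hz
  have hzim : 0 < z.im := by
    have : z.im = x * (w.re / normSq w) := by
      rw [hz]; simp [div_eq_mul_inv, Complex.inv_re]
    rw [this]
    have : 0 < normSq w := normSq_pos.2 hw0
    positivity
  have e1 := pi_mul_cot_pi_q_exp ⟨z, hzim⟩
  have e2 := cot_series_rep' (UpperHalfPlane.coe_mem_integerComplement ⟨z, hzim⟩)
  have e3 := UpperHalfPlane.norm_exp_two_pi_I_lt_one ⟨z, hzim⟩
  simp only at e1 e2 e3
  have hexp : 2 * π * I * z = -(2 * π * x) / w := by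
    rw [hz]; field_simp; rw [I_sq]
  rw [hexp] at e1 e3
  set q := cexp (-(2 * π * x) / w) with hq
  have l1 : ∀ b : ℕ, qC (2 * π * x * ((b + 1 : ℕ) : ℝ)) w = w ^ (-(3/2) : ℂ) * q * q ^ b := by
    intro b
    unfold qC
    rw [mul_assoc (w ^ (-(3/2) : ℂ)) q, ← pow_succ', hq, ← Complex.exp_nat_mul]
    push_cast
    congr 2
    ring
  simp_rw [l1]
  rw [tsum_mul_left]
  rw [tsum_geometric_of_norm_lt_one e3] at e1 ⊢
  have hq1 : 1 - q ≠ 0 := by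
    intro h
    have : q = 1 := by linear_combination -h
    rw [this] at e3; simp at e3
  have l2 : ∀ n : ℕ, 1 / (z - (n + 1)) + 1 / (z + (n + 1)) = (-2 * I * w ^ (3/2 : ℂ)) * hh x (n + 1) w := by
    intro n
    have hden := den_ne x (d := n + 1) (by omega) hw
    push_cast at hden
    have f1 : z - (n + 1) ≠ 0 := by
      intro h
      have := congrArg Complex.im h
      simp at this
      exact hzim.ne' this
    have f2 : z + (n + 1) ≠ 0 := by
      intro h
      have := congrArg Complex.im h
      simp at this
      exact hzim.ne' this
    have f3 : w ^ (3/2 : ℂ) * w ^ (-(1/2) : ℂ) = w := by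
      rw [← Complex.cpow_add _ _ hw0]; norm_num
    have f4 : (-2 * I * w ^ (3/2 : ℂ)) * hh x (n + 1) w = -2 * I * (w * (x / (x ^ 2 + (n + 1) ^ 2 * w ^ 2))) := by
      unfold hh
      push_cast
      linear_combination (-2 * I * (x / (x ^ 2 + (n + 1) ^ 2 * w ^ 2))) * f3
    rw [f4]
    have f5 : (z - (n + 1)) * (z + (n + 1)) * w ^ 2 = -(x ^ 2 + (n + 1) ^ 2 * w ^ 2) := by
      have : z * w = I * x := by rw [hz]; field_simp
      linear_combination (z * w + I * x) * this + x ^ 2 * I_sq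
    have f6 : z * w = I * x := by rw [hz]; field_simp
    rw [div_add_div _ _ f1 f2, ← mul_div_assoc, ← mul_div_assoc, div_eq_div_iff (mul_ne_zero f1 f2) hden]
    have : (x:ℂ) ^ 2 + (n + 1) ^ 2 * w ^ 2 = -((z - (n + 1)) * (z + (n + 1)) * w ^ 2) := by rw [f5]; ring
    rw [this]
    linear_combination (-2 * w * (z - (n + 1)) * (z + (n + 1))) * f6
  simp_rw [l2] at e2
  rw [tsum_mul_left] at e2
  rw [e1] at e2
  set S := ∑' d : ℕ, hh x (d + 1) w with hS
  have hzz : 1 / z = -I * w / x := by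
    rw [hz]; field_simp; rw [I_sq]; ring
  rw [hzz] at e2
  have f3 : w ^ (3/2 : ℂ) * w ^ (-(3/2) : ℂ) = 1 := by
    rw [← Complex.cpow_add _ _ hw0]; norm_num
  have f4 : w * w ^ (-(3/2) : ℂ) = w ^ (-(1/2) : ℂ) := by
    nth_rw 1 [← Complex.cpow_one w]
    rw [← Complex.cpow_add _ _ hw0]; norm_num
  have e4 : q * (1 - q)⁻¹ = -1/2 + w / (2 * π * x) + 1 / π * (w ^ (3/2 : ℂ) * S) := by
    have e5 : q * (1 - q)⁻¹ = (1 - q)⁻¹ - 1 := by field_simp; ring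
    rw [e5]
    have e6 : (2 * π * I) * ((1 - q)⁻¹ - 1) = (2 * π * I) * (-1/2 + w / (2 * π * x) + 1 / π * (w ^ (3/2 : ℂ) * S)) := by
      have : (2 * π * I) * (-1/2 + w / (2 * π * x) + 1 / π * (w ^ (3/2 : ℂ) * S)) = - π * I + I * w / x + 2 * I * (w ^ (3/2 : ℂ) * S) := by
        field_simp
      rw [this]
      linear_combination -e2
    exact mul_left_cancel₀ (by simp [hpi]) e6
  rw [mul_assoc, e4]
  linear_combination (1 / (2 * π * x)) * f4 + 1 / π * S * f3

/-- Local boundedness of powers -/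
lemma cpow_loc_bdd (s : ℂ) {ξ : ℝ} (hξ : 0 < ξ) : ∃ M : ℝ, 0 ≤ M ∧ ∀ w ∈ Metric.ball (ξ:ℂ) (ξ/2), ‖w ^ s‖ ≤ M := by
  have hc : ContinuousOn (fun w : ℂ => w ^ s) (Metric.closedBall (ξ:ℂ) (ξ/2)) := by
    intro w hw
    refine (ContinuousAt.cpow continuousAt_id continuousAt_const (Or.inl ?_)).continuousWithinAt
    have := (Complex.abs_re_le_norm (w - ξ)).trans (by simpa [dist_eq_norm] using hw : ‖w - ξ‖ ≤ ξ/2)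
    simp only [sub_re, ofReal_re] at this
    have := abs_le.1 this
    simp only [id]
    linarith
  obtain ⟨M, hM⟩ := (isCompact_closedBall _ _).exists_bound_of_continuousOn hc
  refine ⟨max M 0, le_max_right _ _, fun w hw => (hM w (Metric.ball_subset_closedBall hw)).trans (le_max_left _ _)⟩

lemma ball_re {ξ : ℝ} {w : ℂ} (hw : w ∈ Metric.ball (ξ:ℂ) (ξ/2)) : ξ / 2 < w.re ∧ ‖w‖ < 3 * ξ / 2 := by
  have h0 : ‖w - ξ‖ < ξ/2 := by simpa [dist_eq_norm] using hw
  have hξ : 0 < ξ := by have := norm_nonneg (w - ξ); linarith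
  have := (Complex.abs_re_le_norm (w - ξ)).trans_lt h0
  simp only [sub_re, ofReal_re] at this
  have h1 := abs_lt.1 this
  refine ⟨by linarith, ?_⟩
  have : ‖w‖ ≤ ‖w - ξ‖ + ‖(ξ:ℂ)‖ := by simpa using norm_add_le (w - ξ) (ξ:ℂ)
  rw [Complex.norm_of_nonneg hξ.le] at this
  linarith

lemma hh_diff (x : ℝ) {d : ℕ} (hd : 0 < d) : DifferentiableOn ℂ (hh x d) {w | 0 < w.re} := by
  intro w hw
  have hw' : 0 < w.re := hw
  unfold hh
  refine (DifferentiableAt.mul ?_ ?_).differentiableWithinAt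
  · exact DifferentiableAt.cpow_const differentiableAt_id (Or.inl hw')
  · exact DifferentiableAt.div (by fun_prop) (by fun_prop) (den_ne x hd hw')

lemma hh_bdd {x ξ : ℝ} (hx : 0 < x) (hξ : 0 < ξ) : ∃ u : ℕ → ℝ, Summable u ∧
    ∀ d, ∀ w ∈ Metric.ball (ξ:ℂ) (ξ/2), ‖hh x (d + 1) w‖ ≤ u d := by
  obtain ⟨M, hM0, hM⟩ := cpow_loc_bdd (-(1/2)) hξ
  refine ⟨fun d => M * (x * (ξ/2) ^ (-2:ℤ)) * (1 / ((d + 1 : ℕ):ℝ) ^ 2), ?_, ?_⟩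
  · refine Summable.mul_left _ ?_
    exact (summable_nat_add_iff 1).2 (Real.summable_one_div_nat_pow.2 (by norm_num : 1 < 2))
  · intro d w hw
    obtain ⟨h1, h2⟩ := ball_re hw
    have hw0 : 0 < w.re := by linarith
    unfold hh
    show _ ≤ M * (x * (ξ/2) ^ (-2:ℤ)) * (1 / ((d + 1 : ℕ):ℝ) ^ 2)
    rw [norm_mul, mul_assoc]
    refine mul_le_mul (hM w hw) ?_ (norm_nonneg _) hM0
    rw [norm_div, Complex.norm_of_nonneg hx.le]
    have h3 := den_bound x (d + 1) hw0
    have h4 : (((d + 1 : ℕ):ℝ) * (ξ / 2)) ^ 2 ≤ (((d + 1 : ℕ):ℝ) * w.re) ^ 2 := by gcongr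
    have h5 : (0:ℝ) < (((d + 1 : ℕ):ℝ) * (ξ / 2)) ^ 2 := by positivity
    calc x / ‖(x:ℂ) ^ 2 + ((d + 1 : ℕ):ℂ) ^ 2 * w ^ 2‖ ≤ x / (((d + 1 : ℕ):ℝ) * (ξ / 2)) ^ 2 :=
          div_le_div_of_nonneg_left hx.le h5 (h4.trans h3)
      _ = _ := by
          rw [zpow_neg]; norm_cast
          field_simp
          push_cast
          rfl

lemma qC_bdd {x ξ : ℝ} (hx : 0 < x) (hξ : 0 < ξ) : ∃ u : ℕ → ℝ, Summable u ∧
    ∀ b : ℕ, ∀ w ∈ Metric.ball (ξ:ℂ) (ξ/2), ‖qC (2 * π * x * ((b + 1 : ℕ) : ℝ)) w‖ ≤ u b := by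
  obtain ⟨M, hM0, hM⟩ := cpow_loc_bdd (-(3/2)) hξ
  set c : ℝ := (ξ / 2) / (3 * ξ / 2) ^ 2 with hc
  have hc0 : 0 < c := by positivity
  refine ⟨fun b => M * (Real.exp (-(2 * π * x * c))) ^ b, ?_, ?_⟩
  · refine Summable.mul_left _ (summable_geometric_of_lt_one (Real.exp_pos _).le ?_)
    rw [Real.exp_lt_one_iff]
    have : 0 < 2 * π * x * c := by positivity
    linarith
  · intro b w hw
    obtain ⟨h1, h2⟩ := ball_re hw
    have hw0 : 0 < w.re := by linarith
    unfold qC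
    rw [norm_mul]
    refine mul_le_mul (hM w hw) ?_ (norm_nonneg _) hM0
    rw [Complex.norm_exp, ← Real.exp_nat_mul, Real.exp_le_exp]
    have h3 : (-(((2 * π * x * ((b + 1 : ℕ) : ℝ) : ℝ)) : ℂ) / w).re = -(2 * π * x * ((b + 1 : ℕ) : ℝ) * (w.re / normSq w)) := by
      rw [div_eq_mul_inv, ← ofReal_neg, re_ofReal_mul, Complex.inv_re]; ring
    rw [h3]
    have h4 : c ≤ w.re / normSq w := by
      rw [hc, Complex.normSq_eq_norm_sq]
      have : 0 < ‖w‖ := norm_pos_iff.2 (hp_ne hw0)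
      gcongr
    have h5 : (b:ℝ) * (2 * π * x * c) ≤ 2 * π * x * ((b + 1 : ℕ) : ℝ) * (w.re / normSq w) := by
      calc (b:ℝ) * (2 * π * x * c) ≤ ((b + 1 : ℕ) : ℝ) * (2 * π * x * c) := by gcongr; simp
        _ = 2 * π * x * ((b + 1 : ℕ) : ℝ) * c := by ring
        _ ≤ _ := by gcongr
    linarith

lemma cpow_contDiffAt (s : ℂ) {w : ℂ} (hw : 0 < w.re) (n : ℕ) : ContDiffAt ℂ n (fun z : ℂ => z ^ s) w := by
  have : DifferentiableOn ℂ (fun z : ℂ => z ^ s) {w | 0 < w.re} := fun z hz =>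
    (DifferentiableAt.cpow_const differentiableAt_id (Or.inl hz)).differentiableWithinAt
  exact (this.contDiffOn isOpen_hp).contDiffAt (isOpen_hp.mem_nhds hw)

theorem sum_iter_qC (n : ℕ) {x ξ : ℝ} (hx : 0 < x) (hξ : 0 < ξ) :
    HasSum (fun b : ℕ => iteratedDeriv n (qC (2 * π * x * ((b + 1 : ℕ) : ℝ))) ξ)
      ((1 / (2 * π * x)) * ((∏ i ∈ Finset.range n, (-(1/2) - i : ℂ)) * (ξ:ℂ) ^ (-(1/2) - n : ℂ))
      - 1/2 * ((∏ i ∈ Finset.range n, (-(3/2) - i : ℂ)) * (ξ:ℂ) ^ (-(3/2) - n : ℂ))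
      + 1 / π * ∑' d : ℕ, iteratedDeriv n (hh x (d + 1)) ξ) ∧
    Summable (fun d : ℕ => iteratedDeriv n (hh x (d + 1)) ξ) := by
  have hsub : Metric.ball (ξ:ℂ) (ξ/2) ⊆ {w : ℂ | 0 < w.re} := fun w hw => by
    have := (ball_re hw).1
    show 0 < w.re
    linarith
  have hmem : (ξ:ℂ) ∈ Metric.ball (ξ:ℂ) (ξ/2) := Metric.mem_ball_self (by linarith)
  have hre : 0 < (ξ:ℂ).re := by simpa
  obtain ⟨u, hu, hub⟩ := qC_bdd hx hξ
  obtain ⟨v, hv, hvb⟩ := hh_bdd hx hξ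
  have hd1 : ∀ b : ℕ, DifferentiableOn ℂ (qC (2 * π * x * ((b + 1 : ℕ) : ℝ))) (Metric.ball (ξ:ℂ) (ξ/2)) := fun b => (qC_diff _).mono hsub
  have hd2 : ∀ b : ℕ, DifferentiableOn ℂ (hh x (b + 1)) (Metric.ball (ξ:ℂ) (ξ/2)) := fun b => (hh_diff x (by omega)).mono hsub
  have s1 := hasSum_iter Metric.isOpen_ball hd1 hu hub n hmem
  have s2 := hasSum_iter Metric.isOpen_ball hd2 hv hvb n hmem
  refine ⟨?_, s2.summable⟩
  convert s1 using 1
  have hev : (fun w => ∑' b : ℕ, qC (2 * π * x * ((b + 1 : ℕ) : ℝ)) w) =ᶠ[𝓝 (ξ:ℂ)] fun w => ((1 / (2 * π * x)) * w ^ (-(1/2) : ℂ)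
      - 1/2 * w ^ (-(3/2) : ℂ)) + 1 / π * ∑' d : ℕ, hh x (d + 1) w := by
    filter_upwards [isOpen_hp.mem_nhds hre] with w hw using cot_id hx hw
  rw [hev.iteratedDeriv_eq]
  have c1 := cpow_contDiffAt (-(1/2)) hre n
  have c2 := cpow_contDiffAt (-(3/2)) hre n
  have c3 : ContDiffAt ℂ n (fun w => ∑' d : ℕ, hh x (d + 1) w) (ξ:ℂ) :=
    ((differentiableOn_tsum_of_summable_norm hv hd2 Metric.isOpen_ball hvb).contDiffOn Metric.isOpen_ball).contDiffAt
      (Metric.isOpen_ball.mem_nhds hmem)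
  rw [iteratedDeriv_fun_add ((contDiffAt_const.mul c1).sub (contDiffAt_const.mul c2)) (contDiffAt_const.mul c3),
    iteratedDeriv_fun_sub (contDiffAt_const.mul c1) (contDiffAt_const.mul c2),
    iteratedDeriv_const_mul_field, iteratedDeriv_const_mul_field, iteratedDeriv_const_mul_field,
    iter_cpow _ _ _ hre, iter_cpow _ _ _ hre, s2.tsum_eq]

end CS

namespace CS
open MeasureTheory Filter Topology

noncomputable def PP (n : ℕ) (s : ℂ) : ℂ := ∏ i ∈ Finset.range n, (s - 1/2 - i)

lemma PP_shift (n : ℕ) (s : ℂ) :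
    PP n (s + 2) * ((s + 3/2 - n) * (s + 1/2 - n)) = PP n s * ((s + 3/2) * (s + 1/2)) := by
  induction n with
  | zero => simp [PP]
  | succ n ih =>
    unfold PP at *
    rw [Finset.prod_range_succ, Finset.prod_range_succ]
    push_cast
    linear_combination (s - 1/2 - n) * ih

lemma poch_succ (a : ℂ) (k : ℕ) : poch a (k + 1) = poch a k * (a + k) := by
  unfold poch; rw [Finset.prod_range_succ]

lemma poch_one (k : ℕ) : poch 1 k = (k.factorial : ℂ) := by
  induction k with
  | zero => simp [poch]
  | succ k ih => rw [poch_succ, ih, Nat.factorial_succ]; push_cast; ring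

lemma ratio1 (m k : ℕ) : poch (1/4) k * poch (3/4) k * PP (2 * m) 0 =
    PP (2 * m) (2 * k) * (poch (1/4 - m) k * poch (3/4 - m) k) := by
  induction k with
  | zero => simp [poch]
  | succ k ih =>
    have h := PP_shift (2 * m) (2 * k)
    simp only [poch_succ]
    push_cast at h ⊢
    rw [show (2 * (k + 1) : ℂ) = 2 * k + 2 by ring]
    linear_combination (1/4 + (k:ℂ)) * (3/4 + k) * ih - 1/4 * poch (1/4 - m) k * poch (3/4 - m) k * h

lemma ratio2 (m k : ℕ) : poch (1/4 + m) k * poch (3/4 + m) k * PP (2 * m) 0 =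
    PP (2 * m) (-(2 * k)) * (poch (1/4) k * poch (3/4) k) := by
  induction k with
  | zero => simp [poch]
  | succ k ih =>
    have h := PP_shift (2 * m) (-(2 * (k + 1 : ℂ)))
    simp only [poch_succ]
    push_cast at h ⊢
    rw [show (-(2 * (k + 1)) + 2 : ℂ) = -(2 * k) by ring] at h
    linear_combination (1/4 + m + (k:ℂ)) * (3/4 + m + k) * ih + 1/4 * poch (1/4) k * poch (3/4) k * h

lemma quarter_ne (z : ℤ) : (1/4 : ℂ) + z ≠ 0 ∧ (3/4 : ℂ) + z ≠ 0 := by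
  constructor
  · intro h
    have : ((1 + 4 * z : ℤ) : ℂ) = 0 := by push_cast; linear_combination 4 * h
    have := Int.cast_eq_zero.1 this
    omega
  · intro h
    have : ((3 + 4 * z : ℤ) : ℂ) = 0 := by push_cast; linear_combination 4 * h
    have := Int.cast_eq_zero.1 this
    omega

lemma poch_ne (z : ℤ) (k : ℕ) : poch (1/4 + z) k ≠ 0 ∧ poch (3/4 + z) k ≠ 0 := by
  unfold poch
  constructor
  · refine Finset.prod_ne_zero_iff.2 fun i _ => ?_
    have := (quarter_ne (z + i)).1
    push_cast at this
    rwa [← add_assoc] at this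
  · refine Finset.prod_ne_zero_iff.2 fun i _ => ?_
    have := (quarter_ne (z + i)).2
    push_cast at this
    rwa [← add_assoc] at this

lemma PP_ne (n : ℕ) : PP n 0 ≠ 0 := by
  unfold PP
  refine Finset.prod_ne_zero_iff.2 fun i _ => ?_
  intro h
  have : ((1 + 2 * i : ℕ) : ℂ) = 0 := by push_cast; linear_combination -2 * h
  have := Nat.cast_eq_zero.1 this
  omega

lemma F32_small (m : ℕ) (z : ℂ) : PP (2 * m) 0 * F32 (1 / 4) (3 / 4) 1 (1 / 4 - (m : ℂ)) (3 / 4 - (m : ℂ)) z =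
    ∑' k : ℕ, PP (2 * m) (2 * k) * z ^ k := by
  unfold F32
  rw [← tsum_mul_left]
  refine tsum_congr fun k => ?_
  have h1 := poch_ne (-(m:ℤ)) k
  push_cast at h1
  simp only [← sub_eq_add_neg] at h1
  have hf : (k.factorial : ℂ) ≠ 0 := by exact_mod_cast k.factorial_ne_zero
  have hr := ratio1 m k
  rw [poch_one]
  generalize poch (1 / 4 - (m:ℂ)) k = p1 at *
  generalize poch (3 / 4 - (m:ℂ)) k = p2 at *
  have h2 := h1.1
  have h3 := h1.2
  field_simp
  linear_combination z ^ k * hr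

lemma F32_big (m : ℕ) (z : ℂ) : PP (2 * m) 0 * F32 (1 / 4 + m) (3 / 4 + m) 1 (1 / 4) (3 / 4) z =
    ∑' k : ℕ, PP (2 * m) (-(2 * k)) * z ^ k := by
  unfold F32
  rw [← tsum_mul_left]
  refine tsum_congr fun k => ?_
  have h1 := poch_ne 0 k
  simp only [Int.cast_zero, add_zero] at h1
  have hf : (k.factorial : ℂ) ≠ 0 := by exact_mod_cast k.factorial_ne_zero
  have hr := ratio2 m k
  rw [poch_one]
  generalize poch (1 / 4 + (m:ℂ)) k = p1 at *
  generalize poch (3 / 4 + (m:ℂ)) k = p2 at *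
  have h2 := h1.1
  have h3 := h1.2
  field_simp
  linear_combination z ^ k * hr

lemma iter_term (c s : ℂ) (n : ℕ) {w : ℂ} (hw : 0 < w.re) :
    iteratedDeriv n (fun w : ℂ => c * w ^ (s - 1/2)) w = c * (PP n s * w ^ (s - 1/2 - n)) := by
  rw [iteratedDeriv_const_mul_field, iter_cpow _ _ _ hw]
  rfl

lemma cpow_diff_mul (c s : ℂ) : DifferentiableOn ℂ (fun w : ℂ => c * w ^ s) {w | 0 < w.re} := fun z hz =>
  ((DifferentiableAt.cpow_const differentiableAt_id (Or.inl hz)).const_mul c).differentiableWithinAt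

/-- the small case -/
lemma hh_iter_small (n : ℕ) {x : ℝ} (hx : 0 < x) {j d : ℕ} (hj : 0 < j) (hd : 0 < d) (hlt : (j * d : ℝ) < x) :
    HasSum (fun k : ℕ => (1 / x : ℂ) * (-(d:ℂ) ^ 2 / (x:ℂ) ^ 2) ^ k * (PP n (2 * k) * (j:ℂ) ^ (2 * k - 1/2 - n : ℂ)))
      (iteratedDeriv n (hh x d) j) := by
  have hj' : (0:ℝ) < j := by exact_mod_cast hj
  have hd' : (0:ℝ) < d := by exact_mod_cast hd
  have hx0 : (x:ℂ) ≠ 0 := by exact_mod_cast hx.ne'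
  obtain ⟨M, hM0, hM⟩ := cpow_loc_bdd (-(1/2)) hj'
  have hjx : (j:ℝ) < x / d := by rw [lt_div_iff₀ hd']; exact hlt
  set r : ℝ := (j + x / d) / 2 with hr
  set ε : ℝ := min ((j:ℝ) / 2) ((x / d - j) / 2) with hε
  have hε0 : 0 < ε := lt_min (by linarith) (by linarith)
  set U := Metric.ball ((j:ℝ):ℂ) ε with hU
  have hUs : ∀ w ∈ U, w ∈ Metric.ball ((j:ℝ):ℂ) ((j:ℝ) / 2) ∧ ‖w‖ ≤ r := by
    intro w hw
    refine ⟨Metric.ball_subset_ball (min_le_left _ _) hw, ?_⟩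
    have h0 : ‖w - (j:ℝ)‖ < ε := by simpa [hU, dist_eq_norm] using hw
    have h1 : ‖w‖ ≤ ‖w - (j:ℝ)‖ + ‖((j:ℝ):ℂ)‖ := by simpa using norm_add_le (w - (j:ℝ)) ((j:ℝ):ℂ)
    rw [Complex.norm_of_nonneg hj'.le] at h1
    have := min_le_right ((j:ℝ) / 2) ((x / d - j) / 2)
    rw [hr]; linarith
  have hpos : ∀ w ∈ U, 0 < w.re := fun w hw => by have := (ball_re (hUs w hw).1).1; linarith
  set F : ℕ → ℂ → ℂ := fun k w => ((1 / x : ℂ) * (-(d:ℂ) ^ 2 / (x:ℂ) ^ 2) ^ k) * w ^ ((2 * k : ℂ) - 1/2) with hF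
  set ρ : ℝ := (d * r / x) ^ 2 with hρ
  have hr0 : 0 ≤ r := by rw [hr]; positivity
  have hdr : d * r < x := by
    have : r < x / d := by rw [hr]; linarith
    rw [lt_div_iff₀ hd'] at this; linarith
  have hρ1 : ρ < 1 := by
    rw [hρ]
    have : d * r / x < 1 := by rw [div_lt_one hx]; exact hdr
    have h0 : 0 ≤ d * r / x := by positivity
    nlinarith
  have hFz : ∀ k, ∀ w ∈ U, F k w = (1 / x) * w ^ (-(1/2) : ℂ) * (-((d:ℂ) ^ 2 * w ^ 2) / x ^ 2) ^ k := by
    intro k w hw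
    have hw0 := hp_ne (hpos w hw)
    simp only [hF]
    rw [show (2 * k : ℂ) - 1/2 = -(1/2) + ((2 * k : ℕ) : ℂ) by push_cast; ring, Complex.cpow_add _ _ hw0,
      Complex.cpow_natCast, pow_mul]
    rw [show (-((d:ℂ) ^ 2 * w ^ 2) / x ^ 2) = (-(d:ℂ) ^ 2 / (x:ℂ) ^ 2) * w ^ 2 by ring, mul_pow]
    ring
  have hnz : ∀ w ∈ U, ‖(-((d:ℂ) ^ 2 * w ^ 2) / x ^ 2)‖ ≤ ρ := by
    intro w hw
    rw [norm_div, norm_neg, norm_mul, norm_pow, norm_pow, norm_pow, Complex.norm_natCast, Complex.norm_of_nonneg hx.le, hρ,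
      div_pow, mul_pow]
    have := (hUs w hw).2
    gcongr
  have hmem : (((j:ℝ)):ℂ) ∈ U := Metric.mem_ball_self hε0
  have key := hasSum_iter (U := U) (F := F) (u := fun k => (1 / x) * M * ρ ^ k) Metric.isOpen_ball
    (fun k => (cpow_diff_mul _ _).mono fun w hw => hpos w hw)
    ((summable_geometric_of_lt_one (by positivity) hρ1).mul_left _) (by
      intro k w hw
      rw [hFz k w hw, norm_mul, norm_mul, norm_pow]
      have h1 : ‖(1 / x : ℂ)‖ = 1 / x := by rw [norm_div, Complex.norm_of_nonneg hx.le]; simp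
      rw [h1]
      have := hM w (hUs w hw).1
      have := hnz w hw
      gcongr) n hmem
  have hev : (fun w => ∑' k, F k w) =ᶠ[𝓝 (((j:ℝ)):ℂ)] hh x d := by
    filter_upwards [Metric.isOpen_ball.mem_nhds hmem] with w hw
    rw [tsum_congr fun k => hFz k w hw, tsum_mul_left, tsum_geometric_of_norm_lt_one ((hnz w hw).trans_lt hρ1)]
    have hden := den_ne x hd (hpos w hw)
    have h3 : (1 - -((d:ℂ) ^ 2 * w ^ 2) / x ^ 2) = (x ^ 2 + d ^ 2 * w ^ 2) / x ^ 2 := by field_simp; ring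
    rw [h3]
    unfold hh
    field_simp
  rw [hev.iteratedDeriv_eq] at key
  simp only [hF] at key
  have h4 : ∀ k : ℕ, iteratedDeriv n (fun w : ℂ => ((1 / x : ℂ) * (-(d:ℂ) ^ 2 / (x:ℂ) ^ 2) ^ k) * w ^ ((2 * k : ℂ) - 1/2)) ((j:ℝ):ℂ) =
      (1 / x : ℂ) * (-(d:ℂ) ^ 2 / (x:ℂ) ^ 2) ^ k * (PP n (2 * k) * ((j:ℝ):ℂ) ^ (2 * k - 1/2 - n : ℂ)) := by
    intro k
    exact iter_term _ _ _ (by simpa using hj)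
  simp_rw [h4] at key
  simpa using key

/-- the big case -/
lemma hh_iter_big (n : ℕ) {x : ℝ} (hx : 0 < x) {j d : ℕ} (hj : 0 < j) (hd : 0 < d) (hlt : x < (j * d : ℝ)) :
    HasSum (fun k : ℕ => -(1 / x : ℂ) * (-(x:ℂ) ^ 2 / (d:ℂ) ^ 2) ^ (k + 1) * (PP n (-(2 * (k + 1 : ℕ))) * (j:ℂ) ^ (-(2 * (k + 1 : ℕ)) - 1/2 - n : ℂ)))
      (iteratedDeriv n (hh x d) j) := by
  have hj' : (0:ℝ) < j := by exact_mod_cast hj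
  have hd' : (0:ℝ) < d := by exact_mod_cast hd
  have hx0 : (x:ℂ) ≠ 0 := by exact_mod_cast hx.ne'
  have hd0 : (d:ℂ) ≠ 0 := by exact_mod_cast hd.ne'
  obtain ⟨M, hM0, hM⟩ := cpow_loc_bdd (-(1/2)) hj'
  have hjx : x / d < (j:ℝ) := by rw [div_lt_iff₀ hd']; exact hlt
  set r : ℝ := (j + x / d) / 2 with hr
  set ε : ℝ := min ((j:ℝ) / 2) ((j - x / d) / 2) with hε
  have hε0 : 0 < ε := lt_min (by linarith) (by linarith)
  set U := Metric.ball ((j:ℝ):ℂ) ε with hU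
  have hUs : ∀ w ∈ U, w ∈ Metric.ball ((j:ℝ):ℂ) ((j:ℝ) / 2) ∧ r ≤ ‖w‖ := by
    intro w hw
    refine ⟨Metric.ball_subset_ball (min_le_left _ _) hw, ?_⟩
    have h0 : ‖w - (j:ℝ)‖ < ε := by simpa [hU, dist_eq_norm] using hw
    have h1 : ‖((j:ℝ):ℂ)‖ ≤ ‖w - (j:ℝ)‖ + ‖w‖ := by
      rw [norm_sub_rev]; simpa using norm_add_le (((j:ℝ):ℂ) - w) w
    rw [Complex.norm_of_nonneg hj'.le] at h1
    have := min_le_right ((j:ℝ) / 2) ((j - x / d) / 2)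
    rw [hr]; linarith
  have hpos : ∀ w ∈ U, 0 < w.re := fun w hw => by have := (ball_re (hUs w hw).1).1; linarith
  set F : ℕ → ℂ → ℂ := fun k w => (-(1 / x : ℂ) * (-(x:ℂ) ^ 2 / (d:ℂ) ^ 2) ^ (k + 1)) * w ^ (-(2 * (k + 1 : ℕ) : ℂ) - 1/2) with hF
  set ρ : ℝ := (x / (d * r)) ^ 2 with hρ
  have hr0 : 0 < r := by rw [hr]; positivity
  have hdr : x < d * r := by
    have : x / d < r := by rw [hr]; linarith
    rw [div_lt_iff₀ hd'] at this; linarith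
  have hρ1 : ρ < 1 := by
    rw [hρ]
    have : x / (d * r) < 1 := by rw [div_lt_one (by positivity)]; exact hdr
    have h0 : 0 ≤ x / (d * r) := by positivity
    nlinarith
  have hFz : ∀ k, ∀ w ∈ U, F k w = -(1 / x) * w ^ (-(1/2) : ℂ) * (-(x:ℂ) ^ 2 / (d ^ 2 * w ^ 2)) * (-(x:ℂ) ^ 2 / (d ^ 2 * w ^ 2)) ^ k := by
    intro k w hw
    have hw0 := hp_ne (hpos w hw)
    simp only [hF]
    rw [mul_assoc (-(1 / (x:ℂ)) * w ^ (-(1/2) : ℂ)), ← pow_succ',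
      show -(2 * (k + 1 : ℕ) : ℂ) - 1/2 = -(1/2) + -((2 * (k + 1) : ℕ) : ℂ) by push_cast; ring, Complex.cpow_add _ _ hw0,
      Complex.cpow_neg w ((2 * (k + 1) : ℕ) : ℂ), Complex.cpow_natCast, pow_mul w]
    rw [show -(x:ℂ) ^ 2 / (d ^ 2 * w ^ 2) = (-(x:ℂ) ^ 2 / (d:ℂ) ^ 2) * (w ^ 2)⁻¹ by field_simp, mul_pow, inv_pow]
    ring
  have hnz : ∀ w ∈ U, ‖(-(x:ℂ) ^ 2 / (d ^ 2 * w ^ 2))‖ ≤ ρ := by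
    intro w hw
    rw [norm_div, norm_neg, norm_mul, norm_pow, norm_pow, norm_pow, Complex.norm_natCast, Complex.norm_of_nonneg hx.le, hρ,
      div_pow, mul_pow]
    have := (hUs w hw).2
    gcongr
  have hmem : (((j:ℝ)):ℂ) ∈ U := Metric.mem_ball_self hε0
  have key := hasSum_iter (U := U) (F := F) (u := fun k => (1 / x) * M * ρ * ρ ^ k) Metric.isOpen_ball
    (fun k => (cpow_diff_mul _ _).mono fun w hw => hpos w hw)
    ((summable_geometric_of_lt_one (by positivity) hρ1).mul_left _) (by
      intro k w hw
      rw [hFz k w hw, norm_mul, norm_mul, norm_mul, norm_pow, norm_neg]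
      have h1 : ‖(1 / x : ℂ)‖ = 1 / x := by rw [norm_div, Complex.norm_of_nonneg hx.le]; simp
      rw [h1]
      have := hM w (hUs w hw).1
      have := hnz w hw
      gcongr) n hmem
  have hev : (fun w => ∑' k, F k w) =ᶠ[𝓝 (((j:ℝ)):ℂ)] hh x d := by
    filter_upwards [Metric.isOpen_ball.mem_nhds hmem] with w hw
    rw [tsum_congr fun k => hFz k w hw, tsum_mul_left, tsum_geometric_of_norm_lt_one ((hnz w hw).trans_lt hρ1)]
    have hden := den_ne x hd (hpos w hw)
    have hw0 := hp_ne (hpos w hw)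
    have h3 : (1 - -(x:ℂ) ^ 2 / (d ^ 2 * w ^ 2)) = (x ^ 2 + d ^ 2 * w ^ 2) / (d ^ 2 * w ^ 2) := by field_simp; ring
    rw [h3]
    unfold hh
    field_simp
  rw [hev.iteratedDeriv_eq] at key
  simp only [hF] at key
  have h4 : ∀ k : ℕ, iteratedDeriv n (fun w : ℂ => (-(1 / x : ℂ) * (-(x:ℂ) ^ 2 / (d:ℂ) ^ 2) ^ (k + 1)) * w ^ (-(2 * (k + 1 : ℕ) : ℂ) - 1/2)) ((j:ℝ):ℂ) =
      -(1 / x : ℂ) * (-(x:ℂ) ^ 2 / (d:ℂ) ^ 2) ^ (k + 1) * (PP n (-(2 * (k + 1 : ℕ))) * ((j:ℝ):ℂ) ^ (-(2 * (k + 1 : ℕ)) - 1/2 - n : ℂ)) := by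
    intro k
    exact iter_term _ _ _ (by simpa using hj)
  simp_rw [h4] at key
  simpa using key

theorem hh_iter_W (m : ℕ) {x : ℝ} (hx : 0 < x) (hxint : ∀ k : ℤ, x ≠ (k : ℝ)) {j d : ℕ} (hj : 0 < j) (hd : 0 < d) :
    iteratedDeriv (2 * m) (hh x d) j = (1 / x : ℂ) * (j:ℂ) ^ (-(1/2) - (2 * m : ℕ) : ℂ) * PP (2 * m) 0 * Wm m (j * d) x := by
  have hj0 : (j:ℂ) ≠ 0 := by exact_mod_cast hj.ne'
  have hd0 : (d:ℂ) ≠ 0 := by exact_mod_cast hd.ne'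
  have hx0 : (x:ℂ) ≠ 0 := by exact_mod_cast hx.ne'
  unfold Wm
  split_ifs with h
  · push_cast at h
    have hs := hh_iter_small (2 * m) hx hj hd h
    rw [← hs.tsum_eq, mul_assoc _ (PP (2 * m) 0), F32_small, ← tsum_mul_left]
    refine tsum_congr fun k => ?_
    rw [show (2 * k - 1/2 - (2 * m : ℕ) : ℂ) = (-(1/2) - (2 * m : ℕ) : ℂ) + ((2 * k : ℕ) : ℂ) by push_cast; ring,
      Complex.cpow_add _ _ hj0, Complex.cpow_natCast, pow_mul]
    push_cast
    rw [show (-(j * d : ℂ) ^ 2 / x ^ 2) = (-(d:ℂ) ^ 2 / (x:ℂ) ^ 2) * j ^ 2 by ring, mul_pow]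
    ring
  · have h' : x < (j * d : ℝ) := by
      refine lt_of_le_of_ne (by push_cast at h; linarith) ?_
      have := hxint (j * d : ℕ)
      push_cast at this; exact this
    have hs := hh_iter_big (2 * m) hx hj hd h'
    have hc : (1 / x : ℂ) * (j:ℂ) ^ (-(1/2) - (2 * m : ℕ) : ℂ) ≠ 0 :=
      mul_ne_zero (by simp [hx0]) (by rw [Complex.cpow_ne_zero_iff]; exact Or.inl hj0)
    set c := (1 / x : ℂ) * (j:ℂ) ^ (-(1/2) - (2 * m : ℕ) : ℂ) with hcd
    set z : ℂ := (-(x:ℂ) ^ 2 / ((j * d : ℕ):ℂ) ^ 2) with hz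
    have ht : ∀ k : ℕ, -(1 / x : ℂ) * (-(x:ℂ) ^ 2 / (d:ℂ) ^ 2) ^ (k + 1) * (PP (2 * m) (-(2 * (k + 1 : ℕ))) * (j:ℂ) ^ (-(2 * (k + 1 : ℕ)) - 1/2 - (2 * m : ℕ) : ℂ))
       = -c * (PP (2 * m) (-(2 * (k + 1 : ℕ))) * z ^ (k + 1)) := by
      intro k
      rw [hcd, show (-(2 * (k + 1 : ℕ)) - 1/2 - (2 * m : ℕ) : ℂ) = (-(1/2) - (2 * m : ℕ) : ℂ) + -((2 * (k + 1) : ℕ) : ℂ) by push_cast; ring,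
      Complex.cpow_add _ _ hj0, Complex.cpow_neg, Complex.cpow_natCast, pow_mul]
      rw [hz, show (-(x:ℂ) ^ 2 / ((j * d : ℕ):ℂ) ^ 2) = (-(x:ℂ) ^ 2 / (d:ℂ) ^ 2) * ((j:ℂ) ^ 2)⁻¹ by push_cast; field_simp, mul_pow, inv_pow]
      ring
    simp_rw [ht] at hs
    have hsum : Summable (fun k : ℕ => PP (2 * m) (-(2 * (k + 1 : ℕ))) * z ^ (k + 1)) :=
      (summable_mul_left_iff (neg_ne_zero.2 hc)).1 hs.summable
    have hsum2 : Summable (fun k : ℕ => PP (2 * m) (-(2 * k)) * z ^ k) :=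
      (summable_nat_add_iff (f := fun k : ℕ => PP (2 * m) (-(2 * k)) * z ^ k) 1).1 hsum
    rw [← hs.tsum_eq, tsum_mul_left, mul_assoc c, mul_sub, F32_big, hsum2.tsum_eq_zero_add]
    simp only [Nat.cast_zero, mul_zero, neg_zero, pow_zero, mul_one]
    ring

lemma Wm_bound (m : ℕ) {x : ℝ} (hx : 0 < x) (hxint : ∀ k : ℤ, x ≠ (k : ℝ)) :
    ∃ C : ℝ, 0 ≤ C ∧ ∀ n : ℕ, 0 < n → ‖Wm m n x‖ ≤ C * (n:ℝ) ^ (-2:ℝ) := by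
  set N : ℕ := ⌊x⌋₊ + 1 with hN
  have hxN : x < N := by rw [hN]; push_cast; exact Nat.lt_floor_add_one x
  have hN0 : 0 < N := by omega
  have hN' : (0:ℝ) < N := by exact_mod_cast hN0
  have hNC : (N:ℂ) ≠ 0 := by exact_mod_cast hN0.ne'
  have hx0 : (x:ℂ) ≠ 0 := by exact_mod_cast hx.ne'
  have hsum : ∀ n : ℕ, N ≤ n → Summable (fun k : ℕ => PP (2 * m) (-(2 * (k + 1 : ℕ))) * (-(x:ℂ) ^ 2 / (n:ℂ) ^ 2) ^ (k + 1)) := by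
    intro n hn
    have hn0 : 0 < n := by omega
    have hxn : x < n := hxN.trans_le (by exact_mod_cast hn)
    have hs := (hh_iter_big (2 * m) hx (j := 1) (d := n) one_pos hn0 (by simpa using hxn)).summable
    simp only [Nat.cast_one, Complex.one_cpow, mul_one] at hs
    have hc : -(1 / x : ℂ) ≠ 0 := by simp [hx0]
    refine (summable_mul_left_iff hc).1 (hs.congr fun k => ?_)
    ring
  have hW : ∀ n : ℕ, N ≤ n → PP (2 * m) 0 * Wm m n x = -∑' k : ℕ, PP (2 * m) (-(2 * (k + 1 : ℕ))) * (-(x:ℂ) ^ 2 / (n:ℂ) ^ 2) ^ (k + 1) := by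
    intro n hn
    have hxn : x < n := hxN.trans_le (by exact_mod_cast hn)
    unfold Wm
    rw [if_neg (by linarith), mul_sub, F32_big,
      ((summable_nat_add_iff (f := fun k : ℕ => PP (2 * m) (-(2 * k)) * (-(x:ℂ) ^ 2 / (n:ℂ) ^ 2) ^ k) 1).1 (hsum n hn)).tsum_eq_zero_add]
    simp only [Nat.cast_zero, mul_zero, neg_zero, pow_zero, mul_one]
    ring
  set A : ℝ := ∑' k : ℕ, ‖PP (2 * m) (-(2 * (k + 1 : ℕ))) * (-(x:ℂ) ^ 2 / (N:ℂ) ^ 2) ^ (k + 1)‖ with hA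
  have hA0 : 0 ≤ A := tsum_nonneg fun _ => norm_nonneg _
  set C1 : ℝ := ‖PP (2 * m) 0‖⁻¹ * ((N:ℝ) ^ 2 * A) with hC1
  set C2 : ℝ := ∑ n ∈ Finset.range N, ‖Wm m n x‖ * (n:ℝ) ^ (2:ℝ) with hC2
  have hC10 : 0 ≤ C1 := by positivity
  have hC20 : 0 ≤ C2 := Finset.sum_nonneg fun _ _ => by positivity
  have hP : 0 < ‖PP (2 * m) 0‖ := norm_pos_iff.2 (PP_ne _)
  refine ⟨C1 + C2, by positivity, fun n hn => ?_⟩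
  have hn' : (0:ℝ) < n := by exact_mod_cast hn
  have hnn : (n:ℝ) ^ (2:ℝ) * (n:ℝ) ^ (-2:ℝ) = 1 := by rw [← Real.rpow_add hn']; norm_num
  rcases lt_or_ge n N with h | h
  · have h1 : ‖Wm m n x‖ * (n:ℝ) ^ (2:ℝ) ≤ C2 :=
      Finset.single_le_sum (f := fun n : ℕ => ‖Wm m n x‖ * (n:ℝ) ^ (2:ℝ)) (fun _ _ => by positivity) (Finset.mem_range.2 h)
    calc ‖Wm m n x‖ = ‖Wm m n x‖ * (n:ℝ) ^ (2:ℝ) * (n:ℝ) ^ (-2:ℝ) := by rw [mul_assoc, hnn, mul_one]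
      _ ≤ (C1 + C2) * (n:ℝ) ^ (-2:ℝ) := by gcongr; linarith
  · have h1 : ‖PP (2 * m) 0‖ * ‖Wm m n x‖ ≤ (N:ℝ) ^ 2 * A * (n:ℝ) ^ (-2:ℝ) := by
      rw [← norm_mul, hW n h, norm_neg]
      refine (norm_tsum_le_tsum_norm (hsum n h).norm).trans ?_
      rw [show (N:ℝ) ^ 2 * A * (n:ℝ) ^ (-2:ℝ) = ((N:ℝ) ^ 2 * (n:ℝ) ^ (-2:ℝ)) * A by ring, hA, ← tsum_mul_left]
      refine (hsum n h).norm.tsum_le_tsum (fun k => ?_) ((hsum N le_rfl).norm.mul_left _)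
      rw [norm_mul, norm_mul, norm_pow, norm_pow, norm_div, norm_div, norm_neg, norm_pow, norm_pow, norm_pow,
        Complex.norm_natCast, Complex.norm_natCast, Complex.norm_of_nonneg hx.le]
      have hNn : (N:ℝ) ≤ n := by exact_mod_cast h
      have e : (n:ℝ) ^ (-2:ℝ) = 1 / (n:ℝ) ^ 2 := by rw [Real.rpow_neg hn'.le]; norm_num
      rw [e, mul_left_comm]
      gcongr
      rw [pow_succ' (x ^ 2 / (n:ℝ) ^ 2), pow_succ' (x ^ 2 / (N:ℝ) ^ 2)]
      calc x ^ 2 / (n:ℝ) ^ 2 * (x ^ 2 / (n:ℝ) ^ 2) ^ k ≤ x ^ 2 / (n:ℝ) ^ 2 * (x ^ 2 / (N:ℝ) ^ 2) ^ k := by gcongr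
        _ = _ := by field_simp
    calc ‖Wm m n x‖ = ‖PP (2 * m) 0‖⁻¹ * (‖PP (2 * m) 0‖ * ‖Wm m n x‖) := by field_simp
      _ ≤ ‖PP (2 * m) 0‖⁻¹ * ((N:ℝ) ^ 2 * A * (n:ℝ) ^ (-2:ℝ)) := by gcongr
      _ = C1 * (n:ℝ) ^ (-2:ℝ) := by rw [hC1]; ring
      _ ≤ _ := by gcongr; linarith

end CS

namespace CS
open MeasureTheory Filter Topology

noncomputable def ppr (m : ℕ) : ℝ := ∏ i ∈ Finset.range (2 * m), (-(1/2) - i : ℝ)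
noncomputable def Dc (m : ℕ) (x : ℝ) : ℝ := kap m x * ∏ i ∈ Finset.range (2 * m), ((-(3/2):ℝ) - i)

noncomputable def Vt (m : ℕ) (x : ℝ) (j d : ℕ) : ℂ :=
  -((Cp m x * Gf m (j / x) d : ℝ) : ℂ) + ((kap m x / (π * x) * ppr m * (j:ℝ) ^ (-(2 * m + 1/2) : ℝ) : ℝ) : ℂ) * Wm m (j * d) x

lemma PP_ppr (m : ℕ) : PP (2 * m) 0 = (ppr m : ℂ) := by
  unfold PP ppr; push_cast
  refine Finset.prod_congr rfl fun i _ => ?_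
  ring

lemma Vt_summable (m : ℕ) {x : ℝ} (hx : 0 < x) (hxint : ∀ k : ℤ, x ≠ (k : ℝ)) :
    Summable (fun p : ℕ × ℕ => Vt m x (p.1 + 1) (p.2 + 1)) := by
  obtain ⟨C, hC0, hC⟩ := Wm_bound m hx hxint
  set A : ℝ := |Cp m x| * ((2 * m + 1) * x ^ (2 * m) * x ^ 2) with hA
  set B : ℝ := |kap m x / (π * x) * ppr m| * C with hB
  have h2 : Summable (fun j : ℕ => ((j + 1 : ℕ):ℝ) ^ (-2:ℝ)) := summable_rpow_shift (by norm_num)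
  have h3 : Summable (fun j : ℕ => ((j + 1 : ℕ):ℝ) ^ (-(3/2):ℝ)) := summable_rpow_shift (by norm_num)
  refine Summable.of_norm_bounded ((h2.mul_of_nonneg h3 (fun _ => by positivity) (fun _ => by positivity)).mul_left (A + B)) ?_
  rintro ⟨j, d⟩
  simp only
  set J : ℝ := ((j + 1 : ℕ):ℝ) with hJ
  set E : ℝ := ((d + 1 : ℕ):ℝ) with hE
  have hJ1 : 1 ≤ J := by rw [hJ]; push_cast; linarith [Nat.cast_nonneg (α := ℝ) j]
  have hE1 : 1 ≤ E := by rw [hE]; push_cast; linarith [Nat.cast_nonneg (α := ℝ) d]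
  have hJ0 : 0 < J := by linarith
  have hE0 : 0 < E := by linarith
  unfold Vt
  rw [add_mul A B]
  refine (norm_add_le _ _).trans (add_le_add ?_ ?_)
  · rw [norm_neg, Complex.norm_real, Real.norm_eq_abs, abs_mul, hA, mul_assoc |Cp m x|]
    refine mul_le_mul_of_nonneg_left ?_ (abs_nonneg _)
    refine (GQ_bound m (c := J / x) (by positivity) hE0).trans ?_
    have e1 : J ^ (-2:ℝ) = 1 / J ^ 2 := by rw [Real.rpow_neg hJ0.le]; norm_num
    have e2 : E ^ (-(3/2):ℝ) = E ^ (1/2:ℝ) / E ^ 2 := by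
      rw [show (-(3/2):ℝ) = 1/2 - 2 by norm_num, Real.rpow_sub hE0]; norm_num
    have e3 : E ^ (1/2:ℝ) / (1 + (J / x * E) ^ 2) ≤ E ^ (1/2:ℝ) / ((J / x * E) ^ 2) := by
      gcongr; linarith
    have e4 : ((J / x) ^ (2 * m))⁻¹ ≤ x ^ (2 * m) := by
      rw [div_pow, inv_div]
      exact div_le_self (by positivity) (one_le_pow₀ hJ1)
    calc (2 * (m:ℝ) + 1) * ((J / x) ^ (2 * m))⁻¹ * (E ^ (1/2:ℝ) / (1 + (J / x * E) ^ 2))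
        ≤ (2 * (m:ℝ) + 1) * x ^ (2 * m) * (E ^ (1/2:ℝ) / ((J / x * E) ^ 2)) := by gcongr
      _ = _ := by rw [e1, e2]; field_simp
  · rw [norm_mul, Complex.norm_real, Real.norm_eq_abs, abs_mul, hB, mul_assoc |_|, mul_assoc |_|]
    refine mul_le_mul_of_nonneg_left ?_ (abs_nonneg _)
    have h1 := hC ((j + 1) * (d + 1)) (by positivity)
    rw [abs_of_pos (by positivity)]
    have h4 : J ^ (-(2 * m + 1/2) : ℝ) ≤ 1 := Real.rpow_le_one_of_one_le_of_nonpos hJ1 (by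
      have : (0:ℝ) ≤ m := Nat.cast_nonneg m
      linarith)
    have h5 : E ^ (-2:ℝ) ≤ E ^ (-(3/2):ℝ) := Real.rpow_le_rpow_of_exponent_le hE1 (by norm_num)
    have h6 : ((((j + 1) * (d + 1) : ℕ)):ℝ) ^ (-2:ℝ) = J ^ (-2:ℝ) * E ^ (-2:ℝ) := by
      rw [← Real.mul_rpow hJ0.le hE0.le, hJ, hE]; push_cast; rfl
    rw [h6] at h1
    calc J ^ (-(2 * m + 1/2) : ℝ) * ‖Wm m ((j + 1) * (d + 1)) x‖ ≤ 1 * (C * (J ^ (-2:ℝ) * E ^ (-2:ℝ))) := by gcongr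
      _ ≤ C * (J ^ (-2:ℝ) * E ^ (-(3/2):ℝ)) := by rw [one_mul]; gcongr

noncomputable def rest (m : ℕ) (x : ℝ) (j : ℕ) : ℂ :=
  ((Dc m x / 2 * (j:ℝ) ^ (-(2 * m + 3/2) : ℝ) : ℝ) : ℂ) + ∑' d : ℕ, Vt m x j (d + 1)

noncomputable def cc (m : ℕ) (x : ℝ) : ℝ := kap m x / (2 * π * x) * ppr m

lemma rest_summable (m : ℕ) {x : ℝ} (hx : 0 < x) (hxint : ∀ k : ℤ, x ≠ (k : ℝ)) :
    Summable (fun j : ℕ => rest m x (j + 1)) ∧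
    ∑' j : ℕ, rest m x (j + 1) = ((Dc m x / 2 * ∑' j : ℕ, ((j + 1 : ℕ):ℝ) ^ (-(2 * m + 3/2) : ℝ) : ℝ) : ℂ) +
      ∑' p : ℕ × ℕ, Vt m x (p.1 + 1) (p.2 + 1) := by
  have hV := Vt_summable m hx hxint
  have h1 : Summable (fun j : ℕ => ((Dc m x / 2 * ((j + 1 : ℕ):ℝ) ^ (-(2 * m + 3/2) : ℝ) : ℝ) : ℂ)) :=
    Complex.ofRealCLM.summable ((summable_rpow_shift (by
      have : (0:ℝ) ≤ m := Nat.cast_nonneg m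
      linarith)).mul_left _)
  have h2 := hV.prod
  simp only at h2
  refine ⟨h1.add h2, ?_⟩
  unfold rest
  rw [h1.tsum_add h2, hV.tsum_prod, ← tsum_mul_left, Complex.ofReal_tsum]

theorem sum_ImT (m : ℕ) {x : ℝ} (hx : 0 < x) (hxint : ∀ k : ℤ, x ≠ (k : ℝ)) (j : ℕ) (hj : 0 < j) :
    HasSum (fun b : ℕ => ((-(T m x ((b + 1 : ℕ):ℝ) j).im : ℝ) : ℂ))
      (((cc m x * (j:ℝ) ^ (-(2 * m + 1/2) : ℝ) : ℝ) : ℂ) + rest m x j) := by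
  have hj' : (0:ℝ) < j := by exact_mod_cast hj
  obtain ⟨s1, s2, e1⟩ := poisson_b m hx hj'
  obtain ⟨q1, q2⟩ := sum_iter_qC (2 * m) hx hj'
  simp only [ofReal_natCast] at q1 q2
  have hk : ((kap m x : ℝ) : ℂ) = (-1) ^ m / (2 * π) ^ (2 * m) * (√(2 * x) / 4 : ℝ) := by
    unfold kap; push_cast; ring
  have hre : ∀ b : ℕ, (((T m x ((b + 1 : ℕ):ℝ) j).re : ℝ) : ℂ) = (kap m x : ℂ) * iteratedDeriv (2 * m) (qC (2 * π * x * ((b + 1 : ℕ) : ℝ))) (j:ℂ) := by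
    intro b
    rw [T_re_formula m hx (by positivity) hj', hk]
    simp
  have r1 : HasSum (fun b : ℕ => (((T m x ((b + 1 : ℕ):ℝ) j).re : ℝ) : ℂ)) _ := (funext hre) ▸ q1.mul_left (kap m x : ℂ)
  have hs3 : Summable (fun b : ℕ => (T m x ((b + 1 : ℕ):ℝ) j).re + (T m x ((b + 1 : ℕ):ℝ) j).im) :=
    (Complex.reCLM.summable s1).add (Complex.imCLM.summable s1)
  have r2 := Complex.ofRealCLM.hasSum hs3.hasSum
  rw [e1] at r2
  have r3 := r1.sub r2
  convert r3 using 1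
  · rfl
  · funext b
    simp [Complex.ofRealCLM_apply]
  · have hV : ∀ d : ℕ, Vt m x j (d + 1) = -((Cp m x * Gf m (j / x) (d + 1 : ℝ) : ℝ) : ℂ) + (kap m x / π : ℂ) * iteratedDeriv (2 * m) (hh x (d + 1)) j := by
      intro d
      rw [hh_iter_W m hx hxint hj (by omega), PP_ppr]
      unfold Vt
      have hjp : (j:ℂ) ^ (-(1/2) - (2 * m : ℕ) : ℂ) = (((j:ℝ) ^ (-(2 * m + 1/2) : ℝ) : ℝ) : ℂ) := by
        rw [Complex.ofReal_cpow hj'.le]; push_cast; congr 1; ring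
      rw [hjp]
      push_cast
      have hpi : (π:ℂ) ≠ 0 := by exact_mod_cast Real.pi_ne_zero
      have hx0 : (x:ℂ) ≠ 0 := by exact_mod_cast hx.ne'
      field_simp
    have g1 : Summable (fun d : ℕ => ((Cp m x * Gf m (j / x) (d + 1 : ℝ) : ℝ) : ℂ)) := Complex.ofRealCLM.summable (s2.mul_left _)
    have g2 := q2.mul_left (kap m x / π : ℂ)
    unfold rest
    rw [tsum_congr hV, g1.neg.tsum_add g2, tsum_neg, tsum_mul_left, ← Complex.ofReal_tsum, tsum_mul_left, int_Gf m hx hj']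
    have hA : (∏ i ∈ Finset.range (2 * m), (-(1/2) - i : ℂ)) = (ppr m : ℂ) := by unfold ppr; push_cast; rfl
    have hB : (kap m x : ℂ) * (∏ i ∈ Finset.range (2 * m), (-(3/2) - i : ℂ)) = (Dc m x : ℂ) := by unfold Dc; push_cast; rfl
    have hj1 : (j:ℂ) ^ (-(1/2) - (2 * m : ℕ) : ℂ) = (((j:ℝ) ^ (-(2 * m + 1/2) : ℝ) : ℝ) : ℂ) := by
      rw [Complex.ofReal_cpow hj'.le]; push_cast; congr 1; ring
    have hj3 : (j:ℂ) ^ (-(3/2) - (2 * m : ℕ) : ℂ) = (((j:ℝ) ^ (-(2 * m + 3/2) : ℝ) : ℝ) : ℂ) := by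
      rw [Complex.ofReal_cpow hj'.le]; push_cast; congr 1; ring
    rw [hA, hj1, hj3]
    have hD : kap m x * ∏ i ∈ Finset.range (2 * m), ((-(3/2):ℝ) - i) = Dc m x := rfl
    rw [hD]
    simp only [Complex.ofRealCLM_apply]
    unfold cc
    push_cast
    generalize ((j:ℝ) ^ (-(2 * m + 3/2) : ℝ) : ℝ) = y3 at *
    linear_combination ((y3:ℂ)/2) * hB

end CS

namespace CS
open MeasureTheory Filter Topology

lemma Q_zero_eq (u : ℝ) : Q 0 u = (1 + u ^ 2)⁻¹ := by
  unfold Q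
  rw [Complex.inv_re]
  simp [Complex.normSq_apply]
  ring

lemma Jc_lip {x : ℝ} (hx : 0 < x) : ∃ C : ℝ, 0 ≤ C ∧ ∀ ξ η : ℝ, ‖Jc 0 x ξ - Jc 0 x η‖ ≤ C * |ξ - η| := by
  refine ⟨2 * π * ∫ t in Set.Ioi (0:ℝ), t ^ 1 * Real.exp (-al x * √t), ?_, fun ξ η => ?_⟩
  · refine mul_nonneg (by positivity) (setIntegral_nonneg measurableSet_Ioi fun t ht => ?_)
    have : (0:ℝ) < t := ht
    positivity
  · unfold Jc
    rw [← integral_sub (Jc_intble 0 ξ hx) (Jc_intble 0 η hx)]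
    rw [show (2 * π * ∫ t in Set.Ioi (0:ℝ), t ^ 1 * Real.exp (-al x * √t)) * |ξ - η| =
      ∫ t in Set.Ioi (0:ℝ), (2 * π * |ξ - η|) * (t ^ 1 * Real.exp (-al x * √t)) by
        rw [integral_const_mul]; ring]
    refine norm_integral_le_of_norm_le ((int_pow_exp_sqrt 1 (al_pos hx)).const_mul _) ?_
    refine (ae_restrict_iff' measurableSet_Ioi).2 (Eventually.of_forall fun t ht => ?_)
    have ht' : 0 < t := ht
    rw [← sub_mul, norm_mul, Kf_norm, ← ofReal_sub, Complex.norm_real, Real.norm_eq_abs]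
    have h1 : |Real.cos (2 * π * ξ * t) - Real.cos (2 * π * η * t)| ≤ |2 * π * ξ * t - 2 * π * η * t| := by
      have := Real.abs_cos_sub_cos_le (2 * π * ξ * t) (2 * π * η * t)
      exact this
    have h2 : |2 * π * ξ * t - 2 * π * η * t| = 2 * π * |ξ - η| * t := by
      rw [show 2 * π * ξ * t - 2 * π * η * t = 2 * π * (ξ - η) * t by ring, abs_mul, abs_mul, abs_of_pos ht',
        abs_of_pos (by positivity : 0 < 2 * π)]
    simp only [mul_zero, pow_zero, one_mul, pow_one]
    rw [← mul_assoc, ← h2]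
    gcongr

lemma Q_diff {u v : ℝ} (hu : 0 < u) (huv : u ≤ v) : |Q 0 u - Q 0 v| ≤ 2 * (1 - u / v) * (1 + u ^ 2)⁻¹ := by
  have hv : 0 < v := hu.trans_le huv
  rw [Q_zero_eq, Q_zero_eq]
  have h1 : (1 + u ^ 2)⁻¹ - (1 + v ^ 2)⁻¹ = ((v ^ 2 - u ^ 2) / (1 + v ^ 2)) * (1 + u ^ 2)⁻¹ := by
    field_simp; ring
  have h0 : 0 ≤ v ^ 2 - u ^ 2 := by nlinarith
  rw [h1, abs_of_nonneg (by positivity)]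
  gcongr
  rw [div_le_iff₀ (by positivity)]
  have h2 : 0 ≤ 1 - u / v := by rw [sub_nonneg, div_le_one hv]; exact huv
  have h3 : u = (u / v) * v := by field_simp
  set r := u / v
  have hr : 0 < r := by positivity
  rw [h3]
  nlinarith [mul_nonneg h2 (sq_nonneg v), mul_nonneg (mul_nonneg h2 h2) (sq_nonneg v)]

lemma Jc_diff2 {x : ℝ} (hx : 0 < x) : ∃ C : ℝ, 0 ≤ C ∧ ∀ ξ η : ℝ, 0 < ξ → ξ ≤ η →
    ‖Jc 0 x ξ - Jc 0 x η‖ ≤ C * ((1 - ξ / η) * ξ ^ (-(3/2) : ℝ)) := by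
  have hC : 0 ≤ Cp 0 x := by unfold Cp; positivity
  have hA := Abase_nonneg
  refine ⟨2 * Cp 0 x * 2 * x ^ (3/2 : ℝ) * Abase, by positivity, fun ξ η hξ h => ?_⟩
  have hη : 0 < η := hξ.trans_le h
  have hc : 0 < ξ / x := by positivity
  have hc2 : 0 < η / x := by positivity
  have h1 : ‖(1 + I : ℂ)‖ ≤ 2 := by
    refine (norm_add_le _ _).trans ?_
    simp; norm_num
  have h_intg : ∀ c : ℝ, 0 < c → IntegrableOn (fun v : ℝ => ((v ^ (2 * (0:ℕ) + 1/2 : ℝ) * Q 0 (c * v) : ℝ) : ℂ) *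
          cexp (-(2 * π * I) * v)) (Set.Ioi 0) := by
    intro c hc
    refine Integrable.mono' ((int_base hc).const_mul ((2 * (0:ℕ) + 1) * (c ^ (2 * 0))⁻¹)) ?_ ?_
    · exact ((Complex.measurable_ofReal.comp (GQ_meas 0 c)).mul (by fun_prop)).aestronglyMeasurable
    · refine (ae_restrict_iff' measurableSet_Ioi).2 (Eventually.of_forall fun t ht => ?_)
      rw [norm_mul, norm_exp_2pii, mul_one, Complex.norm_real, Real.norm_eq_abs]
      exact GQ_bound 0 hc ht
  rw [Jc_formula 0 hx hξ, Jc_formula 0 hx hη, ← mul_sub, norm_mul, norm_mul, Complex.norm_real, Real.norm_eq_abs,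
    abs_of_nonneg hC, ← integral_sub (h_intg _ hc) (h_intg _ hc2)]
  have h2 : ‖∫ v in Set.Ioi (0:ℝ), (((v ^ (2 * (0:ℕ) + 1/2 : ℝ) * Q 0 (ξ / x * v) : ℝ) : ℂ) *
          cexp (-(2 * π * I) * v) - ((v ^ (2 * (0:ℕ) + 1/2 : ℝ) * Q 0 (η / x * v) : ℝ) : ℂ) *
          cexp (-(2 * π * I) * v))‖ ≤ 2 * (1 - ξ / η) * ((ξ / x) ^ (-(3/2) : ℝ) * Abase) := by
    rw [← integral_base hc, ← integral_const_mul]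
    refine norm_integral_le_of_norm_le ((int_base hc).const_mul _) ?_
    refine (ae_restrict_iff' measurableSet_Ioi).2 (Eventually.of_forall fun t ht => ?_)
    have ht0 : 0 < t := ht
    rw [← sub_mul, norm_mul, norm_exp_2pii, mul_one, ← ofReal_sub, Complex.norm_real, Real.norm_eq_abs, ← mul_sub, abs_mul,
      abs_of_pos (by positivity)]
    have := Q_diff (u := ξ / x * t) (v := η / x * t) (by positivity) (by gcongr)
    rw [show ξ / x * t / (η / x * t) = ξ / η by field_simp] at this
    calc _ ≤ t ^ (2 * (0:ℕ) + 1/2 : ℝ) * (2 * (1 - ξ / η) * (1 + (ξ / x * t) ^ 2)⁻¹) := by gcongr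
      _ = _ := by
        simp; ring
  have h3 : (ξ / x) ^ (-(3/2) : ℝ) = x ^ (3/2 : ℝ) * ξ ^ (-(3/2) : ℝ) := by
    rw [Real.div_rpow hξ.le hx.le,
      Real.rpow_neg hx.le, div_inv_eq_mul, mul_comm]
  rw [h3] at h2
  calc _ ≤ 2 * Cp 0 x * (2 * (1 - ξ / η) * (x ^ (3/2 : ℝ) * ξ ^ (-(3/2) : ℝ) * Abase)) := by
        gcongr
    _ = _ := by ring

lemma Jc_diff {x : ℝ} (hx : 0 < x) : ∃ C : ℝ, 0 ≤ C ∧ ∀ ξ η : ℝ, 0 < ξ → ξ ≤ η → η ≤ 2 * ξ →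
    ‖Jc 0 x ξ - Jc 0 x η‖ ≤ C * ((1 - ξ / η) * ξ ^ (-(5/4) : ℝ)) := by
  obtain ⟨C1, hC1, h1⟩ := Jc_lip hx
  obtain ⟨C2, hC2, h2⟩ := Jc_diff2 hx
  refine ⟨2 * C1 + C2, by positivity, fun ξ η hξ h hh => ?_⟩
  have hη : 0 < η := hξ.trans_le h
  have h3 : 0 ≤ 1 - ξ / η := by rw [sub_nonneg, div_le_one hη]; exact h
  rcases le_total ξ 1 with h4 | h4
  · have h5 : ξ ≤ ξ ^ (-(5/4) : ℝ) := by
      have : 1 ≤ ξ ^ (-(5/4) : ℝ) := Real.one_le_rpow_of_pos_of_le_one_of_nonpos hξ h4 (by norm_num)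
      linarith
    have h6 : |ξ - η| = (1 - ξ / η) * η := by
      rw [abs_sub_comm, abs_of_nonneg (by linarith)]; field_simp
    calc _ ≤ C1 * |ξ - η| := h1 ξ η
      _ ≤ C1 * ((1 - ξ / η) * (2 * ξ ^ (-(5/4) : ℝ))) := by
        rw [h6]; gcongr; linarith
      _ = 2 * C1 * ((1 - ξ / η) * ξ ^ (-(5/4) : ℝ)) := by ring
      _ ≤ _ := by gcongr; linarith
  · calc _ ≤ _ := h2 ξ η hξ h
      _ ≤ C2 * ((1 - ξ / η) * ξ ^ (-(5/4) : ℝ)) := by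
        have : ξ ^ (-(3/2) : ℝ) ≤ ξ ^ (-(5/4) : ℝ) := Real.rpow_le_rpow_of_exponent_le h4 (by norm_num)
        gcongr
      _ ≤ _ := by gcongr; linarith

/-- `Φ_j(t)` -/
noncomputable def Ph (x : ℝ) (j : ℕ) (t : ℝ) : ℝ := -(T 0 x t ((j + 1 : ℕ) : ℝ)).im

lemma Ph_eq (x : ℝ) (j : ℕ) (t : ℝ) : Ph x j t = t ^ (-(3/2) : ℝ) * (-(Jc 0 x ((j + 1 : ℕ) / t)).im) := by
  unfold Ph T
  rw [Complex.re_ofReal_mul |> fun _ => Complex.im_ofReal_mul]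
  simp

lemma Ph_bound {x : ℝ} (hx : 0 < x) : ∃ K : ℝ, 0 ≤ K ∧ ∀ σ : ℝ, 0 ≤ σ → σ ≤ 3/2 → ∀ j : ℕ, ∀ t : ℝ, 0 < t →
    |Ph x j t| ≤ K * (t ^ (σ - 3/2) * ((j + 1 : ℕ) : ℝ) ^ (-σ)) := by
  obtain ⟨K, hK, h⟩ := T_bound 0 hx
  refine ⟨K, hK, fun σ h0 h1 j t ht => ?_⟩
  have := h σ h0 (by simpa using h1) t ((j + 1 : ℕ) : ℝ) ht (by positivity)
  unfold Ph
  rw [abs_neg]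
  refine (Complex.abs_im_le_norm _).trans ?_
  simpa using this

lemma Ph_diff {x : ℝ} (hx : 0 < x) : ∃ K : ℝ, 0 ≤ K ∧ ∀ (j : ℕ) (B t : ℝ), 2 ≤ B → B - 1 ≤ t → t ≤ B →
    |Ph x j B - Ph x j t| ≤ K * (B ^ (-(5/4) : ℝ) * ((j + 1 : ℕ) : ℝ) ^ (-(5/4) : ℝ)) := by
  obtain ⟨C, hC, h⟩ := Jc_diff hx
  obtain ⟨K, hK, hb⟩ := Jc_bound 0 hx
  refine ⟨4 * C + 8 * K, by positivity, fun j B t hB h1 h2 => ?_⟩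
  have hB0 : 0 < B := by linarith
  have ht : 0 < t := by linarith
  have hj : (0:ℝ) < ((j + 1 : ℕ) : ℝ) := by positivity
  rw [Ph_eq, Ph_eq]
  set n : ℝ := ((j + 1 : ℕ) : ℝ)
  have e1 : ‖Jc 0 x (n / B) - Jc 0 x (n / t)‖ ≤ C * ((1 - t / B) * (n / B) ^ (-(5/4) : ℝ)) := by
    have := h (n / B) (n / t) (by positivity) (by gcongr) (by
      rw [div_le_iff₀ ht, mul_assoc, div_mul_eq_mul_div, ← mul_div_assoc, le_div_iff₀ hB0]
      nlinarith)
    rwa [show n / B / (n / t) = t / B by field_simp] at this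
  have e2 : ‖Jc 0 x (n / B)‖ ≤ K * (n / B) ^ (-(5/4) : ℝ) := hb (5/4) (by norm_num) (by norm_num) _ (by positivity)
  have hr : 1 / 2 ≤ t / B := by rw [le_div_iff₀ hB0]; linarith
  have hr2 : 1 - t / B ≤ 1 / B := by
    rw [sub_le_iff_le_add, ← add_div, le_div_iff₀ hB0]; linarith
  have hr1 : t / B ≤ 1 := by rw [div_le_one hB0]; exact h2
  have hr0 : 0 < t / B := by positivity
  have h5 : (t / B) ^ (-(3/2) : ℝ) ≤ (t / B) ^ (-(2:ℕ) : ℝ) := Real.rpow_le_rpow_of_exponent_ge hr0 hr1 (by norm_num)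
  have h5' : (t / B) ^ (-(3/2) : ℝ) * B ^ (-(3/2) : ℝ) = t ^ (-(3/2) : ℝ) := by
    rw [← Real.mul_rpow hr0.le hB0.le]; congr 1; field_simp
  rw [Real.rpow_neg hr0.le ((2:ℕ):ℝ), Real.rpow_natCast] at h5
  have h5b : 1 ≤ (t / B) ^ (-(3/2) : ℝ) := Real.one_le_rpow_of_pos_of_le_one_of_nonpos hr0 hr1 (by norm_num)
  have hnB : (n / B) ^ (-(5/4) : ℝ) = B ^ (5/4 : ℝ) * n ^ (-(5/4) : ℝ) := by
    rw [Real.div_rpow hj.le hB0.le, Real.rpow_neg hB0.le, div_inv_eq_mul, mul_comm]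
  have hBB : B ^ (-(3/2) : ℝ) * (1 / B) * B ^ (5/4 : ℝ) = B ^ (-(5/4) : ℝ) := by
    rw [one_div, ← Real.rpow_neg_one B, ← Real.rpow_add hB0, ← Real.rpow_add hB0]; norm_num
  set r := t / B
  have g1 : (r ^ 2)⁻¹ ≤ 4 := by
    rw [inv_le_comm₀ (by positivity) (by norm_num)]; nlinarith
  have g2 : (r ^ 2)⁻¹ - 1 ≤ 8 * (1 / B) := by
    have : (r ^ 2)⁻¹ - 1 = (1 - r) * ((1 + r) * (r ^ 2)⁻¹) := by field_simp; ring
    rw [this]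
    calc _ ≤ (1 / B) * (2 * 4) := by gcongr <;> linarith
      _ = _ := by ring
  set S := (r ^ (-(3/2) : ℝ))
  set p := B ^ (-(3/2) : ℝ)
  have hp : 0 < p := by positivity
  rw [← h5']
  set a := (Jc 0 x (n / B)).im
  set b := (Jc 0 x (n / t)).im
  have e1' : |a - b| ≤ C * ((1 / B) * (n / B) ^ (-(5/4) : ℝ)) := by
    refine ((by simpa [a, b] using Complex.abs_im_le_norm (Jc 0 x (n / B) - Jc 0 x (n / t)) : |a - b| ≤ _).trans e1).trans ?_
    gcongr
  have e2' : |a| ≤ K * (n / B) ^ (-(5/4) : ℝ) := (Complex.abs_im_le_norm _).trans e2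
  calc |p * -a - S * p * -b| = |(S - 1) * p * a - S * p * (a - b)| := by congr 1; ring
    _ ≤ |(S - 1) * p * a| + |S * p * (a - b)| := abs_sub _ _
    _ = (S - 1) * p * |a| + S * p * |a - b| := by
      rw [abs_mul, abs_mul, abs_mul, abs_mul, abs_of_nonneg (by linarith : 0 ≤ S - 1), abs_of_pos hp, abs_of_pos (by linarith : 0 < S)]
    _ ≤ (8 * (1 / B)) * p * (K * (n / B) ^ (-(5/4) : ℝ)) + 4 * p * (C * ((1 / B) * (n / B) ^ (-(5/4) : ℝ))) := by
      gcongr <;> linarith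
    _ = (4 * C + 8 * K) * ((p * (1 / B) * B ^ (5/4 : ℝ)) * n ^ (-(5/4) : ℝ)) := by rw [hnB]; ring
    _ = _ := by rw [hBB]

lemma Ph_cont {x : ℝ} (hx : 0 < x) (j : ℕ) : ContinuousOn (Ph x j) (Set.Ioi 0) := by
  obtain ⟨C, hC, h⟩ := Jc_lip hx
  have hJ : Continuous (Jc 0 x) := by
    have : LipschitzWith ⟨C, hC⟩ (Jc 0 x) := LipschitzWith.of_dist_le_mul fun a b => by
      rw [dist_eq_norm, Real.dist_eq]; exact h a b
    exact this.continuous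
  have : Ph x j = fun t => t ^ (-(3/2) : ℝ) * (-(Jc 0 x ((j + 1 : ℕ) / t)).im) := funext fun t => Ph_eq x j t
  rw [this]
  refine ContinuousOn.mul ?_ ?_
  · exact fun t ht => (Real.continuousAt_rpow_const _ _ (Or.inl (ne_of_gt ht))).continuousWithinAt
  · refine (Complex.continuous_im.comp_continuousOn (hJ.comp_continuousOn ?_)).neg
    exact continuousOn_const.div continuousOn_id fun t ht => ne_of_gt ht

lemma Ph_scale (x : ℝ) (j : ℕ) {t : ℝ} (ht : 0 < t) :
    Ph x j t = ((j + 1 : ℕ) : ℝ) ^ (-(3/2) : ℝ) * Ph x 0 (((j + 1 : ℕ) : ℝ)⁻¹ * t) := by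
  have hj : (0:ℝ) < ((j + 1 : ℕ) : ℝ) := by positivity
  rw [Ph_eq, Ph_eq, Real.mul_rpow (by positivity) ht.le, ← mul_assoc, ← mul_assoc,
    ← Real.mul_rpow hj.le (by positivity), mul_inv_cancel₀ hj.ne', Real.one_rpow, one_mul]
  congr 4
  push_cast
  field_simp

end CS

namespace CS
open MeasureTheory Filter Topology

lemma Ph_summable {x : ℝ} (hx : 0 < x) {t : ℝ} (ht : 0 < t) : Summable (fun j => Ph x j t) := by
  obtain ⟨K, hK, h⟩ := Ph_bound hx
  refine Summable.of_norm_bounded (((summable_rpow_shift (s := 5/4) (by norm_num)).mul_left (K * t ^ (5/4 - 3/2 : ℝ)))) fun j => ?_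
  have := h (5/4) (by norm_num) (by norm_num) j t ht
  rw [Real.norm_eq_abs]
  linarith

/-- `P(t) = ∑_j Φ_j(t)` -/
noncomputable def Pt (x t : ℝ) : ℝ := ∑' j, Ph x j t

lemma Pt_bound1 {x : ℝ} (hx : 0 < x) : ∃ K : ℝ, 0 ≤ K ∧ ∀ t, 0 < t → |Pt x t| ≤ K * t ^ (-(1/4) : ℝ) := by
  obtain ⟨K, hK, h⟩ := Ph_bound hx
  have hs := summable_rpow_shift (s := 5/4) (by norm_num)
  refine ⟨K * ∑' j : ℕ, ((j + 1 : ℕ) : ℝ) ^ (-(5/4) : ℝ), mul_nonneg hK (tsum_nonneg fun j => by positivity), fun t ht => ?_⟩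
  have h2 := hs.mul_left (K * t ^ (-(1/4) : ℝ))
  have := tsum_of_norm_bounded (f := fun j => Ph x j t) h2.hasSum fun j => by
    have := h (5/4) (by norm_num) (by norm_num) j t ht
    rw [Real.norm_eq_abs]
    norm_num at this ⊢
    linarith
  rw [tsum_mul_left, Real.norm_eq_abs] at this
  unfold Pt
  linarith

lemma Pt_bound2 {x : ℝ} (hx : 0 < x) : ∃ K : ℝ, 0 ≤ K ∧ ∀ t, 1 ≤ t → |Pt x t| ≤ K * t ^ (-(3/2) : ℝ) := by
  have hs := summable_rpow_shift (s := 3/2) (by norm_num)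
  set C : ℝ := ((2 * 0 + 3).factorial / al x ^ (2 * 0 + 3))
  have hC : 0 ≤ C := by have := al_pos hx; positivity
  set S := ∑' j : ℕ, ((j + 1 : ℕ) : ℝ) ^ (-(3/2) : ℝ)
  have hS : 0 ≤ S := tsum_nonneg fun j => by positivity
  refine ⟨C * S + |J0 0 x|, by positivity, fun t ht => ?_⟩
  have ht0 : 0 < t := by linarith
  obtain ⟨h1, h2, h3⟩ := poisson_k 0 hx ht0
  have e : Pt x t = ∑' j : ℕ, -(T 0 x t ((j + 1 : ℕ) : ℝ)).im := rfl
  rw [← e] at h3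
  have hp1 : t ^ (-(1/2) : ℝ) ≤ 1 := Real.rpow_le_one_of_one_le_of_nonpos ht (by norm_num)
  have h4 : |∑' k : ℕ, t ^ (-(1/2) : ℝ) * (((k + 1 : ℕ) : ℝ) ^ (2 * 0) * (-(Kf x (t * (k + 1 : ℕ))).im))| ≤ C * t ^ (-(3/2) : ℝ) * S := by
    rw [← Real.norm_eq_abs, ← tsum_mul_left]
    refine tsum_of_norm_bounded (hs.mul_left (C * t ^ (-(3/2) : ℝ))).hasSum fun k => ?_
    have := Kf_im_decay 0 (t := t * (k + 1 : ℕ)) hx (by positivity)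
    rw [Real.norm_eq_abs, abs_mul, abs_of_pos (by positivity : 0 < t ^ (-(1/2) : ℝ))]
    rw [Real.mul_rpow ht0.le (by positivity)] at this
    simp only [mul_zero, pow_zero, one_mul] at this ⊢
    calc _ ≤ 1 * |(-(Kf x (t * (k + 1 : ℕ))).im)| := by gcongr
      _ ≤ _ := by rw [one_mul, mul_assoc]; exact this
  have h5 : Pt x t = ((∑' k : ℕ, t ^ (-(1/2) : ℝ) * (((k + 1 : ℕ) : ℝ) ^ (2 * 0) * (-(Kf x (t * (k + 1 : ℕ))).im)))
     - t ^ (-(3/2) : ℝ) * J0 0 x) / 2 := by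
    rw [h3]; norm_num
  rw [h5, abs_div, abs_of_pos (two_pos : (0:ℝ) < 2), div_le_iff₀ two_pos]
  refine (abs_sub _ _).trans ?_
  rw [abs_mul, abs_of_pos (by positivity : 0 < t ^ (-(3/2) : ℝ))]
  have : 0 ≤ C * S * t ^ (-(3/2) : ℝ) + |J0 0 x| * t ^ (-(3/2) : ℝ) := by positivity
  nlinarith

lemma Pt_cont {x : ℝ} (hx : 0 < x) : ContinuousOn (Pt x) (Set.Ioi 0) := by
  obtain ⟨K, hK, h⟩ := Ph_bound hx
  intro t ht
  have ht0 : 0 < t := ht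
  have hs := (summable_rpow_shift (s := 5/4) (by norm_num)).mul_left (K * (t/2) ^ (-(1/4) : ℝ))
  have : ContinuousOn (Pt x) (Set.Ioi (t/2)) := by
    refine continuousOn_tsum (fun j => (Ph_cont hx j).mono (Set.Ioi_subset_Ioi (by linarith))) hs fun j u hu => ?_
    have hu0 : t / 2 < u := hu
    have := h (5/4) (by norm_num) (by norm_num) j u (by linarith)
    rw [Real.norm_eq_abs]
    refine this.trans ?_
    rw [mul_assoc]
    rw [show (5/4 - 3/2 : ℝ) = -(1/4) by norm_num]
    have h9 : u ^ (-(1/4) : ℝ) ≤ (t/2) ^ (-(1/4) : ℝ) := Real.rpow_le_rpow_of_nonpos (by linarith) hu0.le (by norm_num)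
    gcongr
  exact (this.continuousAt (Ioi_mem_nhds (by linarith))).continuousWithinAt

lemma locint {f : ℝ → ℝ} (hf : ContinuousOn f (Set.Ioi 0)) :
    LocallyIntegrableOn (fun t => (f t : ℂ)) (Set.Ioi (0:ℝ)) :=
  (Complex.continuous_ofReal.comp_continuousOn hf).locallyIntegrableOn measurableSet_Ioi

lemma bigO_top {f : ℝ → ℝ} {K : ℝ} (h : ∀ t, 1 ≤ t → |f t| ≤ K * t ^ (-(3/2) : ℝ)) :
    (fun t => (f t : ℂ)) =O[atTop] (fun t : ℝ => t ^ (-(3/2) : ℝ)) := by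
  refine Asymptotics.IsBigO.of_bound K ?_
  filter_upwards [eventually_ge_atTop 1] with t ht
  rw [Complex.norm_real, Real.norm_eq_abs, Real.norm_eq_abs, abs_of_nonneg (by positivity : 0 ≤ t ^ (-(3/2) : ℝ))]
  exact h t ht

lemma bigO_bot {f : ℝ → ℝ} {K : ℝ} (h : ∀ t, 0 < t → |f t| ≤ K * t ^ (-(1/4) : ℝ)) :
    (fun t => (f t : ℂ)) =O[𝓝[>] 0] (fun t : ℝ => t ^ (-(1/4) : ℝ)) := by
  refine Asymptotics.IsBigO.of_bound K ?_
  filter_upwards [self_mem_nhdsWithin] with t ht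
  have ht0 : 0 < t := ht
  rw [Complex.norm_real, Real.norm_eq_abs, Real.norm_eq_abs, abs_of_nonneg (by positivity : 0 ≤ t ^ (-(1/4) : ℝ))]
  exact h t ht0

lemma Ph_b1 {x : ℝ} (hx : 0 < x) (j : ℕ) : ∃ K : ℝ, ∀ t, 0 < t → |Ph x j t| ≤ K * t ^ (-(1/4) : ℝ) := by
  obtain ⟨K, hK, h⟩ := Ph_bound hx
  refine ⟨K * ((j + 1 : ℕ) : ℝ) ^ (-(5/4) : ℝ), fun t ht => ?_⟩
  have := h (5/4) (by norm_num) (by norm_num) j t ht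
  norm_num at this ⊢
  linarith

lemma Ph_b2 {x : ℝ} (hx : 0 < x) (j : ℕ) : ∃ K : ℝ, ∀ t, 1 ≤ t → |Ph x j t| ≤ K * t ^ (-(3/2) : ℝ) := by
  obtain ⟨K, hK, h⟩ := Ph_bound hx
  refine ⟨K, fun t ht => ?_⟩
  have := h 0 le_rfl (by norm_num) j t (by linarith)
  simpa using this

lemma Ph_mellin {x : ℝ} (hx : 0 < x) (j : ℕ) {s : ℂ} (h1 : 1/4 < s.re) (h2 : s.re < 3/2) :
    MellinConvergent (fun t => (Ph x j t : ℂ)) s := by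
  obtain ⟨K1, hK1⟩ := Ph_b1 hx j
  obtain ⟨K2, hK2⟩ := Ph_b2 hx j
  exact mellinConvergent_of_isBigO_rpow (locint (Ph_cont hx j)) (bigO_top hK2) h2 (bigO_bot hK1) h1

lemma Pt_mellin {x : ℝ} (hx : 0 < x) {s : ℂ} (h1 : 1/4 < s.re) (h2 : s.re < 3/2) :
    MellinConvergent (fun t => (Pt x t : ℂ)) s := by
  obtain ⟨K1, -, hK1⟩ := Pt_bound1 hx
  obtain ⟨K2, -, hK2⟩ := Pt_bound2 hx
  exact mellinConvergent_of_isBigO_rpow (locint (Pt_cont hx)) (bigO_top hK2) h2 (bigO_bot hK1) h1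

lemma Ph_mellin_diff {x : ℝ} (hx : 0 < x) (j : ℕ) {s : ℂ} (h1 : 1/4 < s.re) (h2 : s.re < 3/2) :
    DifferentiableAt ℂ (mellin (fun t => (Ph x j t : ℂ))) s := by
  obtain ⟨K1, hK1⟩ := Ph_b1 hx j
  obtain ⟨K2, hK2⟩ := Ph_b2 hx j
  exact mellin_differentiableAt_of_isBigO_rpow (locint (Ph_cont hx j)) (bigO_top hK2) h2 (bigO_bot hK1) h1

lemma Pt_mellin_diff {x : ℝ} (hx : 0 < x) {s : ℂ} (h1 : 1/4 < s.re) (h2 : s.re < 3/2) :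
    DifferentiableAt ℂ (mellin (fun t => (Pt x t : ℂ))) s := by
  obtain ⟨K1, -, hK1⟩ := Pt_bound1 hx
  obtain ⟨K2, -, hK2⟩ := Pt_bound2 hx
  exact mellin_differentiableAt_of_isBigO_rpow (locint (Pt_cont hx)) (bigO_top hK2) h2 (bigO_bot hK1) h1

lemma Ph_mellin_scale (x : ℝ) (j : ℕ) (s : ℂ) :
    mellin (fun t => (Ph x j t : ℂ)) s = (1 / ((j:ℂ) + 1) ^ (3/2 - s)) * mellin (fun t => (Ph x 0 t : ℂ)) s := by
  have hj : (0:ℝ) < ((j + 1 : ℕ) : ℝ) := by positivity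
  have hj' : ((j:ℂ) + 1) ≠ 0 := by exact_mod_cast hj.ne'
  have h1 : mellin (fun t => (Ph x j t : ℂ)) s =
      mellin (fun t => ((((j + 1 : ℕ) : ℝ) ^ (-(3/2) : ℝ) : ℝ) : ℂ) • (fun u : ℝ => (Ph x 0 u : ℂ)) (((j + 1 : ℕ) : ℝ)⁻¹ * t)) s := by
    unfold mellin
    refine setIntegral_congr_fun measurableSet_Ioi fun t ht => ?_
    simp only
    rw [Ph_scale x j ht, ofReal_mul, smul_eq_mul (α := ℂ) _ ((Ph x 0 _ : ℝ) : ℂ)]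
  rw [h1, mellin_const_smul, mellin_comp_mul_left (fun u : ℝ => (Ph x 0 u : ℂ)) s (inv_pos.2 hj), smul_eq_mul, smul_eq_mul, ← mul_assoc]
  congr 1
  rw [ofReal_cpow hj.le, ofReal_inv, Complex.inv_cpow]
  · push_cast
    rw [Complex.cpow_neg, Complex.cpow_neg, Complex.cpow_sub _ _ hj']
    field_simp
  · push_cast
    rw [show ((j:ℂ) + 1) = ((j + 1 : ℕ) : ℂ) by push_cast; rfl, Complex.natCast_arg]
    exact Real.pi_pos.ne

lemma Ph_norm_scale (x : ℝ) (j : ℕ) (s : ℂ) :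
    ∫ t in Set.Ioi (0:ℝ), ‖(t : ℂ) ^ (s - 1) • (Ph x j t : ℂ)‖ = ((j + 1 : ℕ) : ℝ) ^ (-(3/2 - s.re)) *
      ∫ t in Set.Ioi (0:ℝ), ‖(t : ℂ) ^ (s - 1) • (Ph x 0 t : ℂ)‖ := by
  have hj : (0:ℝ) < ((j + 1 : ℕ) : ℝ) := by positivity
  have h := MeasureTheory.integral_comp_mul_left_Ioi (fun t : ℝ => ‖(t : ℂ) ^ (s - 1) • (Ph x 0 t : ℂ)‖) 0 (inv_pos.2 hj)
  rw [mul_zero, inv_inv, smul_eq_mul] at h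
  have h2 : ∫ t in Set.Ioi (0:ℝ), ‖(t : ℂ) ^ (s - 1) • (Ph x j t : ℂ)‖ =
      ((j + 1 : ℕ) : ℝ) ^ (-(3/2 - s.re) - 1) * ∫ t in Set.Ioi (0:ℝ), ‖(((((j + 1 : ℕ) : ℝ)⁻¹ * t : ℝ)) : ℂ) ^ (s - 1) • (Ph x 0 (((j + 1 : ℕ) : ℝ)⁻¹ * t) : ℂ)‖ := by
    rw [← integral_const_mul]
    refine setIntegral_congr_fun measurableSet_Ioi fun t ht => ?_
    have ht0 : 0 < t := ht
    rw [Ph_scale x j ht, norm_smul, norm_smul, Complex.norm_cpow_eq_rpow_re_of_pos ht0,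
      Complex.norm_cpow_eq_rpow_re_of_pos (by positivity), ofReal_mul, norm_mul, Complex.norm_real, Real.norm_of_nonneg (by positivity),
      Real.mul_rpow (by positivity) ht0.le, Real.inv_rpow hj.le, ← Real.rpow_neg hj.le]
    have : ((j + 1 : ℕ) : ℝ) ^ (-(3/2) : ℝ) = ((j + 1 : ℕ) : ℝ) ^ (-(3/2 - s.re) - 1) * ((j + 1 : ℕ) : ℝ) ^ (-(s - 1).re) := by
      rw [← Real.rpow_add hj]; congr 1; simp
    rw [this]; ring
  rw [h2, h, Real.rpow_sub_one hj.ne']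
  field_simp

lemma Pt_mellin_eq1 {x : ℝ} (hx : 0 < x) {s : ℂ} (h1 : 1/4 < s.re) (h2 : s.re < 1/2) :
    mellin (fun t => (Pt x t : ℂ)) s = riemannZeta (3/2 - s) * mellin (fun t => (Ph x 0 t : ℂ)) s := by
  have hsum : Summable fun j : ℕ => ∫ t in Set.Ioi (0:ℝ), ‖(t : ℂ) ^ (s - 1) • (Ph x j t : ℂ)‖ := by
    refine Summable.congr ((summable_rpow_shift (s := 3/2 - s.re) (by linarith)).mul_right _) fun j => (Ph_norm_scale x j s).symm
  have := hasSum_integral_of_summable_integral_norm (μ := volume.restrict (Set.Ioi (0:ℝ))) (F := fun (j : ℕ) (t : ℝ) => (t : ℂ) ^ (s - 1) • (Ph x j t : ℂ))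
    (fun j => Ph_mellin hx j h1 (by linarith)) hsum
  have e : ∫ t in Set.Ioi (0:ℝ), ∑' j : ℕ, (t : ℂ) ^ (s - 1) • (Ph x j t : ℂ) = mellin (fun t => (Pt x t : ℂ)) s := by
    unfold mellin
    refine setIntegral_congr_fun measurableSet_Ioi fun t ht => ?_
    simp only [smul_eq_mul]
    rw [tsum_mul_left, Pt, Complex.ofReal_tsum]
  rw [e] at this
  rw [← this.tsum_eq, zeta_eq_tsum_one_div_nat_add_one_cpow (by simp; linarith), ← tsum_mul_right]
  refine tsum_congr fun j => ?_
  exact Ph_mellin_scale x j s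

lemma U_preconn : IsPreconnected ({s : ℂ | 1/4 < s.re ∧ s.re < 1/2} ∪ {s : ℂ | 1/4 < s.re ∧ s.re < 3/2 ∧ 0 < s.im} ∪
    {s : ℂ | 1/2 < s.re ∧ s.re < 3/2}) := by
  have c1 : ∀ r : ℝ, Convex ℝ {s : ℂ | r < s.re} := fun r => convex_halfSpace_re_gt r
  have c2 : ∀ r : ℝ, Convex ℝ {s : ℂ | s.re < r} := fun r => convex_halfSpace_re_lt r
  have c3 : ∀ r : ℝ, Convex ℝ {s : ℂ | r < s.im} := fun r => convex_halfSpace_im_gt r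
  refine IsPreconnected.union' ⟨(1 + I : ℂ), ?_, ?_⟩ (IsPreconnected.union' ⟨(3/8 + I : ℂ), ?_, ?_⟩ ?_ ?_) ?_
  · right; norm_num
  · norm_num
  · norm_num
  · norm_num
  · exact ((c1 _).inter (c2 _)).isPreconnected
  · exact ((c1 _).inter ((c2 _).inter (c3 _))).isPreconnected
  · exact ((c1 _).inter (c2 _)).isPreconnected

lemma Pt_mellin_eq {x : ℝ} (hx : 0 < x) :
    mellin (fun t => (Pt x t : ℂ)) 1 = riemannZeta (1/2) * mellin (fun t => (Ph x 0 t : ℂ)) 1 := by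
  set U := ({s : ℂ | 1/4 < s.re ∧ s.re < 1/2} ∪ {s : ℂ | 1/4 < s.re ∧ s.re < 3/2 ∧ 0 < s.im} ∪
    {s : ℂ | 1/2 < s.re ∧ s.re < 3/2}) with hU
  have hsub : ∀ s ∈ U, 1/4 < s.re ∧ s.re < 3/2 ∧ s ≠ 1/2 := by
    rintro s ((h | h) | h)
    · refine ⟨h.1, by linarith [h.2], fun hs => ?_⟩
      have := h.2; rw [hs] at this; norm_num at this
    · refine ⟨h.1, h.2.1, fun hs => ?_⟩
      have := h.2.2; rw [hs] at this; norm_num at this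
    · refine ⟨by linarith [h.1], h.2, fun hs => ?_⟩
      have := h.1; rw [hs] at this; norm_num at this
  have o1 : IsOpen {s : ℂ | 1/4 < s.re ∧ s.re < 1/2} :=
    (isOpen_lt continuous_const Complex.continuous_re).inter (isOpen_lt Complex.continuous_re continuous_const)
  have o2 : IsOpen {s : ℂ | 1/4 < s.re ∧ s.re < 3/2 ∧ 0 < s.im} :=
    (isOpen_lt continuous_const Complex.continuous_re).inter ((isOpen_lt Complex.continuous_re continuous_const).inter
      (isOpen_lt continuous_const Complex.continuous_im))
  have o3 : IsOpen {s : ℂ | 1/2 < s.re ∧ s.re < 3/2} :=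
    (isOpen_lt continuous_const Complex.continuous_re).inter (isOpen_lt Complex.continuous_re continuous_const)
  have hUo : IsOpen U := (o1.union o2).union o3
  have a1 : AnalyticOnNhd ℂ (mellin (fun t => (Pt x t : ℂ))) U := by
    refine DifferentiableOn.analyticOnNhd (fun s hs => ?_) hUo
    exact (Pt_mellin_diff hx (hsub s hs).1 (hsub s hs).2.1).differentiableWithinAt
  have a2 : AnalyticOnNhd ℂ (fun s => riemannZeta (3/2 - s) * mellin (fun t => (Ph x 0 t : ℂ)) s) U := by
    refine DifferentiableOn.analyticOnNhd (fun s hs => ?_) hUo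
    obtain ⟨h1, h2, h3⟩ := hsub s hs
    have hz : DifferentiableAt ℂ (fun s => riemannZeta (3/2 - s)) s := by
      have hne : (3/2 - s : ℂ) ≠ 1 := fun h => h3 (by linear_combination -h)
      exact (differentiableAt_riemannZeta hne).comp s (by fun_prop)
    exact (hz.mul (Ph_mellin_diff hx 0 h1 h2)).differentiableWithinAt
  have h0 : (3/8 : ℂ) ∈ {s : ℂ | 1/4 < s.re ∧ s.re < 1/2} := by norm_num
  have := a1.eqOn_of_preconnected_of_eventuallyEq a2 U_preconn (z₀ := 3/8) (Or.inl (Or.inl h0)) (by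
    filter_upwards [o1.mem_nhds h0] with s hs
    exact Pt_mellin_eq1 hx hs.1 hs.2)
  have h := this (show (1:ℂ) ∈ U from Or.inr (by norm_num))
  simp only at h
  rw [h]; norm_num

lemma Pt_int_eq {x : ℝ} (hx : 0 < x) :
    ((∫ t in Set.Ioi (0:ℝ), Pt x t : ℝ) : ℂ) = riemannZeta (1/2) * ((∫ t in Set.Ioi (0:ℝ), Ph x 0 t : ℝ) : ℂ) := by
  have := Pt_mellin_eq hx
  unfold mellin at this
  simpa [integral_complex_ofReal] using this

lemma Ph_int {x : ℝ} (hx : 0 < x) (j : ℕ) : IntegrableOn (Ph x j) (Set.Ioi 0) := by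
  have := Ph_mellin hx j (s := 1) (by norm_num) (by norm_num)
  unfold MellinConvergent at this
  simp only [sub_self, Complex.cpow_zero, one_smul] at this
  exact this.re

lemma Pt_int {x : ℝ} (hx : 0 < x) : IntegrableOn (Pt x) (Set.Ioi 0) := by
  have := Pt_mellin hx (s := 1) (by norm_num) (by norm_num)
  unfold MellinConvergent at this
  simp only [sub_self, Complex.cpow_zero, one_smul] at this
  exact this.re

lemma Ph_int_eq (x : ℝ) (j : ℕ) :
    ∫ t in Set.Ioi (0:ℝ), Ph x j t = ((j + 1 : ℕ) : ℝ) ^ (-(1/2) : ℝ) * ∫ t in Set.Ioi (0:ℝ), Ph x 0 t := by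
  have h := Ph_mellin_scale x j 1
  unfold mellin at h
  simp only [sub_self, Complex.cpow_zero, one_smul, integral_complex_ofReal] at h
  apply Complex.ofReal_injective
  rw [h, ofReal_mul, ofReal_cpow (by positivity), one_div]
  rw [show (3/2 - 1 : ℂ) = 1/2 by norm_num, ← Complex.cpow_neg]
  push_cast; rfl

end CS

namespace CS
open MeasureTheory Filter Topology

lemma hasSum_Ioc {f : ℝ → ℝ} (hf : IntegrableOn f (Set.Ioi 0)) :
    HasSum (fun b : ℕ => ∫ t in Set.Ioc (b:ℝ) (b+1), f t) (∫ t in Set.Ioi (0:ℝ), f t) := by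
  have hU : (⋃ b : ℕ, Set.Ioc (b:ℝ) (b+1)) = Set.Ioi (0:ℝ) := by
    ext t
    simp only [Set.mem_iUnion, Set.mem_Ioc, Set.mem_Ioi]
    constructor
    · rintro ⟨b, h1, h2⟩
      exact (Nat.cast_nonneg b).trans_lt h1
    · intro ht
      have h1 : 0 < ⌈t⌉₊ := Nat.ceil_pos.2 ht
      refine ⟨⌈t⌉₊ - 1, ?_, ?_⟩
      · rw [Nat.cast_sub h1]
        have := Nat.ceil_lt_add_one ht.le
        push_cast; linarith
      · rw [Nat.cast_sub h1]
        have := Nat.le_ceil t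
        push_cast; linarith
  have := hasSum_integral_iUnion (μ := volume) (s := fun b : ℕ => Set.Ioc (b:ℝ) (b+1)) (f := f) (fun b => measurableSet_Ioc) ?_ (by rw [hU]; exact hf)
  · rwa [hU] at this
  · intro a b hab
    simp only [Function.onFun]
    rw [Set.disjoint_left]
    rintro t ⟨h1, h2⟩ ⟨h3, h4⟩
    rcases lt_or_gt_of_ne hab with h | h
    · have : (a:ℝ) + 1 ≤ b := by exact_mod_cast h
      linarith
    · have : (b:ℝ) + 1 ≤ a := by exact_mod_cast h
      linarith

/-- error term -/
noncomputable def ee (x : ℝ) (j b : ℕ) : ℝ := Ph x j (b + 1) - ∫ t in Set.Ioc (b:ℝ) (b+1), Ph x j t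

lemma Ioc_sub (b : ℕ) : Set.Ioc (b:ℝ) (b+1) ⊆ Set.Ioi 0 := fun t ht => (Nat.cast_nonneg b).trans_lt ht.1

lemma int_quarter : IntegrableOn (fun t : ℝ => t ^ (-(1/4) : ℝ)) (Set.Ioc 0 1) :=
  (intervalIntegrable_iff_integrableOn_Ioc_of_le zero_le_one).1 (intervalIntegral.intervalIntegrable_rpow' (by norm_num))

lemma ee_bound {x : ℝ} (hx : 0 < x) : ∃ C : ℝ, 0 ≤ C ∧ ∀ j b : ℕ,
    |ee x j b| ≤ C * (((b + 1 : ℕ) : ℝ) ^ (-(5/4) : ℝ) * ((j + 1 : ℕ) : ℝ) ^ (-(5/4) : ℝ)) := by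
  obtain ⟨K, hK, h⟩ := Ph_bound hx
  obtain ⟨D, hD, hd⟩ := Ph_diff hx
  set M := ∫ t in Set.Ioc (0:ℝ) 1, t ^ (-(1/4) : ℝ)
  have hM : 0 ≤ M := setIntegral_nonneg measurableSet_Ioc fun t ht => by
    have := ht.1; positivity
  refine ⟨K + K * M + D, by positivity, fun j b => ?_⟩
  have hj : (0:ℝ) < ((j + 1 : ℕ) : ℝ) := by positivity
  rcases Nat.eq_zero_or_pos b with rfl | hb
  · unfold ee
    have h1 : |Ph x j 1| ≤ K * ((j + 1 : ℕ) : ℝ) ^ (-(5/4) : ℝ) := by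
      have := h (5/4) (by norm_num) (by norm_num) j 1 one_pos
      simpa using this
    have h2 : ‖∫ t in Set.Ioc (0:ℝ) 1, Ph x j t‖ ≤ (K * ((j + 1 : ℕ) : ℝ) ^ (-(5/4) : ℝ)) * M := by
      rw [← integral_const_mul]
      refine norm_integral_le_of_norm_le (int_quarter.const_mul _) ?_
      refine (ae_restrict_iff' measurableSet_Ioc).2 (Eventually.of_forall fun t ht => ?_)
      have := h (5/4) (by norm_num) (by norm_num) j t ht.1
      rw [Real.norm_eq_abs]
      rw [show (5/4 - 3/2 : ℝ) = -(1/4) by norm_num] at this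
      linarith
    rw [Real.norm_eq_abs] at h2
    have h3 : 0 ≤ D * ((j + 1 : ℕ) : ℝ) ^ (-(5/4) : ℝ) := by positivity
    have h4 := abs_sub (Ph x j 1) (∫ t in Set.Ioc (0:ℝ) 1, Ph x j t)
    simp only [Nat.cast_zero, zero_add, Nat.cast_one, Real.one_rpow, one_mul]
    nlinarith
  · have hb1 : (1:ℝ) ≤ b := by exact_mod_cast hb
    have hvol : (volume (Set.Ioc (b:ℝ) (b+1))) = 1 := by simp
    have h_intg : IntegrableOn (Ph x j) (Set.Ioc (b:ℝ) (b+1)) := (Ph_int hx j).mono_set (Ioc_sub b)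
    have e : ee x j b = ∫ t in Set.Ioc (b:ℝ) (b+1), (Ph x j (b+1) - Ph x j t) := by
      have hci : IntegrableOn (fun _ : ℝ => Ph x j (b+1)) (Set.Ioc (b:ℝ) (b+1)) := by
        refine integrableOn_const ?_
        rw [hvol]; simp
      rw [integral_sub hci h_intg, setIntegral_const, Measure.real, hvol]
      simp [ee]
    rw [e, ← Real.norm_eq_abs]
    have := norm_setIntegral_le_of_norm_le_const (μ := volume) (s := Set.Ioc (b:ℝ) (b+1)) (f := fun t => (Ph x j (b+1) - Ph x j t))
      (C := D * (((b + 1 : ℕ) : ℝ) ^ (-(5/4) : ℝ) * ((j + 1 : ℕ) : ℝ) ^ (-(5/4) : ℝ))) (by rw [hvol]; simp) (fun t ht => by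
        rw [Real.norm_eq_abs]
        have := hd j ((b:ℝ) + 1) t (by linarith) (by linarith [ht.1]) ht.2
        push_cast at this ⊢
        exact this)
    rw [Measure.real, hvol] at this
    simp only [ENNReal.toReal_one, mul_one] at this
    refine this.trans ?_
    have : 0 ≤ K + K * M := by positivity
    gcongr
    linarith

lemma ee_summable {x : ℝ} (hx : 0 < x) : Summable (fun p : ℕ × ℕ => ee x p.1 p.2) := by
  obtain ⟨C, hC, h⟩ := ee_bound hx
  have hs := summable_rpow_shift (s := 5/4) (by norm_num)
  have h2 := (hs.mul_of_nonneg hs (fun _ => by positivity) (fun _ => by positivity)).mul_left C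
  refine Summable.of_norm_bounded h2 fun p => ?_
  have := h p.1 p.2
  rw [Real.norm_eq_abs]
  linarith

lemma ee_sum_j {x : ℝ} (hx : 0 < x) (b : ℕ) :
    HasSum (fun j => ee x j b) (Pt x (b + 1) - ∫ t in Set.Ioc (b:ℝ) (b+1), Pt x t) := by
  obtain ⟨C, hC, h⟩ := Ph_bound hx
  refine HasSum.sub (Ph_summable hx (by positivity)).hasSum ?_
  have h_intg : IntegrableOn (fun t : ℝ => t ^ (-(1/4) : ℝ)) (Set.Ioc (b:ℝ) (b+1)) :=
    (intervalIntegrable_iff_integrableOn_Ioc_of_le (by linarith)).1 (intervalIntegral.intervalIntegrable_rpow' (by norm_num))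
  refine hasSum_integral_of_summable_integral_norm (fun j => (Ph_int hx j).mono_set (Ioc_sub b)) ?_
  set M := ∫ t in Set.Ioc (b:ℝ) (b+1), t ^ (-(1/4) : ℝ)
  refine Summable.of_nonneg_of_le (fun j => integral_nonneg fun t => norm_nonneg _) (fun j => ?_)
    (((summable_rpow_shift (s := 5/4) (by norm_num)).mul_left C).mul_right M)
  rw [← integral_const_mul]
  refine setIntegral_mono_on ((Ph_int hx j).mono_set (Ioc_sub b)).norm (h_intg.const_mul _) measurableSet_Ioc fun t ht => ?_
  have := h (5/4) (by norm_num) (by norm_num) j t (Ioc_sub b ht)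
  rw [Real.norm_eq_abs]
  rw [show (5/4 - 3/2 : ℝ) = -(1/4) by norm_num] at this
  linarith

/-- The row sums. -/
lemma Ph_summable_b {x : ℝ} (hx : 0 < x) (j : ℕ) : Summable (fun b : ℕ => Ph x j (b + 1)) := by
  obtain ⟨K, hK, h⟩ := Ph_bound hx
  refine Summable.of_norm_bounded ((summable_rpow_shift (s := 3/2) (by norm_num)).mul_left K) fun b => ?_
  have := h 0 le_rfl (by norm_num) j (b+1) (by positivity)
  rw [Real.norm_eq_abs]
  simpa using this

lemma Pt_summable_b {x : ℝ} (hx : 0 < x) : Summable (fun b : ℕ => Pt x (b + 1)) := by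
  obtain ⟨K, hK, h⟩ := Pt_bound2 hx
  refine Summable.of_norm_bounded ((summable_rpow_shift (s := 3/2) (by norm_num)).mul_left K) fun b => ?_
  have := h (b+1) (by linarith [(Nat.cast_nonneg b : (0:ℝ) ≤ b)])
  rw [Real.norm_eq_abs]
  push_cast
  exact this

lemma interchange0 {x : ℝ} (hx : 0 < x) (hxint : ∀ k : ℤ, x ≠ (k : ℝ)) :
    (((∑' b : ℕ, Pt x (b + 1)) : ℝ) : ℂ) = cc 0 x * riemannZeta (1/2) + ∑' j, rest 0 x (j + 1) := by
  have hE := ee_summable hx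
  set V := ∫ t in Set.Ioi (0:ℝ), Ph x 0 t with hV
  set R : ℕ → ℝ := fun j => ∑' b : ℕ, Ph x j (b + 1)
  have h1 : ∀ j, HasSum (fun b => ee x j b) (R j - V * ((j + 1 : ℕ) : ℝ) ^ (-(1/2) : ℝ)) := by
    intro j
    have := (Ph_summable_b hx j).hasSum.sub (hasSum_Ioc (Ph_int hx j))
    rw [Ph_int_eq, mul_comm] at this
    exact this
  have h2 : HasSum (fun b : ℕ => Pt x (b + 1) - ∫ t in Set.Ioc (b:ℝ) (b+1), Pt x t) (∑' b : ℕ, Pt x (b + 1) - ∫ t in Set.Ioi (0:ℝ), Pt x t) :=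
    (Pt_summable_b hx).hasSum.sub (hasSum_Ioc (Pt_int hx))
  have h3 : Summable fun j => R j - V * ((j + 1 : ℕ) : ℝ) ^ (-(1/2) : ℝ) := by
    have := hE.prod
    refine this.congr fun j => (h1 j).tsum_eq
  have h4 : ∑' j, (R j - V * ((j + 1 : ℕ) : ℝ) ^ (-(1/2) : ℝ)) = ∑' b : ℕ, Pt x (b + 1) - ∫ t in Set.Ioi (0:ℝ), Pt x t := by
    rw [← h2.tsum_eq]
    have := (hE.tsum_comm (f := fun j b => ee x j b))
    rw [tsum_congr fun b => (ee_sum_j hx b).tsum_eq, tsum_congr fun j => (h1 j).tsum_eq] at this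
    exact this.symm
  have hR : ∀ j, (R j : ℂ) = ((cc 0 x * ((j + 1 : ℕ) : ℝ) ^ (-(1/2) : ℝ) : ℝ) : ℂ) + rest 0 x (j + 1) := by
    intro j
    have := sum_ImT 0 hx hxint (j + 1) (Nat.succ_pos j)
    have e : (R j : ℂ) = ∑' b : ℕ, ((-(T 0 x ((b+1:ℕ):ℝ) (j+1:ℕ)).im : ℝ) : ℂ) := by
      rw [← Complex.ofReal_tsum]
      simp only [R, Ph]
      push_cast
      rfl
    rw [e, this.tsum_eq]
    simp
  obtain ⟨r1, -⟩ := rest_summable 0 hx hxint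
  have h5 : Summable fun j : ℕ => (((V - cc 0 x) * ((j + 1 : ℕ) : ℝ) ^ (-(1/2) : ℝ) : ℝ) : ℂ) := by
    have := r1.sub (Complex.ofRealCLM.summable h3)
    refine this.congr fun j => ?_
    simp only [Function.comp, Complex.ofRealCLM_apply]
    rw [ofReal_sub, hR]
    push_cast
    ring
  have h6 : V = cc 0 x := by
    by_contra hne
    have h7 : Summable fun j : ℕ => ((V - cc 0 x) * ((j + 1 : ℕ) : ℝ) ^ (-(1/2) : ℝ)) := by
      have := Complex.reCLM.summable h5
      exact this.congr fun j => by simp only [Complex.reCLM_apply, Complex.ofReal_re]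
    have h8 := h7.mul_left (V - cc 0 x)⁻¹
    have h9 : Summable fun j : ℕ => ((j + 1 : ℕ) : ℝ) ^ (-(1/2) : ℝ) :=
      h8.congr fun j => by rw [inv_mul_cancel_left₀ (sub_ne_zero.2 hne)]
    have := Real.summable_nat_rpow.1 ((summable_nat_add_iff (f := fun j : ℕ => (j:ℝ) ^ (-(1/2) : ℝ)) 1).1 h9)
    norm_num at this
  have h10 : ∀ j, ((R j - V * ((j + 1 : ℕ) : ℝ) ^ (-(1/2) : ℝ) : ℝ) : ℂ) = rest 0 x (j + 1) := by
    intro j; rw [ofReal_sub, hR, h6]; ring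
  have h11 := congrArg (fun r : ℝ => (r : ℂ)) h4
  simp only [Complex.ofReal_tsum] at h11
  rw [tsum_congr h10, ofReal_sub, Pt_int_eq hx, ← hV, h6] at h11
  rw [h11]; ring

/-- The interchange, all `m`. -/
theorem interchange (m : ℕ) {x : ℝ} (hx : 0 < x) (hxint : ∀ k : ℤ, x ≠ (k : ℝ)) :
    Summable (fun b : ℕ => ∑' j : ℕ, -(T m x ((b+1:ℕ):ℝ) (j+1:ℕ)).im) ∧
    ((∑' b : ℕ, ∑' j : ℕ, -(T m x ((b+1:ℕ):ℝ) (j+1:ℕ)).im : ℝ) : ℂ) =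
      cc m x * riemannZeta (2 * m + 1/2) + ∑' j, rest m x (j + 1) := by
  rcases Nat.eq_zero_or_pos m with rfl | hm
  · have e : ∀ b : ℕ, ∑' j : ℕ, -(T 0 x ((b+1:ℕ):ℝ) (j+1:ℕ)).im = Pt x (b + 1) := by
      intro b; simp only [Pt, Ph]; push_cast; rfl
    refine ⟨(Pt_summable_b hx).congr fun b => (e b).symm, ?_⟩
    rw [tsum_congr e, interchange0 hx hxint]
    simp
  · obtain ⟨K, hK, h⟩ := T_bound m hx
    have hm1 : (1:ℝ) ≤ m := by exact_mod_cast hm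
    have hs := summable_rpow_shift (s := m + 3/4) (by linarith)
    have hS : Summable (fun p : ℕ × ℕ => -(T m x ((p.1+1:ℕ):ℝ) (p.2+1:ℕ)).im) := by
      refine Summable.of_norm_bounded ((hs.mul_of_nonneg hs (fun _ => by positivity) (fun _ => by positivity)).mul_left K) fun p => ?_
      have := h (m + 3/4) (by positivity) (by linarith) ((p.1+1:ℕ):ℝ) (p.2+1:ℕ) (by positivity) (by positivity)
      rw [norm_neg, Real.norm_eq_abs]
      rw [show ((m:ℝ) + 3/4 - (2 * m + 3/2)) = -(m + 3/4) by ring] at this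
      exact (Complex.abs_im_le_norm _).trans this
    refine ⟨hS.prod, ?_⟩
    have hc : ∑' b : ℕ, ∑' j : ℕ, -(T m x ((b+1:ℕ):ℝ) (j+1:ℕ)).im = ∑' j : ℕ, ∑' b : ℕ, -(T m x ((b+1:ℕ):ℝ) (j+1:ℕ)).im :=
      (hS.tsum_comm (f := fun b j : ℕ => -(T m x ((b+1:ℕ):ℝ) (j+1:ℕ)).im)).symm
    rw [hc]
    obtain ⟨r1, -⟩ := rest_summable m hx hxint
    have hz := (summable_rpow_shift (s := 2 * m + 1/2) (by linarith)).mul_left (cc m x)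
    have hz2 : Summable fun j : ℕ => ((cc m x * ((j + 1 : ℕ) : ℝ) ^ (-(2 * m + 1/2) : ℝ) : ℝ) : ℂ) :=
      Complex.ofRealCLM.summable hz
    have e : ∀ j : ℕ, ((∑' b : ℕ, -(T m x ((b+1:ℕ):ℝ) (j+1:ℕ)).im : ℝ) : ℂ) =
        ((cc m x * ((j + 1 : ℕ) : ℝ) ^ (-(2 * m + 1/2) : ℝ) : ℝ) : ℂ) + rest m x (j + 1) := by
      intro j
      rw [Complex.ofReal_tsum]
      exact (sum_ImT m hx hxint (j + 1) (Nat.succ_pos j)).tsum_eq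
    rw [Complex.ofReal_tsum, tsum_congr e, Summable.tsum_add hz2 r1,
      zeta_eq_tsum_one_div_nat_add_one_cpow (by simp; linarith), ← tsum_mul_left]
    congr 1
    refine tsum_congr fun j => ?_
    rw [ofReal_mul, ofReal_cpow (by positivity), one_div (((j:ℂ)+1)^(2*(m:ℂ)+1/2)), ← Complex.cpow_neg]
    push_cast; rfl

end CS

namespace CS
open MeasureTheory Filter Topology

lemma regroup (r : ℝ) (G : ℕ → ℂ)
    (hs : Summable fun p : ℕ × ℕ => ((((p.1 + 1 : ℕ) : ℝ) ^ r : ℝ) : ℂ) * G ((p.1 + 1) * (p.2 + 1))) :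
    ∑' n : ℕ, ((rsigma r (n + 1) : ℝ) : ℂ) * G (n + 1) =
      ∑' p : ℕ × ℕ, ((((p.1 + 1 : ℕ) : ℝ) ^ r : ℝ) : ℂ) * G ((p.1 + 1) * (p.2 + 1)) := by
  have h1 := hs.hasSum
  rw [← (Equiv.prodCongr Equiv.pnatEquivNat Equiv.pnatEquivNat).hasSum_iff, ← sigmaAntidiagonalEquivProd.hasSum_iff] at h1
  have h2 := h1.sigma (g := fun n : ℕ+ => ((rsigma r n : ℝ) : ℂ) * G n) (fun n => ?_)
  · rw [← Equiv.pnatEquivNat.symm.hasSum_iff] at h2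
    rw [← h2.tsum_eq]
    refine tsum_congr fun n => ?_
    simp
  · have e : ∀ c : Nat.divisorsAntidiagonal (n:ℕ), ((fun p : ℕ × ℕ => ((((p.1 + 1 : ℕ) : ℝ) ^ r : ℝ) : ℂ) * G ((p.1 + 1) * (p.2 + 1))) ∘
        (Equiv.prodCongr Equiv.pnatEquivNat Equiv.pnatEquivNat)) (sigmaAntidiagonalEquivProd ⟨n, c⟩) =
        (fun q : ℕ × ℕ => (((q.1:ℝ) ^ r : ℝ) : ℂ) * G (q.1 * q.2)) c.1 := by
      rintro ⟨⟨a, b⟩, hc⟩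
      have hc' := Nat.mem_divisorsAntidiagonal.1 hc
      simp only at hc'
      have ha : 0 < a := Nat.pos_of_ne_zero fun h0 => hc'.2 (by rw [← hc'.1, h0, zero_mul])
      have hb : 0 < b := Nat.pos_of_ne_zero fun h0 => hc'.2 (by rw [← hc'.1, h0, mul_zero])
      have ha' : a - 1 + 1 = a := Nat.sub_add_cancel ha
      have hb' : b - 1 + 1 = b := Nat.sub_add_cancel hb
      have ha2 : ((a - 1 : ℕ) : ℝ) + 1 = a := by exact_mod_cast ha'
      simp [sigmaAntidiagonalEquivProd, divisorsAntidiagonalFactors, ha', hb', ha2]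
    have h3 : HasSum (fun c : Nat.divisorsAntidiagonal (n:ℕ) => (fun q : ℕ × ℕ => (((q.1:ℝ) ^ r : ℝ) : ℂ) * G (q.1 * q.2)) c.1)
        (∑ q ∈ Nat.divisorsAntidiagonal (n:ℕ), (((q.1:ℝ) ^ r : ℝ) : ℂ) * G (q.1 * q.2)) :=
      Finset.hasSum _ _
    have h4 : ∑ q ∈ Nat.divisorsAntidiagonal (n:ℕ), (((q.1:ℝ) ^ r : ℝ) : ℂ) * G (q.1 * q.2) = ((rsigma r n : ℝ) : ℂ) * G n := by
      rw [Nat.sum_divisorsAntidiagonal (fun a b => (((a:ℝ) ^ r : ℝ) : ℂ) * G (a * b)), rsigma, Complex.ofReal_sum, Finset.sum_mul]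
      refine Finset.sum_congr rfl fun d hd => ?_
      rw [Nat.mul_div_cancel' (Nat.dvd_of_mem_divisors hd)]
    rw [h4] at h3
    exact h3.congr_fun (fun c => (e c))

lemma Gamma_prod (s : ℝ) (hs : 0 < s) (n : ℕ) :
    Real.Gamma (s + n) = (∏ i ∈ Finset.range n, (s + i)) * Real.Gamma s := by
  induction n with
  | zero => simp
  | succ n ih =>
    rw [Finset.prod_range_succ, show s + ((n + 1 : ℕ) : ℝ) = (s + n) + 1 by push_cast; ring,
      Real.Gamma_add_one (by positivity), ih]
    ring

lemma prod_neg_even (s : ℝ) (m : ℕ) :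
    ∏ i ∈ Finset.range (2 * m), (-s - i : ℝ) = ∏ i ∈ Finset.range (2 * m), (s + i) := by
  have : ∀ i ∈ Finset.range (2 * m), (-s - i : ℝ) = (-1) * (s + i) := fun i _ => by ring
  rw [Finset.prod_congr rfl this, Finset.prod_mul_distrib]
  simp

lemma ppr_eq (m : ℕ) : ppr m = Real.Gamma (2 * m + 1/2) / √π := by
  have h := Gamma_prod (1/2) (by norm_num) (2 * m)
  rw [Real.Gamma_one_half_eq] at h
  rw [ppr, prod_neg_even, show (2 * (m:ℝ) + 1/2) = 1/2 + ((2 * m : ℕ) : ℝ) by push_cast; ring, h]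
  have : √π ≠ 0 := by positivity
  field_simp

lemma Dc_eq (m : ℕ) (x : ℝ) : Dc m x = kap m x * (Real.Gamma (2 * m + 3/2) * 2 / √π) := by
  have h := Gamma_prod (3/2) (by norm_num) (2 * m)
  have h2 : Real.Gamma (3/2) = 1/2 * √π := by
    rw [show (3/2 : ℝ) = 1/2 + 1 by norm_num, Real.Gamma_add_one (by norm_num), Real.Gamma_one_half_eq]
  rw [h2] at h
  rw [Dc, prod_neg_even, show (2 * (m:ℝ) + 3/2) = 3/2 + ((2 * m : ℕ) : ℝ) by push_cast; ring, h]
  have : √π ≠ 0 := by positivity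
  field_simp

lemma Gamma_fact (m : ℕ) : ((2 * m).factorial : ℝ) * Real.Gamma (2 * m + 3/2) = (4 * m + 1).factorial / 2 ^ (4 * m + 1) * √π := by
  have h := Real.Gamma_mul_Gamma_add_half (2 * m + 1)
  rw [show (2 * (2 * (m:ℝ) + 1)) = ((4 * m + 1 : ℕ) : ℝ) + 1 by push_cast; ring, Real.Gamma_nat_eq_factorial,
    show (2 * (m:ℝ) + 1) = ((2 * m : ℕ) : ℝ) + 1 by push_cast; ring, Real.Gamma_nat_eq_factorial,
    show (1 - (((4 * m + 1 : ℕ) : ℝ) + 1)) = -((4 * m + 1 : ℕ) : ℝ) by ring, Real.rpow_neg two_pos.le, Real.rpow_natCast,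
    show ((2 * m : ℕ) : ℝ) + 1 + 1/2 = 2 * m + 3/2 by push_cast; ring] at h
  rw [h, div_eq_mul_inv]

lemma zeta_fe (s : ℝ) (hs : 0 < s) (hs1 : s ≠ 1) :
    riemannZeta (1 - s) = ((2 * (2 * π) ^ (-s) * Real.Gamma s * Real.cos (π * s / 2) : ℝ) : ℂ) * riemannZeta s := by
  rw [riemannZeta_one_sub]
  · rw [show ((2 * (2 * π) ^ (-s) * Real.Gamma s * Real.cos (π * s / 2) : ℝ) : ℂ) =
      2 * (((2 * π : ℝ) ^ (-s) : ℝ) : ℂ) * ((Real.Gamma s : ℝ) : ℂ) * ((Real.cos (π * s / 2) : ℝ) : ℂ) by push_cast; ring,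
      ofReal_cpow (by positivity), ← Complex.Gamma_ofReal, Complex.ofReal_cos]
    push_cast
    rfl
  · intro n h
    have := congrArg Complex.re h
    simp at this
    linarith [(Nat.cast_nonneg n : (0:ℝ) ≤ n)]
  · exact_mod_cast hs1

lemma cos_a (m : ℕ) : Real.cos (π * (2 * m + 1/2) / 2) = (-1) ^ m * (√2 / 2) := by
  rw [show π * (2 * m + 1/2) / 2 = π / 4 + m * π by ring, Real.cos_add_nat_mul_pi, Real.cos_pi_div_four]

lemma cos_b (m : ℕ) : Real.cos (π * (2 * m + 3/2) / 2) = -((-1) ^ m * (√2 / 2)) := by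
  rw [show π * (2 * m + 3/2) / 2 = (π - π / 4) + m * π by ring, Real.cos_add_nat_mul_pi, Real.cos_pi_sub, Real.cos_pi_div_four]
  ring

lemma two_pi_rpow (m : ℕ) : (2 * π) ^ (-(2 * m + 1/2) : ℝ) = ((2 * π) ^ (2 * m) * (√2 * √π))⁻¹ := by
  rw [Real.rpow_neg (by positivity), Real.rpow_add (by positivity), ← Real.sqrt_eq_rpow, Real.sqrt_mul (by norm_num)]
  rw [show (2 * (m:ℝ)) = ((2 * m : ℕ) : ℝ) by push_cast; rfl, Real.rpow_natCast]

lemma zeta_term1 (m : ℕ) {x : ℝ} (hx : 0 < x) :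
    ((2 * cc m x : ℝ) : ℂ) * riemannZeta (2 * m + 1/2) =
      riemannZeta (1 / 2 - 2 * m) / (2 * (π : ℂ) * (Real.sqrt (2 * x) : ℂ)) := by
  have h := zeta_fe (2 * m + 1/2) (by positivity) (by
    intro h
    have h1 : (4 * m + 1 : ℝ) = 2 := by linarith
    have h2 : 4 * m + 1 = 2 := by exact_mod_cast h1
    omega)
  rw [cos_a, two_pi_rpow] at h
  have e : (1 / 2 - 2 * m : ℂ) = 1 - ((2 * m + 1/2 : ℝ) : ℂ) := by push_cast; ring
  rw [e, h, show ((2 * m + 1/2 : ℝ) : ℂ) = 2 * m + 1/2 by push_cast; rfl, mul_div_right_comm]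
  congr 1
  rw [show (2 * (π : ℂ) * (Real.sqrt (2 * x) : ℂ)) = ((2 * π * √(2 * x) : ℝ) : ℂ) by push_cast; rfl, ← ofReal_div]
  congr 1
  rw [cc, ppr_eq, kap, Real.sqrt_mul (by norm_num)]
  have h2 : √2 ^ 2 = 2 := Real.sq_sqrt (by norm_num)
  have hx2 : √x ^ 2 = x := Real.sq_sqrt hx.le
  have s2 : √2 ≠ 0 := by positivity
  have sx : √x ≠ 0 := by positivity
  have sp : √π ≠ 0 := by positivity
  generalize Real.Gamma (2 * m + 1/2) = g
  generalize (2 * π) ^ (2 * m) = q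
  generalize (-1 : ℝ) ^ m = w
  rw [← hx2]
  field_simp
  rw [Real.sqrt_sq (Real.sqrt_nonneg x)]
  rw [h2]
  ring

lemma zeta_term2 (m : ℕ) {x : ℝ} (hx : 0 < x) :
    ((J0 m x + Dc m x : ℝ) : ℂ) * riemannZeta (2 * m + 3/2) =
      - ((Real.sqrt 2 * (π * Real.sqrt x +
            (Nat.factorial (2 * m) : ℝ) / (Real.sqrt 2 * (2 * π * x) ^ (2 * m + 1))) : ℝ) : ℂ) *
          riemannZeta (-1 / 2 - 2 * m) := by
  have h := zeta_fe (2 * m + 3/2) (by positivity) (by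
    intro h
    linarith [(Nat.cast_nonneg m : (0:ℝ) ≤ m)])
  rw [cos_b, show (-(2 * m + 3/2) : ℝ) = -(2 * m + 1/2) - 1 by ring, Real.rpow_sub_one (by positivity), two_pi_rpow] at h
  have e : (-1 / 2 - 2 * m : ℂ) = 1 - ((2 * m + 3/2 : ℝ) : ℂ) := by push_cast; ring
  rw [e, h, show ((2 * m + 3/2 : ℝ) : ℂ) = 2 * m + 3/2 by push_cast; rfl, ← mul_assoc, ← ofReal_neg, ← ofReal_mul]
  congr 2
  have hG := Gamma_fact m
  have s2 : √2 ≠ 0 := by positivity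
  have sp : √π ≠ 0 := by positivity
  have hJ : J0 m x = (2 * m).factorial * Real.Gamma (2 * m + 3/2) / √π * (-1) ^ m * (((2 * π) ^ (2 * m) * (2 * π) * ((2 * π * x) ^ (2 * m + 1)))⁻¹) := by
    rw [hG, J0]
    have e1 : (8 * π ^ 2 * x) ^ (2 * m + 1) = 2 ^ (2 * m + 1) * ((2 * π) ^ (2 * m) * (2 * π) * ((2 * π * x) ^ (2 * m + 1))) := by
      rw [← pow_succ, ← mul_pow, ← mul_pow]; congr 1; ring
    rw [e1, show 4 * m + 1 = 2 * m + (2 * m + 1) by ring, pow_add (2:ℝ) (2 * m) (2 * m + 1)]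
    generalize (2 * π) ^ (2 * m) * (2 * π) * ((2 * π * x) ^ (2 * m + 1)) = q
    field_simp
  rw [hJ, Dc_eq, kap, Real.sqrt_mul (by norm_num)]
  have h2 : √2 ^ 2 = 2 := Real.sq_sqrt (by norm_num)
  have hpos : (2 * π * x) ^ (2 * m + 1) ≠ 0 := by positivity
  have hpos2 : (2 * π) ^ (2 * m) ≠ 0 := by positivity
  generalize Real.Gamma (2 * m + 3/2) = g at *
  generalize (2 * π) ^ (2 * m) = q at *
  generalize (2 * π * x) ^ (2 * m + 1) = y at *
  generalize (-1 : ℝ) ^ m = w at *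
  generalize ((2 * m).factorial : ℝ) = f at *
  generalize √x = u at *
  generalize √2 = v at *
  field_simp
  ring

end CS

namespace CS
open MeasureTheory Filter Topology

noncomputable def G1 (x : ℝ) (n : ℕ) : ℂ := (((n:ℝ) ^ (-(1/2) : ℝ) * (-(Kf x n).im) : ℝ) : ℂ)

noncomputable def A1 (m : ℕ) (x : ℝ) (k b : ℕ) : ℝ :=
  ((b+1:ℕ):ℝ) ^ (-(1/2) : ℝ) * (((k+1:ℕ):ℝ) ^ (2*m) * (-(Kf x (((b+1:ℕ):ℝ) * (k+1:ℕ))).im))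

lemma A1_eq (m : ℕ) (x : ℝ) (k b : ℕ) :
    ((((k + 1 : ℕ) : ℝ) ^ (2 * m + 1/2 : ℝ) : ℝ) : ℂ) * G1 x ((k + 1) * (b + 1)) = (A1 m x k b : ℂ) := by
  rw [G1, A1, ← Complex.ofReal_mul]
  congr 1
  have hk : (0:ℝ) < ((k+1:ℕ):ℝ) := by positivity
  have hb : (0:ℝ) < ((b+1:ℕ):ℝ) := by positivity
  rw [Nat.cast_mul, Real.mul_rpow hk.le hb.le, Real.rpow_add hk,
    show (2*(m:ℝ)) = ((2*m:ℕ):ℝ) by push_cast; rfl, Real.rpow_natCast, Real.rpow_neg hk.le,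
    mul_comm ((k+1:ℕ):ℝ) ((b+1:ℕ):ℝ)]
  have : ((k+1:ℕ):ℝ) ^ (1/2:ℝ) ≠ 0 := by positivity
  generalize ((k+1:ℕ):ℝ) ^ (1/2:ℝ) = w at *
  field_simp

lemma A1_summable (m : ℕ) {x : ℝ} (hx : 0 < x) :
    Summable (fun p : ℕ × ℕ => A1 m x p.1 p.2) := by
  have h3 : Summable (fun j : ℕ => ((j + 1 : ℕ):ℝ) ^ (-(3/2):ℝ)) := summable_rpow_shift (by norm_num)
  set C : ℝ := ((2*(2*m)+3).factorial / al x ^ (2*(2*m)+3) : ℝ) with hC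
  refine Summable.of_norm_bounded ((h3.mul_of_nonneg h3 (fun _ => by positivity) (fun _ => by positivity)).mul_left C) fun p => ?_
  obtain ⟨k, b⟩ := p
  simp only
  have hk : (0:ℝ) < ((k+1:ℕ):ℝ) := by positivity
  have hb : (1:ℝ) ≤ ((b+1:ℕ):ℝ) := by push_cast; linarith [(Nat.cast_nonneg b : (0:ℝ) ≤ b)]
  have hb0 : (0:ℝ) < ((b+1:ℕ):ℝ) := by positivity
  have h := Kf_im_decay (2*m) (t := ((b+1:ℕ):ℝ) * (k+1:ℕ)) hx (by positivity)
  rw [Real.mul_rpow hb0.le hk.le, mul_pow] at h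
  have hp1 : ((b+1:ℕ):ℝ) ^ (-(1/2) : ℝ) ≤ 1 := Real.rpow_le_one_of_one_le_of_nonpos hb (by norm_num)
  have hp2 : 1 ≤ ((b+1:ℕ):ℝ) ^ (2*m) := one_le_pow₀ hb
  rw [A1, Real.norm_eq_abs]
  generalize (-(Kf x (((b+1:ℕ):ℝ) * (k+1:ℕ))).im) = q at *
  rw [abs_mul, abs_of_pos (by positivity : 0 < ((b+1:ℕ):ℝ) ^ (-(1/2) : ℝ))]
  rw [mul_assoc, abs_mul, abs_of_pos (by positivity : 0 < ((b+1:ℕ):ℝ) ^ (2*m))] at h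
  calc _ ≤ 1 * |((k+1:ℕ):ℝ) ^ (2*m) * q| := by gcongr
    _ ≤ ((b+1:ℕ):ℝ) ^ (2*m) * |((k+1:ℕ):ℝ) ^ (2*m) * q| := by gcongr
    _ ≤ _ := h
    _ = _ := by push_cast; ring

lemma zeta_sum (m : ℕ) : ((∑' j : ℕ, ((j + 1 : ℕ):ℝ) ^ (-(2 * m + 3/2) : ℝ) : ℝ) : ℂ) = riemannZeta (2 * m + 3/2) := by
  have hm : (0:ℝ) ≤ m := Nat.cast_nonneg m
  rw [zeta_eq_tsum_one_div_nat_add_one_cpow (by simp; linarith), Complex.ofReal_tsum]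
  refine tsum_congr fun n => ?_
  rw [Complex.ofReal_cpow (by positivity)]
  push_cast
  rw [Complex.cpow_neg, one_div]

lemma lhs_eq (m : ℕ) {x : ℝ} (hx : 0 < x) (hxint : ∀ k : ℤ, x ≠ (k : ℝ)) :
    ∑' n : ℕ, ((rsigma (2 * m + 1/2) (n + 1) : ℝ) : ℂ) * G1 x (n + 1) =
      ((J0 m x + Dc m x : ℝ) : ℂ) * riemannZeta (2 * m + 3/2) +
      ((2 * cc m x : ℝ) : ℂ) * riemannZeta (2 * m + 1/2) +
      2 * ∑' p : ℕ × ℕ, Vt m x (p.1 + 1) (p.2 + 1) := by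
  have hm : (0:ℝ) ≤ m := Nat.cast_nonneg m
  have hA := A1_summable m hx
  have hAc : Summable fun p : ℕ × ℕ => ((A1 m x p.1 p.2 : ℝ) : ℂ) := Complex.ofRealCLM.summable hA
  rw [regroup _ _ (hAc.congr fun p => (A1_eq m x p.1 p.2).symm)]
  rw [tsum_congr fun p : ℕ × ℕ => A1_eq m x p.1 p.2, ← Complex.ofReal_tsum]
  have hA' : Summable (fun p : ℕ × ℕ => A1 m x p.2 p.1) := (Equiv.prodComm ℕ ℕ).summable_iff.2 hA
  have e1 : ∑' p : ℕ × ℕ, A1 m x p.1 p.2 = ∑' p : ℕ × ℕ, A1 m x p.2 p.1 :=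
    ((Equiv.prodComm ℕ ℕ).tsum_eq (fun p : ℕ × ℕ => A1 m x p.1 p.2)).symm
  rw [e1, hA'.tsum_prod]
  have e2 : ∀ b : ℕ, ∑' k : ℕ, A1 m x k b = ((b+1:ℕ):ℝ) ^ (-(2*m+3/2):ℝ) * J0 m x +
      2 * ∑' j:ℕ, -(T m x ((b+1:ℕ):ℝ) (j+1:ℕ)).im := by
    intro b
    exact (poisson_k m hx (b := ((b+1:ℕ):ℝ)) (by positivity)).2.2
  rw [tsum_congr e2]
  obtain ⟨i1, i2⟩ := interchange m hx hxint
  have hz := summable_rpow_shift (s := 2*m+3/2) (by linarith)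
  rw [(hz.mul_right (J0 m x)).tsum_add (i1.mul_left 2), tsum_mul_left, tsum_mul_right, Complex.ofReal_add,
    Complex.ofReal_mul, Complex.ofReal_mul, i2, (rest_summable m hx hxint).2, Complex.ofReal_mul, zeta_sum]
  push_cast
  ring

noncomputable def G2 (m : ℕ) (x : ℝ) (n : ℕ) : ℂ :=
  -((Cp m x * Q m (n / x) : ℝ) : ℂ) +
    ((kap m x / (π * x) * ppr m * (n:ℝ) ^ (-(2 * m + 1/2) : ℝ) : ℝ) : ℂ) * Wm m n x

lemma Vt_eq (m : ℕ) (x : ℝ) (j d : ℕ) :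
    ((((d + 1 : ℕ) : ℝ) ^ (2 * m + 1/2 : ℝ) : ℝ) : ℂ) * G2 m x ((d + 1) * (j + 1)) = Vt m x (j + 1) (d + 1) := by
  rw [G2, Vt, Gf, Nat.mul_comm (d+1) (j+1), Nat.cast_mul]
  have hd : (0:ℝ) < ((d+1:ℕ):ℝ) := by positivity
  have hj : (0:ℝ) < ((j+1:ℕ):ℝ) := by positivity
  rw [Real.mul_rpow hj.le hd.le, Real.rpow_neg hd.le, show ((j+1:ℕ):ℝ) * ((d+1:ℕ):ℝ) / x = ((j+1:ℕ):ℝ) / x * ((d+1:ℕ):ℝ) by ring]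
  have hw : ((d+1:ℕ):ℝ) ^ (2 * m + 1/2 : ℝ) ≠ 0 := by positivity
  generalize ((d+1:ℕ):ℝ) ^ (2 * m + 1/2 : ℝ) = w at *
  generalize ((j+1:ℕ):ℝ) ^ (-(2 * m + 1/2) : ℝ) = u at *
  have hw' : (w:ℂ) ≠ 0 := by exact_mod_cast hw
  generalize Q m (((j+1:ℕ):ℝ) / x * ((d+1:ℕ):ℝ)) = q
  generalize Wm m ((j+1) * (d+1)) x = W
  generalize kap m x / (π * x) * ppr m = y
  push_cast
  field_simp

lemma Vt_regroup (m : ℕ) {x : ℝ} (hx : 0 < x) (hxint : ∀ k : ℤ, x ≠ (k : ℝ)) :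
    ∑' p : ℕ × ℕ, Vt m x (p.1 + 1) (p.2 + 1) =
      ∑' n : ℕ, ((rsigma (2 * m + 1/2) (n + 1) : ℝ) : ℂ) * G2 m x (n + 1) := by
  have hV := Vt_summable m hx hxint
  have hV' : Summable (fun p : ℕ × ℕ => Vt m x (p.2 + 1) (p.1 + 1)) := (Equiv.prodComm ℕ ℕ).summable_iff.2 hV
  rw [regroup _ _ (hV'.congr fun p => (Vt_eq m x p.2 p.1).symm)]
  rw [tsum_congr fun p : ℕ × ℕ => Vt_eq m x p.2 p.1]
  exact ((Equiv.prodComm ℕ ℕ).tsum_eq (fun p : ℕ × ℕ => Vt m x (p.1 + 1) (p.2 + 1))).symm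

lemma Q_two (m : ℕ) (n : ℕ) {x : ℝ} (hx : 0 < x) :
    (1 + Complex.I * ((n : ℂ) + 1) / (x : ℂ)) ^ (-(2 * (m : ℤ) + 1)) +
      (1 - Complex.I * ((n : ℂ) + 1) / (x : ℂ)) ^ (-(2 * (m : ℤ) + 1)) =
    ((2 * Q m (((n+1:ℕ):ℝ) / x) : ℝ) : ℂ) := by
  have hx' : (x:ℂ) ≠ 0 := by exact_mod_cast hx.ne'
  set z : ℂ := 1 + I * (((((n+1:ℕ):ℝ) / x : ℝ)) : ℂ) with hz
  have e1 : 1 + Complex.I * ((n : ℂ) + 1) / (x : ℂ) = z := by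
    rw [hz]; push_cast; ring
  have e2 : 1 - Complex.I * ((n : ℂ) + 1) / (x : ℂ) = (starRingEnd ℂ) z := by
    rw [hz]; simp only [map_add, map_mul, map_one, Complex.conj_I, Complex.conj_ofReal]; push_cast; ring
  have e3 : ∀ w : ℂ, w ^ (-(2 * (m : ℤ) + 1)) = (w ^ (2*m+1))⁻¹ := by
    intro w
    rw [zpow_neg, show (2 * (m : ℤ) + 1) = ((2*m+1:ℕ):ℤ) by push_cast; rfl, zpow_natCast]
  rw [e1, e2, e3, e3, ← map_pow, ← map_inv₀, Complex.add_conj, Q]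

lemma term_match (m n : ℕ) {x : ℝ} (hx : 0 < x) :
    2 * G2 m x (n + 1) = ((Real.sqrt x / (Real.sqrt 2 * (π : ℝ) ^ (2 * (m : ℝ) + 1 / 2)) : ℝ) : ℂ) *
      (((((n : ℝ) + 1) ^ (-(2 * (m : ℝ)) - 3 / 2) : ℝ) : ℂ) *
            (-(2 : ℂ) * (((Nat.factorial (2 * m) : ℝ) / Real.sqrt π : ℝ) : ℂ) *
                (((((n : ℝ) + 1) / (2 * x)) ^ (2 * (m : ℝ) + 3 / 2) : ℝ) : ℂ) *
                ((1 + Complex.I * ((n : ℂ) + 1) / (x : ℂ)) ^ (-(2 * (m : ℤ) + 1)) +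
                  (1 - Complex.I * ((n : ℂ) + 1) / (x : ℂ)) ^ (-(2 * (m : ℤ) + 1)))
              + (-1 : ℂ) ^ m * ((n : ℂ) + 1) /
                  ((((2 : ℝ) ^ (2 * m) : ℝ) : ℂ) * (π : ℂ) * (x : ℂ)) *
                  ((Real.Gamma (2 * m + 1 / 2) : ℝ) : ℂ) * Wm m (n + 1) x)) := by
  rw [Q_two m n hx, G2]
  have hN : (0:ℝ) < (n:ℝ) + 1 := by positivity
  have s2 : √2 ≠ 0 := by positivity
  have sx : √x ≠ 0 := by positivity
  have sp : √π ≠ 0 := by positivity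
  have hpi := Real.pi_pos
  have h2 : √2 ^ 2 = 2 := Real.sq_sqrt (by norm_num)
  have hx2 : √x ^ 2 = x := Real.sq_sqrt hx.le
  have hp2 : √π ^ 2 = π := Real.sq_sqrt hpi.le
  have key1 : Cp m x = Real.sqrt x / (Real.sqrt 2 * (π : ℝ) ^ (2 * (m : ℝ) + 1 / 2)) *
      (((n : ℝ) + 1) ^ (-(2 * (m : ℝ)) - 3 / 2) * (2 * ((Nat.factorial (2 * m) : ℝ) / Real.sqrt π) *
        (((n : ℝ) + 1) / (2 * x)) ^ (2 * (m : ℝ) + 3 / 2))) := by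
    rw [Real.div_rpow hN.le (by positivity), show -(2 * (m : ℝ)) - 3 / 2 = -(2 * (m : ℝ) + 3 / 2) by ring,
      Real.rpow_neg hN.le]
    have hw : ((n:ℝ)+1) ^ (2 * (m : ℝ) + 3 / 2) ≠ 0 := by positivity
    generalize ((n:ℝ)+1) ^ (2 * (m : ℝ) + 3 / 2) = w at *
    rw [show 2 * (m : ℝ) + 3 / 2 = ((2*m+1:ℕ):ℝ) + 1/2 by push_cast; ring,
      show 2 * (m : ℝ) + 1 / 2 = ((2*m:ℕ):ℝ) + 1/2 by push_cast; ring,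
      Real.rpow_add hpi, Real.rpow_add (by positivity : 0 < 2 * x), Real.rpow_natCast, Real.rpow_natCast, ← Real.sqrt_eq_rpow,
      ← Real.sqrt_eq_rpow, Real.sqrt_mul (by norm_num), Cp, mul_pow, mul_pow, mul_pow]
    generalize ((2*m).factorial : ℝ) = f
    rw [pow_succ π]
    have h1 : π ^ (2*m) ≠ 0 := by positivity
    generalize π ^ (2*m) = P at *
    have h3 : x ^ (2*m+1) ≠ 0 := by positivity
    generalize x ^ (2*m+1) = X at *
    generalize (2:ℝ) ^ (2*m+1) = Z at *
    nth_rewrite 1 [← hp2]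
    generalize √π = p at *
    generalize √x = y at *
    generalize √2 = v at *
    field_simp
    try rw [h2]
  have key2 : 2 * (kap m x / (π * x) * ppr m * ((n+1:ℕ):ℝ) ^ (-(2 * m + 1/2) : ℝ)) =
      Real.sqrt x / (Real.sqrt 2 * (π : ℝ) ^ (2 * (m : ℝ) + 1 / 2)) *
      (((n : ℝ) + 1) ^ (-(2 * (m : ℝ)) - 3 / 2) * ((-1) ^ m * ((n:ℝ) + 1) / ((2:ℝ) ^ (2*m) * π * x) * Real.Gamma (2 * m + 1 / 2))) := by
    rw [show -(2 * (m : ℝ) + 1/2) = (-(2 * (m : ℝ)) - 3 / 2) + 1 by ring, Nat.cast_add, Nat.cast_one,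
      Real.rpow_add hN, Real.rpow_one, ppr_eq, kap]
    generalize Real.Gamma (2 * m + 1 / 2) = g
    generalize ((n:ℝ)+1) ^ (-(2 * (m : ℝ)) - 3 / 2) = w at *
    rw [show 2 * (m : ℝ) + 1 / 2 = ((2*m:ℕ):ℝ) + 1/2 by push_cast; ring,
      Real.rpow_add hpi, Real.rpow_natCast, ← Real.sqrt_eq_rpow, Real.sqrt_mul (by norm_num), mul_pow]
    generalize π ^ (2*m) = P at *
    generalize √π = p at *
    generalize √x = y at *
    generalize √2 = v at *
    generalize ((-1:ℝ))^m = r at *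
    generalize ((2:ℝ))^(2*m) = Z at *
    field_simp
    try rw [h2]
    try ring
  have k2 := congrArg (fun t : ℝ => (t : ℂ)) key2
  rw [key1]
  generalize Wm m (n+1) x = W at *
  push_cast at k2 ⊢
  linear_combination W * k2

end CS

theorem coalescence_sin (m : ℕ) (x : ℝ) (hx : 0 < x) (hxint : ∀ k : ℤ, x ≠ (k : ℝ)) :
    (∑' n : ℕ, ((rsigma (2 * m + 1 / 2) (n + 1) / Real.sqrt ((n : ℝ) + 1) *
        Real.exp (-(2 * π * Real.sqrt (2 * ((n : ℝ) + 1) * x))) *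
        Real.sin (2 * π * Real.sqrt (2 * ((n : ℝ) + 1) * x)) : ℝ) : ℂ))
    = riemannZeta (1 / 2 - 2 * m) / (2 * (π : ℂ) * (Real.sqrt (2 * x) : ℂ))
      - ((Real.sqrt 2 * (π * Real.sqrt x +
            (Nat.factorial (2 * m) : ℝ) / (Real.sqrt 2 * (2 * π * x) ^ (2 * m + 1))) : ℝ) : ℂ) *
          riemannZeta (-1 / 2 - 2 * m)
      + ((Real.sqrt x / (Real.sqrt 2 * (π : ℝ) ^ (2 * (m : ℝ) + 1 / 2)) : ℝ) : ℂ) *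
        ∑' n : ℕ,
          ((rsigma (2 * m + 1 / 2) (n + 1) : ℝ) : ℂ) *
            ((((n : ℝ) + 1) ^ (-(2 * (m : ℝ)) - 3 / 2) : ℝ) : ℂ) *
            (-(2 : ℂ) * (((Nat.factorial (2 * m) : ℝ) / Real.sqrt π : ℝ) : ℂ) *
                (((((n : ℝ) + 1) / (2 * x)) ^ (2 * (m : ℝ) + 3 / 2) : ℝ) : ℂ) *
                ((1 + Complex.I * ((n : ℂ) + 1) / (x : ℂ)) ^ (-(2 * (m : ℤ) + 1)) +
                  (1 - Complex.I * ((n : ℂ) + 1) / (x : ℂ)) ^ (-(2 * (m : ℤ) + 1)))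
              + (-1 : ℂ) ^ m * ((n : ℂ) + 1) /
                  ((((2 : ℝ) ^ (2 * m) : ℝ) : ℂ) * (π : ℂ) * (x : ℂ)) *
                  ((Real.Gamma (2 * m + 1 / 2) : ℝ) : ℂ) * Wm m (n + 1) x) := by
  have hL : ∀ n : ℕ, ((rsigma (2 * m + 1 / 2) (n + 1) / Real.sqrt ((n : ℝ) + 1) *
        Real.exp (-(2 * π * Real.sqrt (2 * ((n : ℝ) + 1) * x))) *
        Real.sin (2 * π * Real.sqrt (2 * ((n : ℝ) + 1) * x)) : ℝ) : ℂ) =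
      ((rsigma (2 * m + 1/2) (n + 1) : ℝ) : ℂ) * CS.G1 x (n + 1) := by
    intro n
    have hN : (0:ℝ) ≤ (n:ℝ) + 1 := by positivity
    rw [CS.G1, ← Complex.ofReal_mul]
    congr 1
    rw [CS.Kf, CS.al, Nat.cast_add, Nat.cast_one, Real.rpow_neg hN, ← Real.sqrt_eq_rpow,
      show 2 * ((n:ℝ) + 1) * x = 2 * x * ((n:ℝ) + 1) by ring, Real.sqrt_mul (by positivity) ((n:ℝ) + 1),
      ← mul_assoc (2 * π)]
    generalize 2 * π * √(2 * x) * √((n:ℝ) + 1) = u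
    rw [Complex.exp_im]
    have e1 : (-((1 + Complex.I) * (u:ℂ))).re = -u := by simp
    have e2 : (-((1 + Complex.I) * (u:ℂ))).im = -u := by simp
    rw [e1, e2, Real.sin_neg]
    ring
  rw [tsum_congr hL, CS.lhs_eq m hx hxint, CS.zeta_term1 m hx, CS.zeta_term2 m hx, CS.Vt_regroup m hx hxint,
    ← tsum_mul_left, ← tsum_mul_left]
  have hR : ∀ n : ℕ, 2 * (((rsigma (2 * m + 1/2) (n + 1) : ℝ) : ℂ) * CS.G2 m x (n + 1)) = _ := fun n => by
    rw [mul_left_comm, CS.term_match m n hx]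
  rw [tsum_congr hR]
  have hT : ∀ a b c d : ℂ, c = d → -a + b + c = b - a + d := by
    intro a b c d h
    rw [h]; ring
  rw [neg_mul]
  refine hT _ _ _ _ (tsum_congr fun n => ?_)
  ring
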